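/- arXiv:1701.01265 — 4 statements merged into one kernel-verified Lean document; each statement's English description precedes it below -/
import Mathlib

section
/- Let B : ℝ → ℝ be twice continuously differentiable with 0 ≤ B(ξ) ≤ 1 for all ξ, let θ ∈ [0,1], and let w₀ : ℝ → ℝ be a 1-periodic Lipschitz function whose derivative has bounded total variation on [0,1]. For each k ∈ ℕ let N_k ≥ 2 be an integer with N_k → ∞, set Δx_k = 1/N_k, and let Δt_k > 0 satisfy Δt_k → 0 and the CFL condition Δt_k (1−θ)/(Δx_k)² < 1/2. Suppose (w^{(k),n}_j), n ∈ ℕ, j ∈ ZMod N_k, is a solution of the θ-scheme on this grid with initial data given by cell averages, w^{(k),0}_j = (1/Δx_k) ∫_{x_j − Δx_k/2}^{x_j + Δx_k/2} w₀(x) dx, and let W_k : [0,1] × [0,∞) → ℝ be the interpolation that is continuous piecewise linear in x (with W_k(x_j, t) = w^{(k),n}_j) and piecewise constant in t on [nΔt_k, (n+1)Δt_k). Then there exist a subsequence (k_l) and a function w : [0,1] × [0,∞) → ℝ with w ∈ L^∞, w(·,t) weakly differentiable in x with ∂_x w ∈ L^∞, such that for every T > 0, sup_{t ∈ [0,T]}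 ( ∫₀¹ |W_{k_l}(x,t) − w(x,t)| dx + ∫₀¹ |∂_x W_{k_l}(x,t) − ∂_x w(x,t)| dx ) → 0 as l → ∞, and w is a weak solution: for every smooth function φ : ℝ × [0,∞) → ℝ that is 1-periodic in x and compactly supported in t, ∫₀^∞ ∫₀¹ ( w ∂_t φ − B(w) ∂_x w ∂_x φ − B'(w) (∂_x w)² φ ) dx dt + ∫₀¹ w₀(x) φ(x,0) dx = 0. -/
set_option autoImplicit false

/-- Grid spacing `Δx = 1/N` on the periodic domain `[0,1]`. -/
noncomputable def gridDx (N : ℕ) : ℝ := 1 / N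

/-- `(w n j)` is a solution of the θ-scheme `D_t^+ w^n_j = B(w^{n+θ}_j) D² w^{n+θ}_j`
for `w_t = B(w) w_xx` on a periodic grid of `N` cells, where
`w^{n+θ}_j = θ w^{n+1}_j + (1-θ) w^n_j` and
`D² a_j = (a_{j+1} - 2 a_j + a_{j-1})/(Δx)²`. -/
def IsThetaScheme (N : ℕ) (θ Δt : ℝ) (B : ℝ → ℝ) (w : ℕ → ZMod N → ℝ) : Prop :=
  ∀ (n : ℕ) (j : ZMod N),
    (w (n + 1) j - w n j) / Δt =
      B (θ * w (n + 1) j + (1 - θ) * w n j) *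
        (((θ * w (n + 1) (j + 1) + (1 - θ) * w n (j + 1))
          - 2 * (θ * w (n + 1) j + (1 - θ) * w n j)
          + (θ * w (n + 1) (j - 1) + (1 - θ) * w n (j - 1))) / (gridDx N) ^ 2)

section Grid

variable {N : ℕ} [NeZero N]

theorem ZMod.sum_add_one (f : ZMod N → ℝ) : ∑ j, f (j + 1) = ∑ j, f j :=
  Equiv.sum_comp (Equiv.addRight (1 : ZMod N)) f

theorem ZMod.sum_sub_one (f : ZMod N → ℝ) : ∑ j, f (j - 1) = ∑ j, f j :=
  Equiv.sum_comp (Equiv.subRight (1 : ZMod N)) f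

theorem ZMod.sum_eq_sum_range (f : ZMod N → ℝ) :
    ∑ j, f j = ∑ i ∈ Finset.range N, f (i : ZMod N) := by
  symm
  refine Finset.sum_bij (fun i _ => (i : ZMod N)) (by simp) ?_ ?_ (by simp)
  · intro a ha b hb hab
    have := congrArg ZMod.val hab
    rwa [ZMod.val_natCast_of_lt (Finset.mem_range.1 ha),
      ZMod.val_natCast_of_lt (Finset.mem_range.1 hb)] at this
  · intro b _
    exact ⟨b.val, Finset.mem_range.2 (ZMod.val_lt b), ZMod.natCast_zmod_val b⟩

/-- One-sided discrete maximum principle for the θ-scheme with non-negative weights. -/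
theorem le_of_implicit_average {θ M : ℝ} (hθ0 : 0 ≤ θ) (hθ1 : θ ≤ 1)
    {α β y y' : ZMod N → ℝ} (hα : ∀ j, 0 ≤ α j) (hβ : ∀ j, 0 ≤ β j)
    (hαβ : ∀ j, (α j + β j) * (1 - θ) ≤ 1)
    (h : ∀ j, y' j - y j =
      α j * ((θ * y' (j + 1) + (1 - θ) * y (j + 1)) - (θ * y' j + (1 - θ) * y j))
      - β j * ((θ * y' j + (1 - θ) * y j) - (θ * y' (j - 1) + (1 - θ) * y (j - 1))))
    (hy : ∀ j, y j ≤ M) (j : ZMod N) : y' j ≤ M := by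
  obtain ⟨i, hi⟩ := Finite.exists_max y'
  refine (hi j).trans ?_
  have e := h i
  have h1 : 0 ≤ α i * θ * (y' i - y' (i + 1)) :=
    mul_nonneg (mul_nonneg (hα i) hθ0) (sub_nonneg.2 (hi _))
  have h2 : 0 ≤ β i * θ * (y' i - y' (i - 1)) :=
    mul_nonneg (mul_nonneg (hβ i) hθ0) (sub_nonneg.2 (hi _))
  have h3 : 0 ≤ α i * (1 - θ) * (M - y (i + 1)) :=
    mul_nonneg (mul_nonneg (hα i) (sub_nonneg.2 hθ1)) (sub_nonneg.2 (hy _))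
  have h4 : 0 ≤ β i * (1 - θ) * (M - y (i - 1)) :=
    mul_nonneg (mul_nonneg (hβ i) (sub_nonneg.2 hθ1)) (sub_nonneg.2 (hy _))
  have h5 : 0 ≤ (1 - (α i + β i) * (1 - θ)) * (M - y i) :=
    mul_nonneg (sub_nonneg.2 (hαβ i)) (sub_nonneg.2 (hy _))
  linarith

/-- Two-sided discrete maximum principle for the θ-scheme with non-negative weights. -/
theorem abs_le_of_implicit_average {θ M : ℝ} (hθ0 : 0 ≤ θ) (hθ1 : θ ≤ 1)
    {α β y y' : ZMod N → ℝ} (hα : ∀ j, 0 ≤ α j) (hβ : ∀ j, 0 ≤ β j)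
    (hαβ : ∀ j, (α j + β j) * (1 - θ) ≤ 1)
    (h : ∀ j, y' j - y j =
      α j * ((θ * y' (j + 1) + (1 - θ) * y (j + 1)) - (θ * y' j + (1 - θ) * y j))
      - β j * ((θ * y' j + (1 - θ) * y j) - (θ * y' (j - 1) + (1 - θ) * y (j - 1))))
    (hy : ∀ j, |y j| ≤ M) (j : ZMod N) : |y' j| ≤ M := by
  refine abs_le.2 ⟨?_, le_of_implicit_average hθ0 hθ1 hα hβ hαβ h (fun j => (abs_le.1 (hy j)).2) j⟩
  have := le_of_implicit_average (y := fun j => - y j) (y' := fun j => - y' j)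
    hθ0 hθ1 hα hβ hαβ (fun j => by have := h j; linarith)
    (fun j => neg_le.1 (abs_le.1 (hy j)).1) j
  linarith

/-- `ℓ¹`-contraction for the θ-scheme in conservative form. -/
theorem sum_abs_le_of_conservative {θ : ℝ} (hθ0 : 0 ≤ θ) (hθ1 : θ ≤ 1)
    {g c c' : ZMod N → ℝ} (hg : ∀ j, 0 ≤ g j) (hg1 : ∀ j, (g j + g j) * (1 - θ) ≤ 1)
    (h : ∀ j, c' j - c j =
      g (j + 1) * (θ * c' (j + 1) + (1 - θ) * c (j + 1))
      - 2 * (g j * (θ * c' j + (1 - θ) * c j))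
      + g (j - 1) * (θ * c' (j - 1) + (1 - θ) * c (j - 1))) :
    ∑ j, |c' j| ≤ ∑ j, |c j| := by
  have key : ∀ j, |c' j| ≤ |c j| - 2 * (g j * (θ * |c' j| + (1 - θ) * |c j|))
      + g (j + 1) * (θ * |c' (j + 1)| + (1 - θ) * |c (j + 1)|)
      + g (j - 1) * (θ * |c' (j - 1)| + (1 - θ) * |c (j - 1)|) := by
    intro j
    have e : (1 + 2 * (g j * θ)) * c' j = (1 - (g j + g j) * (1 - θ)) * c j
      + (g (j + 1) * (θ * c' (j + 1) + (1 - θ) * c (j + 1))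
        + g (j - 1) * (θ * c' (j - 1) + (1 - θ) * c (j - 1))) := by
      have := h j; linarith
    have p1 : 0 ≤ 1 + 2 * (g j * θ) := by have := mul_nonneg (hg j) hθ0; linarith
    have p2 : 0 ≤ 1 - (g j + g j) * (1 - θ) := sub_nonneg.2 (hg1 j)
    have p3 : 0 ≤ 1 - θ := sub_nonneg.2 hθ1
    have conv : ∀ a b : ℝ, |θ * a + (1 - θ) * b| ≤ θ * |a| + (1 - θ) * |b| := by
      intro a b
      refine (abs_add_le _ _).trans ?_
      rw [abs_mul, abs_mul, abs_of_nonneg hθ0, abs_of_nonneg p3]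
    have term : ∀ i, |g i * (θ * c' i + (1 - θ) * c i)|
        ≤ g i * (θ * |c' i| + (1 - θ) * |c i|) := by
      intro i
      rw [abs_mul, abs_of_nonneg (hg i)]
      exact mul_le_mul_of_nonneg_left (conv _ _) (hg i)
    have e2 := congrArg abs e
    rw [abs_mul, abs_of_nonneg p1] at e2
    have t1 := abs_add_le ((1 - (g j + g j) * (1 - θ)) * c j)
      (g (j + 1) * (θ * c' (j + 1) + (1 - θ) * c (j + 1))
        + g (j - 1) * (θ * c' (j - 1) + (1 - θ) * c (j - 1)))
    have t2 := abs_add_le (g (j + 1) * (θ * c' (j + 1) + (1 - θ) * c (j + 1)))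
      (g (j - 1) * (θ * c' (j - 1) + (1 - θ) * c (j - 1)))
    rw [abs_mul, abs_of_nonneg p2] at t1
    have := term (j + 1)
    have := term (j - 1)
    linarith
  have s := Finset.sum_le_sum (fun j (_ : j ∈ Finset.univ) => key j)
  rw [Finset.sum_add_distrib, Finset.sum_add_distrib, Finset.sum_sub_distrib,
    ZMod.sum_add_one (fun j => g j * (θ * |c' j| + (1 - θ) * |c j|)),
    ZMod.sum_sub_one (fun j => g j * (θ * |c' j| + (1 - θ) * |c j|)), ← Finset.mul_sum] at s
  linarith

/-- The difference of two values of a periodic grid function is bounded by the sum of its jumps. -/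
theorem abs_sub_le_sum_abs_sub (g : ZMod N → ℝ) (i j : ZMod N) :
    |g j - g i| ≤ ∑ l, |g (l + 1) - g l| := by
  have aux : ∀ i j : ZMod N, i.val ≤ j.val → |g j - g i| ≤ ∑ l, |g (l + 1) - g l| := by
    intro i j hij
    have h := dist_le_Ico_sum_dist (fun n : ℕ => g (n : ZMod N)) hij
    simp only [ZMod.natCast_zmod_val, Real.dist_eq] at h
    rw [abs_sub_comm, ZMod.sum_eq_sum_range]
    refine h.trans ?_
    refine (Finset.sum_le_sum_of_subset_of_nonneg (t := Finset.range N) ?_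
      (fun _ _ _ => abs_nonneg _)).trans (Finset.sum_le_sum fun l _ => ?_)
    · intro l hl
      have := ZMod.val_lt j
      simp only [Finset.mem_Ico, Finset.mem_range] at hl ⊢
      omega
    · rw [abs_sub_comm]; push_cast; exact le_rfl
  rcases le_total i.val j.val with h | h
  · exact aux i j h
  · rw [abs_sub_comm]; exact aux j i h

/-- Interpolation between the sup norm, the `ℓ¹` norm and the Lipschitz constant. -/
theorem sq_le_of_sum_abs_le {f : ZMod N → ℝ} {L M η : ℝ}
    (hL : ∀ j, |f (j + 1) - f j| ≤ L * (1 / N)) (hM : ∀ j, |f j| ≤ M)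
    (hη : ∑ j, |f j| * (1 / N) ≤ η) (j : ZMod N) :
    f j ^ 2 ≤ (M + 2 * L) * η := by
  have hN : (0 : ℝ) < N := Nat.cast_pos.2 (NeZero.pos N)
  have hM0 : 0 ≤ M := (abs_nonneg _).trans (hM 0)
  have hL0 : 0 ≤ L * (1 / N) := (abs_nonneg _).trans (hL 0)
  have jump : ∑ l, |f (l + 1) ^ 2 - f l ^ 2| ≤ 2 * L * η := by
    have h1 : ∀ l, |f (l + 1) ^ 2 - f l ^ 2| ≤ L * (1 / N) * |f (l + 1)| + L * (1 / N) * |f l| := by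
      intro l
      rw [sq_sub_sq, abs_mul, mul_comm, ← mul_add]
      exact mul_le_mul (hL l) (abs_add_le _ _) (abs_nonneg _) hL0
    have h2 := Finset.sum_le_sum (fun l (_ : l ∈ Finset.univ) => h1 l)
    rw [Finset.sum_add_distrib, ← Finset.mul_sum, ← Finset.mul_sum,
      ZMod.sum_add_one (fun l => |f l|)] at h2
    rw [← Finset.sum_mul] at hη
    have hL' : 0 ≤ L := by
      rcases (mul_nonneg_iff_of_pos_right (by positivity : (0 : ℝ) < 1 / N)).1 hL0 with h
      exact h
    have := mul_le_mul_of_nonneg_left hη hL'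
    linarith
  have avg : ∑ i, f i ^ 2 * (1 / N) ≤ M * η := by
    refine le_trans ?_ (mul_le_mul_of_nonneg_left hη hM0)
    rw [Finset.mul_sum]
    refine Finset.sum_le_sum fun i _ => ?_
    rw [← sq_abs, sq, mul_assoc]
    exact mul_le_mul_of_nonneg_right (hM i) (by positivity)
  have each : ∀ i, f j ^ 2 * (1 / N) ≤ f i ^ 2 * (1 / N) + 2 * L * η * (1 / N) := by
    intro i
    rw [← add_mul]
    refine mul_le_mul_of_nonneg_right ?_ (by positivity)
    have := (le_abs_self _).trans ((abs_sub_le_sum_abs_sub (fun l => f l ^ 2) i j).trans jump)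
    linarith
  have s := Finset.sum_le_sum (fun l (_ : l ∈ Finset.univ) => each l)
  rw [Finset.sum_add_distrib, Finset.sum_const, Finset.sum_const, Finset.card_univ, ZMod.card,
    nsmul_eq_mul, nsmul_eq_mul] at s
  have e1 : (N : ℝ) * (f j ^ 2 * (1 / N)) = f j ^ 2 := by field_simp
  have e2 : (N : ℝ) * (2 * L * η * (1 / N)) = 2 * L * η := by field_simp
  rw [e1, e2] at s
  linarith

end Grid

section InitialData

open Set MeasureTheory

theorem exists_monotoneOn_abs_sub_le {g : ℝ → ℝ} (hper : ∀ x, g (x + 1) = g x)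
    (hg : BoundedVariationOn g (Icc 0 1)) :
    ∃ P : ℝ → ℝ, MonotoneOn P (Icc (-1) 2) ∧
      ∀ x ∈ Icc (-1 : ℝ) 2, ∀ y ∈ Icc (-1 : ℝ) 2, x ≤ y → |g y - g x| ≤ P y - P x := by
  have shift : ∀ a b c : ℝ, (∀ x, g (x + c) = g x) →
      eVariationOn g (Icc a b) ≤ eVariationOn g (Icc (a + c) (b + c)) := by
    intro a b c hc
    have h := eVariationOn.comp_le_of_monotoneOn g (s := Icc (a + c) (b + c)) (t := Icc a b)
      (fun x => x + c) (fun x _ y _ h => by simpa using h)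
      (fun x hx => ⟨by linarith [hx.1], by linarith [hx.2]⟩)
    refine le_trans (le_of_eq ?_) h
    congr 1
    ext x
    exact (hc x).symm
  have h1 : eVariationOn g (Icc (-1) 0) ≠ ⊤ := by
    refine ne_top_of_le_ne_top hg ((shift (-1) 0 1 hper).trans (le_of_eq ?_))
    norm_num
  have h2 : eVariationOn g (Icc 1 2) ≠ ⊤ := by
    refine ne_top_of_le_ne_top hg ((shift 1 2 (-1) fun x => ?_).trans (le_of_eq ?_))
    · rw [← hper]; ring_nf
    · norm_num
  have hBV : BoundedVariationOn g (Icc (-1) 2) := by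
    have e1 := eVariationOn.Icc_add_Icc g (s := univ) (a := -1) (b := 0) (c := 1)
      (by norm_num) (by norm_num) trivial
    have e2 := eVariationOn.Icc_add_Icc g (s := univ) (a := -1) (b := 1) (c := 2)
      (by norm_num) (by norm_num) trivial
    simp only [univ_inter] at e1 e2
    unfold BoundedVariationOn
    rw [← e2, ← e1]
    exact ENNReal.add_ne_top.2 ⟨ENNReal.add_ne_top.2 ⟨h1, hg⟩, h2⟩
  obtain ⟨p, q, hp, hq, hpq⟩ := hBV.locallyBoundedVariationOn.exists_monotoneOn_sub_monotoneOn
  refine ⟨p + q, hp.add hq, fun x hx y hy hxy => ?_⟩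
  have := hp hx hy hxy
  have := hq hx hy hxy
  simp only [hpq, Pi.sub_apply, Pi.add_apply]
  rw [abs_le]
  constructor <;> linarith

theorem LipschitzWith.abs_second_difference_le {f P : ℝ → ℝ} {K : NNReal}
    (hf : LipschitzWith K f) (hP : MonotoneOn P (Icc (-1) 2))
    (hPd : ∀ x ∈ Icc (-1 : ℝ) 2, ∀ y ∈ Icc (-1 : ℝ) 2, x ≤ y →
      |deriv f y - deriv f x| ≤ P y - P x)
    {y h : ℝ} (hh : 0 ≤ h) (hy : -1 ≤ y) (hyh : y + 2 * h ≤ 2) :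
    |f (y + 2 * h) - 2 * f (y + h) + f y| ≤ h * (P (y + 2 * h) - P y) := by
  have ac : ∀ a b, AbsolutelyContinuousOnInterval f a b := fun a b =>
    (hf.lipschitzOnWith (s := uIcc a b)).absolutelyContinuousOnInterval
  have i1 := (ac (y + h) (y + h + h)).integral_deriv_eq_sub
  have i2 := (ac y (y + h)).integral_deriv_eq_sub
  have j1 := (ac (y + h) (y + h + h)).intervalIntegrable_deriv
  have j2 := (ac y (y + h)).intervalIntegrable_deriv
  rw [← intervalIntegral.integral_comp_add_right] at i1
  have j1' : IntervalIntegrable (fun x => deriv f (x + h)) volume y (y + h) := by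
    have := j1.comp_add_right h
    simpa using this
  have e : f (y + 2 * h) - 2 * f (y + h) + f y
      = ∫ x in y..(y + h), (deriv f (x + h) - deriv f x) := by
    rw [intervalIntegral.integral_sub j1' j2, i1, i2]
    ring_nf
  rw [e]
  have := intervalIntegral.norm_integral_le_of_norm_le_const (a := y) (b := y + h)
    (f := fun x => deriv f (x + h) - deriv f x) (C := P (y + 2 * h) - P y) (fun x hx => by
      rw [uIoc_of_le (by linarith)] at hx
      have m : ∀ {z}, y ≤ z → z ≤ y + 2 * h → z ∈ Icc (-1 : ℝ) 2 := fun h1 h2 =>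
        ⟨by linarith, by linarith⟩
      have hx1 := hx.1
      have hx2 := hx.2
      have a1 := hPd x (m (by linarith) (by linarith)) (x + h) (m (by linarith) (by linarith))
        (by linarith)
      have a2 := hP (m (by linarith) (by linarith)) (m (by linarith) (by linarith))
        (by linarith : x + h ≤ y + 2 * h)
      have a3 := hP (m (by linarith) (by linarith)) (m (by linarith) (by linarith))
        (by linarith : y ≤ x)
      rw [Real.norm_eq_abs]
      linarith)
  rw [Real.norm_eq_abs, add_sub_cancel_left, abs_of_nonneg hh] at this
  linarith

/-- The average of `f` over the grid cell of width `1 / N` centred at `y`. -/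
noncomputable def cellAverage (N : ℕ) (f : ℝ → ℝ) (y : ℝ) : ℝ :=
  N * ∫ x in (y - 1 / (2 * N))..(y + 1 / (2 * N)), f x

theorem cellAverage_eq (N : ℕ) (f : ℝ → ℝ) (y : ℝ) :
    cellAverage N f y = N * ∫ s in (-(1 / (2 * N : ℝ)))..(1 / (2 * N)), f (y + s) := by
  rw [cellAverage, intervalIntegral.integral_comp_add_left f, sub_eq_add_neg]

theorem abs_mul_integral_cell_le {N : ℕ} (hN : 0 < N) {F : ℝ → ℝ} {C : ℝ}
    (h : ∀ s : ℝ, |s| ≤ 1 / (2 * N) → |F s| ≤ C) :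
    |N * ∫ s in (-(1 / (2 * N : ℝ)))..(1 / (2 * N)), F s| ≤ C := by
  have hN' : (0 : ℝ) < N := Nat.cast_pos.2 hN
  have hp : (0 : ℝ) < 1 / (2 * N) := by positivity
  have := intervalIntegral.norm_integral_le_of_norm_le_const
    (a := -(1 / (2 * N : ℝ))) (b := 1 / (2 * N)) (f := F) (C := C) (fun s hs => by
      rw [uIoc_of_le (by linarith)] at hs
      exact h s (abs_le.2 ⟨hs.1.le, hs.2⟩))
  rw [Real.norm_eq_abs] at this
  rw [abs_mul, abs_of_pos hN']
  refine (mul_le_mul_of_nonneg_left this hN'.le).trans (le_of_eq ?_)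
  rw [sub_neg_eq_add, abs_of_pos (by linarith)]
  field_simp
  ring

theorem cellAverage_add_one {f : ℝ → ℝ} (hper : ∀ x, f (x + 1) = f x) (N : ℕ) (y : ℝ) :
    cellAverage N f (y + 1) = cellAverage N f y := by
  simp only [cellAverage_eq]
  congr 2
  ext s
  rw [← hper (y + s)]
  ring_nf

theorem cellAverage_add_nat {f : ℝ → ℝ} (hper : ∀ x, f (x + 1) = f x) (N : ℕ) (y : ℝ) (n : ℕ) :
    cellAverage N f (y + n) = cellAverage N f y := by
  induction n with
  | zero => simp
  | succ n ih => rw [← ih, ← cellAverage_add_one hper N (y + n)]; push_cast; ring_nf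

theorem cellAverage_val {f : ℝ → ℝ} (hper : ∀ x, f (x + 1) = f x) {N : ℕ} [NeZero N] (i : ℕ) :
    cellAverage N f (((i : ZMod N).val : ℝ) / N) = cellAverage N f ((i : ℝ) / N) := by
  have hN' : (N : ℝ) ≠ 0 := Nat.cast_ne_zero.2 (NeZero.ne N)
  rw [ZMod.val_natCast, ← cellAverage_add_nat hper N _ (i / N)]
  congr 1
  field_simp
  exact_mod_cast (Nat.mod_add_div i N)

/-- Uniform bounds for the grid functions given by the cell averages of a periodic Lipschitz
function whose derivative has bounded variation. -/
theorem cellAverage_bounds {f : ℝ → ℝ} {K : NNReal} (hper : ∀ x, f (x + 1) = f x)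
    (hf : LipschitzWith K f) (hBV : BoundedVariationOn (deriv f) (Icc 0 1)) :
    ∃ M V : ℝ, ∀ (N : ℕ) [NeZero N] (a : ZMod N → ℝ), 2 ≤ N →
      (∀ j, a j = cellAverage N f ((j.val : ℝ) / N)) →
      (∀ j, |a j| ≤ M) ∧ (∀ j, |a (j + 1) - a j| ≤ K * (1 / N)) ∧
      (∑ j, |a (j + 1) - 2 * a j + a (j - 1)| ≤ V * (1 / N)) ∧
      (∀ j, |a j - f ((j.val : ℝ) / N)| ≤ K * (1 / N)) := by
  have lip : ∀ x y, |f x - f y| ≤ K * |x - y| := fun x y => by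
    simpa [Real.dist_eq] using hf.dist_le_mul x y
  have hdper : ∀ x, deriv f (x + 1) = deriv f x := by
    intro x
    rw [← deriv_comp_add_const]
    congr 1
    ext y; exact hper y
  obtain ⟨P, hP, hPd⟩ := exists_monotoneOn_abs_sub_le hdper hBV
  refine ⟨|f 0| + K * 2, 4 * (P 2 - P (-1)), fun N _ a hN2 ha => ?_⟩
  have hN : 0 < N := by omega
  have hN' : (0 : ℝ) < N := Nat.cast_pos.2 hN
  have hN2' : (2 : ℝ) ≤ N := by exact_mod_cast hN2
  have hK : (0 : ℝ) ≤ K := K.2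
  have hh : (1 : ℝ) / N ≤ 1 / 2 := by
    apply one_div_le_one_div_of_le <;> linarith
  have hh0 : (0 : ℝ) < 1 / N := by positivity
  have half : (1 : ℝ) / (2 * N) = 1 / N / 2 := by field_simp
  have hc : Continuous f := hf.continuous
  have ii : ∀ y a b, IntervalIntegrable (fun s => f (y + s)) volume a b := fun y a b =>
    (hc.comp (continuous_const.add continuous_id)).intervalIntegrable _ _
  have hai : ∀ i : ℕ, a (i : ZMod N) = cellAverage N f ((i : ℝ) / N) := fun i => by
    rw [ha, cellAverage_val hper]
  refine ⟨fun j => ?_, fun j => ?_, ?_, fun j => ?_⟩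
  · rw [ha, cellAverage_eq]
    refine abs_mul_integral_cell_le hN fun s hs => ?_
    have h1 := lip (j.val / N + s) 0
    have h2 : (j.val : ℝ) / N ≤ 1 := by
      rw [div_le_one hN']; exact_mod_cast (ZMod.val_lt j).le
    have h3 : (0 : ℝ) ≤ (j.val : ℝ) / N := by positivity
    have h4 : |(j.val : ℝ) / N + s - 0| ≤ 2 := by
      have := abs_le.1 hs
      rw [abs_le]; constructor <;> linarith
    have h5 := abs_sub_abs_le_abs_sub (f (j.val / N + s)) (f 0)
    have h6 := mul_le_mul_of_nonneg_left h4 hK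
    linarith
  · have h1 : a (j + 1) = cellAverage N f ((j.val : ℝ) / N + 1 / N) := by
      have := hai (j.val + 1)
      push_cast at this
      rw [ZMod.natCast_zmod_val] at this
      rw [this]; congr 1; ring
    rw [h1, ha j, cellAverage_eq, cellAverage_eq, ← mul_sub,
      ← intervalIntegral.integral_sub (ii _ _ _) (ii _ _ _)]
    refine abs_mul_integral_cell_le hN fun s _ => (lip _ _).trans (le_of_eq ?_)
    rw [show (j.val : ℝ) / N + 1 / N + s - (j.val / N + s) = 1 / N by ring, abs_of_pos hh0]
  · have e1 : ∑ j, |a (j + 1) - 2 * a j + a (j - 1)|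
        = ∑ j, |a (j + 1 + 1) - 2 * a (j + 1) + a j| := by
      rw [← ZMod.sum_add_one]; simp only [add_sub_cancel_right]
    rw [e1, ZMod.sum_eq_sum_range]
    have term : ∀ i ∈ Finset.range N,
        |a ((i : ZMod N) + 1 + 1) - 2 * a ((i : ZMod N) + 1) + a (i : ZMod N)|
          ≤ (P (((i + 4 : ℕ) : ℝ) * (1 / N) - 1 / N) - P ((i : ℝ) * (1 / N) - 1 / N))
            * (1 / N) := by
      intro i hi
      have hiN : (i : ℝ) + 1 ≤ N := by exact_mod_cast Finset.mem_range.1 hi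
      have hiN' : (i : ℝ) * (1 / N) + 1 / N ≤ 1 := by
        have := mul_le_mul_of_nonneg_right hiN hh0.le
        rw [mul_one_div_cancel hN'.ne'] at this
        linarith
      have hi0 : (0 : ℝ) ≤ (i : ℝ) * (1 / N) := by positivity
      have b1 := hai (i + 1)
      have b2 := hai (i + 1 + 1)
      push_cast at b1 b2
      rw [b1, b2, hai i, cellAverage_eq, cellAverage_eq, cellAverage_eq,
        mul_left_comm, ← mul_sub, ← mul_add, ← intervalIntegral.integral_const_mul,
        ← intervalIntegral.integral_sub (ii _ _ _) ((ii _ _ _).const_mul _),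
        ← intervalIntegral.integral_add ((ii _ _ _).sub ((ii _ _ _).const_mul _)) (ii _ _ _)]
      refine abs_mul_integral_cell_le hN fun s hs => ?_
      have hs' := abs_le.1 hs
      rw [half] at hs'
      have d := hf.abs_second_difference_le hP hPd (y := (i : ℝ) * (1 / N) + s) hh0.le
        (by linarith) (by linarith)
      rw [show ((i : ℝ) + 1 + 1) / N + s = i * (1 / N) + s + 2 * (1 / N) by ring,
        show ((i : ℝ) + 1) / N + s = i * (1 / N) + s + 1 / N by ring,
        show (i : ℝ) / N + s = i * (1 / N) + s by ring]
      refine d.trans ?_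
      rw [mul_comm]
      refine mul_le_mul_of_nonneg_right ?_ hh0.le
      have m1 := hP (a := (i : ℝ) * (1 / N) + s + 2 * (1 / N))
        (b := ((i + 4 : ℕ) : ℝ) * (1 / N) - 1 / N)
        ⟨by linarith, by linarith⟩ ⟨by push_cast; linarith, by push_cast; linarith⟩
        (by push_cast; linarith)
      have m2 := hP (a := (i : ℝ) * (1 / N) - 1 / N) (b := (i : ℝ) * (1 / N) + s)
        ⟨by linarith, by linarith⟩ ⟨by linarith, by linarith⟩ (by linarith)
      linarith
    refine (Finset.sum_le_sum term).trans ?_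
    rw [← Finset.sum_mul]
    refine mul_le_mul_of_nonneg_right ?_ hh0.le
    have tel : ∀ (Q : ℕ → ℝ) (n : ℕ), ∑ i ∈ Finset.range n, (Q (i + 4) - Q i)
        = (Q n - Q 0) + (Q (n + 1) - Q 1) + (Q (n + 2) - Q 2) + (Q (n + 3) - Q 3) := by
      intro Q n
      induction n with
      | zero => simp
      | succ n ih => rw [Finset.sum_range_succ, ih]; ring_nf
    have := tel (fun i => P ((i : ℝ) * (1 / N) - 1 / N)) N
    rw [this]
    have hNN : (N : ℝ) * (1 / N) = 1 := mul_one_div_cancel hN'.ne'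
    have d : ∀ m : ℕ, m ≤ 3 →
        P (((N + m : ℕ) : ℝ) * (1 / N) - 1 / N) - P ((m : ℝ) * (1 / N) - 1 / N)
        ≤ P 2 - P (-1) := by
      intro m hm
      have hm' : (m : ℝ) ≤ 3 := by exact_mod_cast hm
      have hm0 : (0 : ℝ) ≤ m * (1 / N) := by positivity
      have hm1 : (m : ℝ) * (1 / N) ≤ 3 * (1 / N) := mul_le_mul_of_nonneg_right hm' hh0.le
      have m1 := hP (a := ((N + m : ℕ) : ℝ) * (1 / N) - 1 / N) (b := 2)
        ⟨by push_cast; linarith, by push_cast; linarith⟩ ⟨by norm_num, le_rfl⟩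
        (by push_cast; linarith)
      have m2 := hP (a := -1) (b := (m : ℝ) * (1 / N) - 1 / N) ⟨le_rfl, by norm_num⟩
        ⟨by linarith, by linarith⟩ (by linarith)
      linarith
    have d0 := d 0 (by norm_num)
    have d1 := d 1 (by norm_num)
    have d2 := d 2 (by norm_num)
    have d3 := d 3 (by norm_num)
    simp only [add_zero] at d0
    linarith
  · have e : a j - f ((j.val : ℝ) / N) = N * ∫ s in (-(1 / (2 * N : ℝ)))..(1 / (2 * N)),
        (f (j.val / N + s) - f (j.val / N)) := by
      rw [intervalIntegral.integral_sub (ii _ _ _) (by simp), ha j, cellAverage_eq, mul_sub,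
        intervalIntegral.integral_const, smul_eq_mul]
      congr 1
      field_simp
      ring
    rw [e]
    refine abs_mul_integral_cell_le hN fun s hs => (lip _ _).trans ?_
    rw [add_sub_cancel_left]
    refine mul_le_mul_of_nonneg_left (hs.trans ?_) hK
    linarith

end InitialData

section Scheme

variable {N : ℕ}

/-- Uniform bounds for a family of periodic grid functions: sup norm, Lipschitz constant,
variation of the difference quotients, and time modulus of continuity. -/
structure GridBounds (N : ℕ) [NeZero N] (Δt M L V C : ℝ) (w : ℕ → ZMod N → ℝ) : Prop where
  sup : ∀ n j, |w n j| ≤ M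
  lip : ∀ n j, |w n (j + 1) - w n j| ≤ L * (1 / N)
  var : ∀ n, ∑ j, |w n (j + 1) - 2 * w n j + w n (j - 1)| ≤ V * (1 / N)
  time : ∀ m n, m ≤ n → ∀ j, (w n j - w m j) ^ 2 ≤ C * (((n : ℝ) - m) * Δt)

variable {θ Δt : ℝ} {B : ℝ → ℝ} {w : ℕ → ZMod N → ℝ}

theorem IsThetaScheme.sub_eq (hw : IsThetaScheme N θ Δt B w) (hΔt : 0 < Δt) (n : ℕ) (j : ZMod N) :
    w (n + 1) j - w n j = Δt / (gridDx N) ^ 2 * B (θ * w (n + 1) j + (1 - θ) * w n j) *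
      (θ * (w (n + 1) (j + 1) - 2 * w (n + 1) j + w (n + 1) (j - 1))
        + (1 - θ) * (w n (j + 1) - 2 * w n j + w n (j - 1))) := by
  have := hw n j
  rw [div_eq_iff hΔt.ne'] at this
  rw [this]
  ring

theorem IsThetaScheme.gridBounds [NeZero N] (hw : IsThetaScheme N θ Δt B w)
    (hB0 : ∀ ξ, 0 ≤ B ξ) (hB1 : ∀ ξ, B ξ ≤ 1) (hθ0 : 0 ≤ θ) (hθ1 : θ ≤ 1) (hΔt : 0 < Δt)
    (hCFL : Δt / (gridDx N) ^ 2 * (1 - θ) < 1 / 2) {M L V : ℝ}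
    (h0 : ∀ j, |w 0 j| ≤ M) (hL : ∀ j, |w 0 (j + 1) - w 0 j| ≤ L * (1 / N))
    (hV : ∑ j, |w 0 (j + 1) - 2 * w 0 j + w 0 (j - 1)| ≤ V * (1 / N)) :
    GridBounds N Δt M L V ((2 * M + 4 * L) * V) w := by
  have hN : (0 : ℝ) < N := Nat.cast_pos.2 (NeZero.pos N)
  set μ := Δt / (gridDx N) ^ 2 with hμ
  have hμ0 : 0 ≤ μ := by positivity
  have hμN : μ = Δt * (N * N) := by
    rw [hμ, gridDx]; field_simp
  have eq := hw.sub_eq hΔt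
  rw [← hμ] at eq
  have hb0 : ∀ ξ, 0 ≤ μ * B ξ := fun ξ => mul_nonneg hμ0 (hB0 ξ)
  have hbθ : ∀ ξ η, (μ * B ξ + μ * B η) * (1 - θ) ≤ 1 := by
    intro ξ η
    have h1 := mul_le_mul_of_nonneg_left (hB1 ξ) (mul_nonneg hμ0 (sub_nonneg.2 hθ1))
    have h2 := mul_le_mul_of_nonneg_left (hB1 η) (mul_nonneg hμ0 (sub_nonneg.2 hθ1))
    linarith
  have hsup : ∀ n j, |w n j| ≤ M := by
    intro n
    induction n with
    | zero => exact h0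
    | succ n ih =>
      refine abs_le_of_implicit_average hθ0 hθ1
        (α := fun j => μ * B (θ * w (n + 1) j + (1 - θ) * w n j))
        (β := fun j => μ * B (θ * w (n + 1) j + (1 - θ) * w n j))
        (fun j => hb0 _) (fun j => hb0 _) (fun j => hbθ _ _) (fun j => ?_) ih
      rw [eq n j]; ring
  have hlip : ∀ n j, |w n (j + 1) - w n j| ≤ L * (1 / N) := by
    intro n
    induction n with
    | zero => exact hL
    | succ n ih =>
      refine abs_le_of_implicit_average (y' := fun j => w (n + 1) (j + 1) - w (n + 1) j)
        (y := fun j => w n (j + 1) - w n j) hθ0 hθ1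
        (α := fun j => μ * B (θ * w (n + 1) (j + 1) + (1 - θ) * w n (j + 1)))
        (β := fun j => μ * B (θ * w (n + 1) j + (1 - θ) * w n j))
        (fun j => hb0 _) (fun j => hb0 _) (fun j => hbθ _ _) (fun j => ?_) ih
      have e1 := eq n (j + 1)
      have e2 := eq n j
      simp only [add_sub_cancel_right, sub_add_cancel] at e1 ⊢
      linear_combination e1 - e2
  have hvar : ∀ n, ∑ j, |w n (j + 1) - 2 * w n j + w n (j - 1)| ≤ V * (1 / N) := by
    intro n
    induction n with
    | zero => exact hV
    | succ n ih =>
      refine le_trans ?_ ih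
      refine sum_abs_le_of_conservative hθ0 hθ1
        (g := fun j => μ * B (θ * w (n + 1) j + (1 - θ) * w n j))
        (c := fun j => w n (j + 1) - 2 * w n j + w n (j - 1))
        (c' := fun j => w (n + 1) (j + 1) - 2 * w (n + 1) j + w (n + 1) (j - 1))
        (fun j => hb0 _) (fun j => hbθ _ _) (fun j => ?_)
      have e1 := eq n (j + 1)
      have e2 := eq n j
      have e3 := eq n (j - 1)
      simp only [add_sub_cancel_right, sub_add_cancel] at e1 e3 ⊢
      linear_combination e1 - 2 * e2 + e3
  refine ⟨hsup, hlip, hvar, ?_⟩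
  have step : ∀ n, ∑ j, |w (n + 1) j - w n j| * (1 / N) ≤ V * Δt := by
    intro n
    have t : ∀ j, |w (n + 1) j - w n j| ≤
        μ * (θ * |w (n + 1) (j + 1) - 2 * w (n + 1) j + w (n + 1) (j - 1)|
          + (1 - θ) * |w n (j + 1) - 2 * w n j + w n (j - 1)|) := by
      intro j
      rw [eq n j, abs_mul, abs_of_nonneg (hb0 _)]
      refine mul_le_mul ?_ ?_ (abs_nonneg _) hμ0
      · simpa using mul_le_mul_of_nonneg_left (hB1 (θ * w (n + 1) j + (1 - θ) * w n j)) hμ0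
      · refine (abs_add_le _ _).trans ?_
        rw [abs_mul, abs_mul, abs_of_nonneg hθ0, abs_of_nonneg (sub_nonneg.2 hθ1)]
    have s := Finset.sum_le_sum (fun j (_ : j ∈ Finset.univ) => t j)
    rw [← Finset.mul_sum, Finset.sum_add_distrib, ← Finset.mul_sum, ← Finset.mul_sum] at s
    have v1 := mul_le_mul_of_nonneg_left (hvar (n + 1)) hθ0
    have v2 := mul_le_mul_of_nonneg_left (hvar n) (sub_nonneg.2 hθ1)
    have s2 : ∑ j, |w (n + 1) j - w n j| ≤ μ * (V * (1 / N)) :=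
      s.trans (mul_le_mul_of_nonneg_left (by linarith) hμ0)
    rw [← Finset.sum_mul]
    refine (mul_le_mul_of_nonneg_right s2 (by positivity)).trans (le_of_eq ?_)
    rw [hμN]; field_simp
  have multi : ∀ m n, m ≤ n →
      ∑ j, |w n j - w m j| * (1 / N) ≤ V * (((n : ℝ) - m) * Δt) := by
    intro m n hmn
    induction n, hmn using Nat.le_induction with
    | base => simp
    | succ n _ ih =>
      have t : ∑ j, |w (n + 1) j - w m j| * (1 / N)
          ≤ ∑ j, |w (n + 1) j - w n j| * (1 / N) + ∑ j, |w n j - w m j| * (1 / (N : ℝ)) := by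
        rw [← Finset.sum_add_distrib]
        refine Finset.sum_le_sum fun j _ => ?_
        rw [← add_mul]
        exact mul_le_mul_of_nonneg_right (abs_sub_le _ _ _) (by positivity)
      have := step n
      push_cast
      linarith
  intro m n hmn j
  have := sq_le_of_sum_abs_le (f := fun j => w n j - w m j) (L := 2 * L) (M := 2 * M)
    (fun j => by
      have h1 := abs_le.1 (hlip n j)
      have h2 := abs_le.1 (hlip m j)
      rw [abs_le]; constructor <;> linarith)
    (fun j => by
      have h1 := abs_le.1 (hsup n j)
      have h2 := abs_le.1 (hsup m j)
      rw [abs_le]; constructor <;> linarith)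
    (multi m n hmn) j
  refine this.trans (le_of_eq ?_)
  ring

end Scheme

section StepFunctions

open Set MeasureTheory

/-- The function equal to `f i` on the cell `[i / N, (i + 1) / N)`. -/
noncomputable def stepFun (N : ℕ) (f : ℕ → ℝ) (x : ℝ) : ℝ := f ⌊x * N⌋₊

/-- Forward difference quotient on the grid with `N` cells. -/
noncomputable def gridSlope (N : ℕ) (f : ℕ → ℝ) (i : ℕ) : ℝ := (f (i + 1) - f i) * N

theorem measurable_stepFun (N : ℕ) (f : ℕ → ℝ) : Measurable (stepFun N f) :=
  (measurable_from_nat (f := f)).comp (Nat.measurable_floor.comp (measurable_id.mul_const _))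

theorem floor_mul_eq {N : ℕ} (hN : 0 < N) {i : ℕ} {x : ℝ}
    (hx : x ∈ Ico ((i : ℝ) / N) (((i : ℝ) + 1) / N)) : ⌊x * N⌋₊ = i := by
  have hN' : (0 : ℝ) < N := Nat.cast_pos.2 hN
  have h1 := (div_le_iff₀ hN').1 hx.1
  have h2 := (lt_div_iff₀ hN').1 hx.2
  exact (Nat.floor_eq_iff ((Nat.cast_nonneg i).trans h1)).2 ⟨h1, h2⟩

theorem mem_Ico_floor {N : ℕ} (hN : 0 < N) {x : ℝ} (hx : 0 ≤ x) :
    x ∈ Ico ((⌊x * N⌋₊ : ℝ) / N) (((⌊x * N⌋₊ : ℝ) + 1) / N) := by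
  have hN' : (0 : ℝ) < N := Nat.cast_pos.2 hN
  exact ⟨(div_le_iff₀ hN').2 (Nat.floor_le (by positivity)),
    (lt_div_iff₀ hN').2 (Nat.lt_floor_add_one _)⟩

theorem floor_mul_lt {N : ℕ} (hN : 0 < N) {x : ℝ} (hx : x < 1) : ⌊x * N⌋₊ < N := by
  have hN' : (0 : ℝ) < N := Nat.cast_pos.2 hN
  rw [Nat.floor_lt' hN.ne']
  nlinarith

theorem abs_floor_div_sub_le {N : ℕ} (hN : 0 < N) {x : ℝ} (hx : 0 ≤ x) :
    |(⌊x * N⌋₊ : ℝ) / N - x| ≤ 1 / N := by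
  have h := mem_Ico_floor hN hx
  have h2 := h.2
  rw [add_div] at h2
  rw [abs_le]; constructor <;> linarith [h.1]

theorem intervalIntegrable_of_abs_le {g : ℝ → ℝ} (hg : Measurable g) {C : ℝ}
    (hC : ∀ x, |g x| ≤ C) (a b : ℝ) : IntervalIntegrable g volume a b :=
  (intervalIntegrable_const (c := C)).mono_fun hg.aestronglyMeasurable
    (Filter.Eventually.of_forall fun x => by
      simpa using (hC x).trans (le_abs_self C))

theorem ae_restrict_uIoc_iff_cell {P : ℝ → Prop} {a b : ℝ} (hab : a ≤ b)
    (h : ∀ x ∈ Ico a b, P x) : ∀ᵐ x ∂volume, x ∈ uIoc a b → P x := by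
  have : ∀ᵐ x ∂(volume : Measure ℝ), x ≠ b := by
    simp [ae_iff, measure_singleton]
  filter_upwards [this] with x hx hxm
  rw [uIoc_of_le hab] at hxm
  exact h x ⟨hxm.1.le, lt_of_le_of_ne hxm.2 hx⟩

theorem integral_eq_sum_cells {N : ℕ} (hN : 0 < N) {g : ℝ → ℝ}
    (hg : ∀ a b, IntervalIntegrable g volume a b) :
    ∫ x in (0 : ℝ)..1, g x
      = ∑ i ∈ Finset.range N, ∫ x in ((i : ℝ) / N)..(((i : ℝ) + 1) / N), g x := by
  have h := intervalIntegral.sum_integral_adjacent_intervals (μ := volume) (f := g)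
    (a := fun i : ℕ => (i : ℝ) / N) (n := N) (fun _ _ => hg _ _)
  have hN' : (N : ℝ) ≠ 0 := Nat.cast_ne_zero.2 hN.ne'
  simp only [Nat.cast_zero, zero_div, div_self hN', Nat.cast_add, Nat.cast_one] at h
  exact h.symm

theorem integral_cell_mul_stepFun {N : ℕ} (hN : 0 < N) (g : ℝ → ℝ) (f : ℕ → ℝ) (i : ℕ) :
    ∫ x in ((i : ℝ) / N)..(((i : ℝ) + 1) / N), g x * stepFun N f x
      = f i * ∫ x in ((i : ℝ) / N)..(((i : ℝ) + 1) / N), g x := by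
  rw [← intervalIntegral.integral_const_mul]
  refine intervalIntegral.integral_congr_ae (ae_restrict_uIoc_iff_cell ?_ fun x hx => ?_)
  · gcongr; linarith
  · rw [stepFun, floor_mul_eq hN hx, mul_comm]

theorem integral_cell_stepFun {N : ℕ} (hN : 0 < N) (f : ℕ → ℝ) (i : ℕ) :
    ∫ x in ((i : ℝ) / N)..(((i : ℝ) + 1) / N), stepFun N f x = f i * (1 / N) := by
  have := integral_cell_mul_stepFun hN (fun _ => 1) f i
  simp only [one_mul, intervalIntegral.integral_const, smul_eq_mul, mul_one] at this
  rw [this]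
  ring

theorem intervalIntegrable_stepFun (N : ℕ) (f : ℕ → ℝ) {C : ℝ} (hC : ∀ i, |f i| ≤ C) (a b : ℝ) :
    IntervalIntegrable (stepFun N f) volume a b :=
  intervalIntegrable_of_abs_le (measurable_stepFun N f) (fun _ => hC _) a b

theorem integral_stepFun {N : ℕ} (hN : 0 < N) (f : ℕ → ℝ) {C : ℝ} (hC : ∀ i, |f i| ≤ C) :
    ∫ x in (0 : ℝ)..1, stepFun N f x = ∑ i ∈ Finset.range N, f i * (1 / N) := by
  rw [integral_eq_sum_cells hN (intervalIntegrable_stepFun N f hC)]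
  exact Finset.sum_congr rfl fun i _ => integral_cell_stepFun hN f i

theorem sum_range_mul_sub_eq {N : ℕ} {f F : ℕ → ℝ} (hf : f N = f 0) (hF : F N = F 0) :
    ∑ i ∈ Finset.range N, f i * (F (i + 1) - F i)
      = - ∑ i ∈ Finset.range N, (f (i + 1) - f i) * F (i + 1) := by
  have h1 := Finset.sum_range_succ (fun i => f i * F i) N
  have h2 := Finset.sum_range_succ' (fun i => f i * F i) N
  rw [hf, hF] at h1
  have h3 : ∑ i ∈ Finset.range N, f i * F i = ∑ i ∈ Finset.range N, f (i + 1) * F (i + 1) := by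
    linarith
  simp only [mul_sub, sub_mul, Finset.sum_sub_distrib]
  rw [h3]
  ring

theorem integral_mul_stepFun_eq {N : ℕ} (hN : 0 < N) {f F : ℕ → ℝ} {g : ℝ → ℝ} {C : ℝ}
    (hC : ∀ i, |f i| ≤ C) (hg : ∀ a b, IntervalIntegrable g volume a b)
    (hf : f N = f 0) (hF : F N = F 0)
    (hgF : ∀ i : ℕ, ∫ x in ((i : ℝ) / N)..(((i : ℝ) + 1) / N), g x = F (i + 1) - F i) :
    ∫ x in (0 : ℝ)..1, g x * stepFun N f x
      = - ∑ i ∈ Finset.range N, (f (i + 1) - f i) * F (i + 1) := by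
  rw [integral_eq_sum_cells hN, ← sum_range_mul_sub_eq hf hF]
  · exact Finset.sum_congr rfl fun i _ => by rw [integral_cell_mul_stepFun hN, hgF]
  · intro a b
    have hm := (measurable_stepFun N f).aestronglyMeasurable (μ := volume)
    have hb : ∀ x, ‖stepFun N f x‖ ≤ C := fun x => hC _
    exact ⟨(hg a b).1.mul_bdd (c := C) hm.restrict (Filter.Eventually.of_forall hb),
      (hg a b).2.mul_bdd (c := C) hm.restrict (Filter.Eventually.of_forall hb)⟩

/-- An `N`-periodic grid function with slopes bounded by `L` whose slopes have total variation
at most `V`. -/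
structure IsRegularGrid (N : ℕ) (L V : ℝ) (p : ℕ → ℝ) : Prop where
  per : ∀ i, p (i + N) = p i
  slope : ∀ i, |gridSlope N p i| ≤ L
  var : ∑ i ∈ Finset.range N, |gridSlope N p (i + 1) - gridSlope N p i| ≤ V

namespace IsRegularGrid

variable {N : ℕ} {L V : ℝ} {p : ℕ → ℝ}

theorem nonneg_L (hp : IsRegularGrid N L V p) : 0 ≤ L := (abs_nonneg _).trans (hp.slope 0)

theorem nonneg_V (hp : IsRegularGrid N L V p) : 0 ≤ V :=
  (Finset.sum_nonneg fun _ _ => abs_nonneg _).trans hp.var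

theorem slope_period (hp : IsRegularGrid N L V p) (i : ℕ) :
    gridSlope N p (i + N) = gridSlope N p i := by
  rw [gridSlope, gridSlope, hp.per, add_right_comm, hp.per]

theorem intervalIntegrable_slope (hp : IsRegularGrid N L V p) (a b : ℝ) :
    IntervalIntegrable (stepFun N (gridSlope N p)) volume a b :=
  intervalIntegrable_stepFun N _ hp.slope a b

theorem integral_cell_slope (hN : 0 < N) (i : ℕ) :
    ∫ x in ((i : ℝ) / N)..(((i : ℝ) + 1) / N), stepFun N (gridSlope N p) x
      = p (i + 1) - p i := by
  have hN' : (N : ℝ) ≠ 0 := Nat.cast_ne_zero.2 hN.ne'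
  rw [integral_cell_stepFun hN, gridSlope]
  field_simp

theorem integral_slope (hp : IsRegularGrid N L V p) (hN : 0 < N) (i : ℕ) :
    ∫ x in (0 : ℝ)..((i : ℝ) / N), stepFun N (gridSlope N p) x = p i - p 0 := by
  have h := intervalIntegral.sum_integral_adjacent_intervals (μ := volume)
    (f := stepFun N (gridSlope N p))
    (a := fun i : ℕ => (i : ℝ) / N) (n := i) (fun _ _ => hp.intervalIntegrable_slope _ _)
  simp only [Nat.cast_zero, zero_div, Nat.cast_add, Nat.cast_one, integral_cell_slope hN] at h
  rw [← h, Finset.sum_range_sub]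

/-- The piecewise linear interpolation of a regular grid function. -/
noncomputable def interp (N : ℕ) (p : ℕ → ℝ) (x : ℝ) : ℝ :=
  p 0 + ∫ y in (0 : ℝ)..x, stepFun N (gridSlope N p) y

theorem interp_node (hp : IsRegularGrid N L V p) (hN : 0 < N) (i : ℕ) :
    interp N p ((i : ℝ) / N) = p i := by
  rw [interp, hp.integral_slope hN]; ring

theorem interp_sub (hp : IsRegularGrid N L V p) (x y : ℝ) :
    interp N p y - interp N p x = ∫ s in x..y, stepFun N (gridSlope N p) s := by
  rw [interp, interp, add_sub_add_left_eq_sub, intervalIntegral.integral_interval_sub_left]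
  all_goals exact hp.intervalIntegrable_slope _ _

theorem interp_one (hp : IsRegularGrid N L V p) (hN : 0 < N) : interp N p 1 = interp N p 0 := by
  have h1 := hp.interp_node hN N
  have h0 := hp.interp_node hN 0
  have hN' : (N : ℝ) ≠ 0 := Nat.cast_ne_zero.2 hN.ne'
  rw [div_self hN'] at h1
  rw [Nat.cast_zero, zero_div] at h0
  rw [h1, h0]
  simpa using hp.per 0

theorem abs_interp_sub_stepFun_le (hp : IsRegularGrid N L V p) (hN : 0 < N) {x : ℝ} (hx : 0 ≤ x) :
    |interp N p x - stepFun N p x| ≤ L * (1 / N) := by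
  have e : stepFun N p x = interp N p ((⌊x * N⌋₊ : ℝ) / N) := (hp.interp_node hN _).symm
  rw [e, hp.interp_sub, ← Real.norm_eq_abs]
  refine (intervalIntegral.norm_integral_le_of_norm_le_const (C := L)
    fun s _ => hp.slope _).trans ?_
  rw [abs_sub_comm]
  exact mul_le_mul_of_nonneg_left (abs_floor_div_sub_le hN hx) hp.nonneg_L

theorem abs_integral_mul_slope_le (hp : IsRegularGrid N L V p) (hN : 0 < N)
    {g F : ℝ → ℝ} (hg : ∀ a b, IntervalIntegrable g volume a b)
    (hgF : ∀ a b, ∫ x in a..b, g x = F b - F a) (hF : F 1 = F 0) {η : ℝ}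
    (hη : ∀ x ∈ Icc (0 : ℝ) 1, |F x| ≤ η) :
    |∫ x in (0 : ℝ)..1, g x * stepFun N (gridSlope N p) x| ≤ V * η := by
  have hN' : (0 : ℝ) < N := Nat.cast_pos.2 hN
  have h := integral_mul_stepFun_eq hN (f := gridSlope N p) (F := fun i => F ((i : ℝ) / N))
    hp.slope hg (by simpa using hp.slope_period 0) (by simpa [div_self hN'.ne'] using hF)
    (fun i => by rw [hgF, Nat.cast_add, Nat.cast_one])
  have hη0 : 0 ≤ η := (abs_nonneg _).trans (hη 0 ⟨le_rfl, zero_le_one⟩)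
  rw [h, abs_neg]
  refine (Finset.abs_sum_le_sum_abs _ _).trans ?_
  refine le_trans ?_ (mul_le_mul_of_nonneg_right hp.var hη0)
  rw [Finset.sum_mul]
  refine Finset.sum_le_sum fun i hi => ?_
  rw [abs_mul]
  refine mul_le_mul_of_nonneg_left (hη _ ⟨by positivity, ?_⟩) (abs_nonneg _)
  rw [div_le_one hN']
  exact_mod_cast Finset.mem_range.1 hi

/-- The slopes of two uniformly close regular grid functions are close in `L²`. -/
theorem integral_sq_slope_sub_le {N' : ℕ} {q : ℕ → ℝ} (hp : IsRegularGrid N L V p)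
    (hq : IsRegularGrid N' L V q) (hN : 0 < N) (hN' : 0 < N') {ε : ℝ}
    (hε : ∀ x ∈ Icc (0 : ℝ) 1, |stepFun N p x - stepFun N' q x| ≤ ε) :
    ∫ x in (0 : ℝ)..1, (stepFun N (gridSlope N p) x - stepFun N' (gridSlope N' q) x) ^ 2
      ≤ 2 * V * (ε + L * (1 / N) + L * (1 / N')) := by
  set a := stepFun N (gridSlope N p) with ha
  set b := stepFun N' (gridSlope N' q) with hb
  have hg : ∀ s t, IntervalIntegrable (fun x => a x - b x) volume s t := fun s t =>
    (hp.intervalIntegrable_slope s t).sub (hq.intervalIntegrable_slope s t)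
  have hgF : ∀ s t, ∫ x in s..t, (a x - b x)
      = (interp N p t - interp N' q t) - (interp N p s - interp N' q s) := by
    intro s t
    rw [intervalIntegral.integral_sub (hp.intervalIntegrable_slope s t)
      (hq.intervalIntegrable_slope s t), ← hp.interp_sub, ← hq.interp_sub]
    ring
  have hF : interp N p 1 - interp N' q 1 = interp N p 0 - interp N' q 0 := by
    rw [hp.interp_one hN, hq.interp_one hN']
  have hη : ∀ x ∈ Icc (0 : ℝ) 1, |interp N p x - interp N' q x|
      ≤ ε + L * (1 / N) + L * (1 / N') := by
    intro x hx
    have h1 := abs_le.1 (hp.abs_interp_sub_stepFun_le hN hx.1)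
    have h2 := abs_le.1 (hq.abs_interp_sub_stepFun_le hN' hx.1)
    have h3 := abs_le.1 (hε x hx)
    rw [abs_le]; constructor <;> linarith
  have e1 := hp.abs_integral_mul_slope_le hN hg hgF hF hη
  have e2 := hq.abs_integral_mul_slope_le hN' hg hgF hF hη
  rw [← ha] at e1
  rw [← hb] at e2
  have ma : Measurable a := measurable_stepFun _ _
  have mb : Measurable b := measurable_stepFun _ _
  have ba : ∀ x, |a x| ≤ L := fun x => hp.slope _
  have bb : ∀ x, |b x| ≤ L := fun x => hq.slope _
  have bab : ∀ x, |a x - b x| ≤ L + L := fun x =>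
    (abs_sub _ _).trans (add_le_add (ba x) (bb x))
  have e : ∫ x in (0 : ℝ)..1, (a x - b x) ^ 2
      = (∫ x in (0 : ℝ)..1, (a x - b x) * a x) - ∫ x in (0 : ℝ)..1, (a x - b x) * b x := by
    rw [← intervalIntegral.integral_sub]
    · congr 1; ext x; ring
    · refine intervalIntegrable_of_abs_le ((ma.sub mb).mul ma) (C := (L + L) * L) (fun x => ?_) _ _
      rw [Pi.mul_apply, abs_mul]
      exact mul_le_mul (bab x) (ba x) (abs_nonneg _) ((abs_nonneg _).trans (bab x))
    · refine intervalIntegrable_of_abs_le ((ma.sub mb).mul mb) (C := (L + L) * L) (fun x => ?_) _ _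
      rw [Pi.mul_apply, abs_mul]
      exact mul_le_mul (bab x) (bb x) (abs_nonneg _) ((abs_nonneg _).trans (bab x))
  rw [e]
  have := (abs_le.1 e1).2
  have := (abs_le.1 e2).1
  linarith

/-- The slopes of two uniformly close regular grid functions are close in `L¹`. -/
theorem integral_abs_slope_sub_le {N' : ℕ} {q : ℕ → ℝ} (hp : IsRegularGrid N L V p)
    (hq : IsRegularGrid N' L V q) (hN : 0 < N) (hN' : 0 < N') {ε δ : ℝ} (hδ : 0 < δ)
    (hε : ∀ x ∈ Icc (0 : ℝ) 1, |stepFun N p x - stepFun N' q x| ≤ ε)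
    (hδε : 2 * V * (ε + L * (1 / N) + L * (1 / N')) ≤ δ ^ 2) :
    ∫ x in (0 : ℝ)..1, |stepFun N (gridSlope N p) x - stepFun N' (gridSlope N' q) x|
      ≤ 2 * δ := by
  have h := (hp.integral_sq_slope_sub_le hq hN hN' hε).trans hδε
  set a := stepFun N (gridSlope N p) with ha
  set b := stepFun N' (gridSlope N' q) with hb
  have ma : Measurable a := measurable_stepFun _ _
  have mb : Measurable b := measurable_stepFun _ _
  have bab : ∀ x, |a x - b x| ≤ L + L := fun x =>
    (abs_sub _ _).trans (add_le_add (hp.slope _) (hq.slope _))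
  have i1 : IntervalIntegrable (fun x => |a x - b x|) volume 0 1 :=
    intervalIntegrable_of_abs_le (ma.sub mb).abs (C := L + L)
      (fun x => by rw [abs_abs]; exact bab x) _ _
  have i2 : IntervalIntegrable (fun x => (a x - b x) ^ 2) volume 0 1 :=
    intervalIntegrable_of_abs_le ((ma.sub mb).pow_const 2) (C := (L + L) ^ 2)
      (fun x => by rw [abs_pow]; exact pow_le_pow_left₀ (abs_nonneg _) (bab x) 2) _ _
  have m := intervalIntegral.integral_mono_on (zero_le_one' ℝ) i1
    ((intervalIntegrable_const (c := δ)).add (i2.const_mul (1 / δ))) (fun x _ => by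
      show |a x - b x| ≤ δ + 1 / δ * (a x - b x) ^ 2
      rw [← sq_abs (a x - b x)]
      have := abs_nonneg (a x - b x)
      set y := |a x - b x|
      have e : δ + 1 / δ * y ^ 2 - y = ((y - δ) ^ 2 + y * δ) / δ := by field_simp; ring
      have : 0 ≤ ((y - δ) ^ 2 + y * δ) / δ := by positivity
      linarith)
  rw [intervalIntegral.integral_add intervalIntegrable_const (i2.const_mul (1 / δ)),
    intervalIntegral.integral_const_mul] at m
  simp only [intervalIntegral.integral_const, sub_zero, smul_eq_mul, one_mul] at m
  refine m.trans ?_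
  have := mul_le_mul_of_nonneg_left h (by positivity : 0 ≤ 1 / δ)
  have e : 1 / δ * δ ^ 2 = δ := by field_simp
  linarith

end IsRegularGrid

end StepFunctions

section Compactness

open Set MeasureTheory Filter Topology

/-- An Arzelà–Ascoli theorem for asymptotically equicontinuous sequences of (possibly
discontinuous) functions. -/
theorem exists_subseq_tendsto_locally_uniformly {v : ℕ → ℝ → ℝ → ℝ} {M : ℝ}
    (hM : ∀ k x t, |v k x t| ≤ M)
    (hequi : ∀ ε > 0, ∃ δ > 0, ∃ K, ∀ k ≥ K, ∀ x y t s : ℝ, |x - y| < δ → |t - s| < δ →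
      |v k x t - v k y s| < ε) :
    ∃ φ : ℕ → ℕ, StrictMono φ ∧ ∃ u : ℝ → ℝ → ℝ, ∀ R : ℝ, ∀ ε > 0, ∃ K, ∀ l ≥ K,
      ∀ x ∈ Icc (-R) R, ∀ t ∈ Icc (-R) R, |v (φ l) x t - u x t| ≤ ε := by
  have hcomp : IsCompact (Set.pi univ fun _ : ℚ × ℚ => Icc (-M) M) :=
    isCompact_univ_pi fun _ => isCompact_Icc
  obtain ⟨F, -, φ, hφ, hF⟩ := hcomp.tendsto_subseq
    (x := fun k (q : ℚ × ℚ) => v k q.1 q.2) (fun k q _ => abs_le.1 (hM k _ _))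
  rw [tendsto_pi_nhds] at hF
  have cauchy : ∀ R : ℝ, ∀ ε > 0, ∃ K, ∀ l ≥ K, ∀ l' ≥ K,
      ∀ x ∈ Icc (-R) R, ∀ t ∈ Icc (-R) R, |v (φ l) x t - v (φ l') x t| ≤ ε := by
    intro R ε hε
    obtain ⟨δ, hδ, K, hK⟩ := hequi (ε / 4) (by positivity)
    obtain ⟨m, hm⟩ := exists_nat_one_div_lt hδ
    set A : ℤ := ⌈R * (m + 1)⌉ + 1
    have ev : ∀ᶠ l in atTop, ∀ p ∈ (Finset.Icc (-A) A) ×ˢ (Finset.Icc (-A) A),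
        |v (φ l) (((p.1 / (m + 1) : ℚ) : ℝ)) (((p.2 / (m + 1) : ℚ) : ℝ))
          - F (p.1 / (m + 1), p.2 / (m + 1))| < ε / 4 := by
      rw [Filter.eventually_all_finset]
      intro p _
      have := Metric.tendsto_atTop.1 (hF (p.1 / (m + 1), p.2 / (m + 1))) (ε / 4) (by positivity)
      exact eventually_atTop.2 this
    obtain ⟨K', hK'⟩ := eventually_atTop.1 ev
    have hm0 : (0 : ℝ) < m + 1 := by positivity
    have near : ∀ x ∈ Icc (-R) R, ∃ i ∈ Finset.Icc (-A) A,
        |x - ((i / (m + 1) : ℚ) : ℝ)| < δ := by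
      intro x hx
      refine ⟨⌊x * (m + 1)⌋, ?_, ?_⟩
      · rw [Finset.mem_Icc]
        have h1 : x * (m + 1) ≤ R * (m + 1) := mul_le_mul_of_nonneg_right hx.2 hm0.le
        have h2 : -R * (m + 1) ≤ x * (m + 1) := mul_le_mul_of_nonneg_right hx.1 hm0.le
        have h3 := Int.le_ceil (R * (m + 1))
        constructor
        · rw [Int.le_floor]
          push_cast [A]
          linarith
        · have := Int.floor_le (x * (m + 1))
          have : (⌊x * (m + 1)⌋ : ℝ) ≤ A := by push_cast [A]; linarith
          exact_mod_cast this
      · refine lt_of_le_of_lt ?_ hm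
        have h1 := Int.floor_le (x * (m + 1))
        have h2 := Int.lt_floor_add_one (x * (m + 1))
        push_cast
        rw [abs_le]
        constructor
        · have : (⌊x * (m + 1)⌋ : ℝ) / (m + 1) ≤ x := (div_le_iff₀ hm0).2 h1
          have : (0 : ℝ) ≤ 1 / (m + 1) := by positivity
          linarith
        · rw [sub_le_iff_le_add', ← add_div, le_div_iff₀ hm0]
          linarith
    refine ⟨max K K', fun l hl l' hl' x hx t ht => ?_⟩
    obtain ⟨i, hi, hix⟩ := near x hx
    obtain ⟨j, hj, hjt⟩ := near t ht
    have one : ∀ n ≥ max K K', |v (φ n) x t - F (i / (m + 1), j / (m + 1))| < ε / 2 := by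
      intro n hn
      have h1 := hK (φ n) (((le_max_left _ _).trans hn).trans (hφ.id_le n)) x _ t _ hix hjt
      have h2 := hK' n ((le_max_right _ _).trans hn) (i, j) (Finset.mem_product.2 ⟨hi, hj⟩)
      have h3 := abs_sub_le (v (φ n) x t) (v (φ n) (((i / (m + 1) : ℚ) : ℝ))
        (((j / (m + 1) : ℚ) : ℝ))) (F (i / (m + 1), j / (m + 1)))
      simp only at h2
      linarith
    have h1 := one l hl
    have h2 := one l' hl'
    have h3 := abs_sub_le (v (φ l) x t) (F (i / (m + 1), j / (m + 1))) (v (φ l') x t)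
    rw [abs_sub_comm (F _)] at h3
    linarith
  have lim : ∀ x t, ∃ y, Tendsto (fun l => v (φ l) x t) atTop (𝓝 y) := by
    intro x t
    refine cauchySeq_tendsto_of_complete (Metric.cauchySeq_iff.2 fun ε hε => ?_)
    obtain ⟨K, hK⟩ := cauchy (max |x| |t|) (ε / 2) (by positivity)
    refine ⟨K, fun l hl l' hl' => ?_⟩
    have := hK l hl l' hl' x (abs_le.1 (le_max_left _ _)) t (abs_le.1 (le_max_right _ _))
    rw [Real.dist_eq]
    linarith
  choose u hu using lim
  refine ⟨φ, hφ, u, fun R ε hε => ?_⟩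
  obtain ⟨K, hK⟩ := cauchy R ε hε
  refine ⟨K, fun l hl x hx t ht => ?_⟩
  refine le_of_tendsto ((tendsto_const_nhds.sub (hu x t)).abs) ?_
  filter_upwards [eventually_ge_atTop K] with l' hl'
  exact hK l hl l' hl' x hx t ht

theorem integral_zero_one_eq (f : ℝ → ℝ) :
    ∫ x in (0 : ℝ)..1, f x = ∫ x in Ioo (0 : ℝ) 1, f x := by
  rw [intervalIntegral.integral_of_le zero_le_one, integral_Ioc_eq_integral_Ioo]

/-- A bounded `L¹(0,1)`-Cauchy sequence has a bounded limit, with the expected error estimate. -/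
theorem exists_bounded_L1_limit {a : ℕ → ℝ → ℝ} {L : ℝ} (ha : ∀ k, Measurable (a k))
    (hL : ∀ k x, |a k x| ≤ L)
    (hC : ∀ ε > 0, ∃ K, ∀ k ≥ K, ∀ m ≥ K, ∫ x in (0 : ℝ)..1, |a k x - a m x| ≤ ε) :
    ∃ z : ℝ → ℝ, Measurable z ∧ (∀ x, |z x| ≤ L) ∧
      ∀ k ε, (∃ K, ∀ m ≥ K, ∫ x in (0 : ℝ)..1, |a k x - a m x| ≤ ε) →
        ∫ x in (0 : ℝ)..1, |a k x - z x| ≤ ε := by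
  simp only [integral_zero_one_eq] at hC ⊢
  set μ := (volume : Measure ℝ).restrict (Ioo 0 1) with hμ
  have hL0 : 0 ≤ L := (abs_nonneg _).trans (hL 0 0)
  have int : ∀ k, Integrable (a k) μ := fun k =>
    Integrable.of_bound (ha k).aestronglyMeasurable L (Eventually.of_forall (hL k))
  have hdist : ∀ k m, dist ((int k).toL1 (a k)) ((int m).toL1 (a m)) = ∫ x, |a k x - a m x| ∂μ := by
    intro k m
    rw [L1.dist_eq_integral_dist]
    refine integral_congr_ae ?_
    filter_upwards [(int k).coeFn_toL1, (int m).coeFn_toL1] with x h1 h2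
    rw [h1, h2, Real.dist_eq]
  have cs : CauchySeq fun k => (int k).toL1 (a k) := by
    refine Metric.cauchySeq_iff.2 fun ε hε => ?_
    obtain ⟨K, hK⟩ := hC (ε / 2) (by positivity)
    refine ⟨K, fun k hk m hm => ?_⟩
    rw [hdist]
    linarith [hK k hk m hm]
  obtain ⟨g, hg⟩ := cauchySeq_tendsto_of_complete cs
  have gm : Measurable g := (Lp.stronglyMeasurable g).measurable
  refine ⟨fun x => max (-L) (min L (g x)), measurable_const.max (measurable_const.min gm),
    fun x => abs_le.2 ⟨le_max_left _ _, max_le (by linarith) (min_le_left _ _)⟩, ?_⟩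
  rintro k ε ⟨K, hK⟩
  have e1 : dist ((int k).toL1 (a k)) g = ∫ x, |a k x - g x| ∂μ := by
    rw [L1.dist_eq_integral_dist]
    refine integral_congr_ae ?_
    filter_upwards [(int k).coeFn_toL1] with x h1
    rw [h1, Real.dist_eq]
  have e2 : dist ((int k).toL1 (a k)) g ≤ ε := by
    refine le_of_tendsto (tendsto_const_nhds.dist hg) ?_
    filter_upwards [eventually_ge_atTop K] with m hm
    rw [hdist]
    exact hK m hm
  rw [e1] at e2
  refine le_trans (integral_mono_of_nonneg (Eventually.of_forall fun x => abs_nonneg _)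
    ((int k).sub (L1.integrable_coeFn g)).abs (Eventually.of_forall fun x => ?_)) e2
  have := abs_le.1 (hL k x)
  have h1 : a k x = max (-L) (min L (a k x)) := by
    rw [min_eq_right this.2, max_eq_right this.1]
  show |a k x - max (-L) (min L (g x))| ≤ |a k x - g x|
  conv_lhs => rw [h1]
  refine (abs_max_sub_max_le_max _ _ _ _).trans ?_
  rw [sub_self, abs_zero, max_eq_right (abs_nonneg _)]
  refine (abs_min_sub_min_le_max _ _ _ _).trans ?_
  rw [sub_self, abs_zero, max_eq_right (abs_nonneg _)]

/-- Products of a bounded `L¹`-convergent sequence and a bounded pointwise convergent sequence. -/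
theorem tendsto_integral_mul_of_L1 {a s : ℕ → ℝ → ℝ} {z r : ℝ → ℝ} {L C : ℝ}
    (ha : ∀ k, Measurable (a k)) (hz : Measurable z) (hs : ∀ k, Measurable (s k))
    (hL : ∀ k x, |a k x| ≤ L) (hzL : ∀ x, |z x| ≤ L) (hC : ∀ k, ∀ x ∈ Ioo (0 : ℝ) 1, |s k x| ≤ C)
    (haz : Tendsto (fun k => ∫ x in (0 : ℝ)..1, |a k x - z x|) atTop (𝓝 0))
    (hsr : ∀ x ∈ Ioo (0 : ℝ) 1, Tendsto (fun k => s k x) atTop (𝓝 (r x))) :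
    Tendsto (fun k => ∫ x in (0 : ℝ)..1, a k x * s k x) atTop
      (𝓝 (∫ x in (0 : ℝ)..1, z x * r x)) := by
  simp only [integral_zero_one_eq] at haz ⊢
  set μ := (volume : Measure ℝ).restrict (Ioo 0 1) with hμ
  have hC0 : 0 ≤ C := (abs_nonneg _).trans (hC 0 (1 / 2) ⟨by norm_num, by norm_num⟩)
  have aeC : ∀ k, ∀ᵐ x ∂μ, |s k x| ≤ C := fun k =>
    (ae_restrict_iff' measurableSet_Ioo).2 (Eventually.of_forall (hC k))
  have bd : ∀ (f g : ℝ → ℝ), Measurable f → Measurable g → (∀ x, |f x| ≤ L) →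
      (∀ᵐ x ∂μ, |g x| ≤ C) → Integrable (fun x => f x * g x) μ := by
    intro f g hf hg hfL hgC
    refine Integrable.of_bound (hf.mul hg).aestronglyMeasurable (L * C) ?_
    filter_upwards [hgC] with x hx
    rw [Real.norm_eq_abs, abs_mul]
    exact mul_le_mul (hfL x) hx (abs_nonneg _) ((abs_nonneg _).trans (hfL x))
  have t1 : Tendsto (fun k => ∫ x, z x * s k x ∂μ) atTop (𝓝 (∫ x, z x * r x ∂μ)) := by
    refine tendsto_integral_of_dominated_convergence (fun _ => L * C)
      (fun k => (hz.mul (hs k)).aestronglyMeasurable) (integrable_const _) (fun k => ?_) ?_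
    · filter_upwards [aeC k] with x hx
      rw [Real.norm_eq_abs, abs_mul]
      exact mul_le_mul (hzL x) hx (abs_nonneg _) ((abs_nonneg _).trans (hzL x))
    · refine (ae_restrict_iff' measurableSet_Ioo).2 (Eventually.of_forall fun x hx => ?_)
      exact (hsr x hx).const_mul _
  have t2 : Tendsto (fun k => (∫ x, a k x * s k x ∂μ) - ∫ x, z x * s k x ∂μ) atTop (𝓝 0) := by
    refine squeeze_zero_norm (a := fun k => C * ∫ x, |a k x - z x| ∂μ) (fun k => ?_)
      (by simpa using haz.const_mul C)
    rw [← integral_sub (bd _ _ (ha k) (hs k) (hL k) (aeC k)) (bd _ _ hz (hs k) hzL (aeC k)),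
      ← integral_const_mul]
    refine norm_integral_le_of_norm_le ?_ ?_
    · refine Integrable.const_mul ?_ C
      refine Integrable.of_bound ((ha k).sub hz).abs.aestronglyMeasurable (L + L)
        (Eventually.of_forall fun x => ?_)
      rw [Real.norm_eq_abs, abs_abs]
      exact (abs_sub _ _).trans (add_le_add (hL k x) (hzL x))
    · filter_upwards [aeC k] with x hx
      rw [← sub_mul, Real.norm_eq_abs, abs_mul, mul_comm]
      exact mul_le_mul_of_nonneg_right hx (abs_nonneg _)
  simpa using t2.add t1

end Compactness

section GridSequence

open Set MeasureTheory Filter Topology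

/-- The sequence indexed by `ℕ` obtained by unrolling a periodic grid function. -/
def unroll {N : ℕ} (a : ZMod N → ℝ) (i : ℕ) : ℝ := a (i : ZMod N)

/-- The function on space-time that equals `w n j` on the cell of the node `(j, n)`. -/
noncomputable def stepSol (N : ℕ) (Δt : ℝ) (w : ℕ → ZMod N → ℝ) (x t : ℝ) : ℝ :=
  stepFun N (unroll (w ⌊t / Δt⌋₊)) x

/-- The function on space-time that equals the forward difference quotient of `w n` at `j`
on the cell of the node `(j, n)`. -/
noncomputable def stepSlope (N : ℕ) (Δt : ℝ) (w : ℕ → ZMod N → ℝ) (x t : ℝ) : ℝ :=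
  stepFun N (gridSlope N (unroll (w ⌊t / Δt⌋₊))) x

theorem measurable_stepSol (N : ℕ) (Δt : ℝ) (w : ℕ → ZMod N → ℝ) (t : ℝ) :
    Measurable fun x => stepSol N Δt w x t :=
  measurable_stepFun _ _

theorem measurable_stepSlope (N : ℕ) (Δt : ℝ) (w : ℕ → ZMod N → ℝ) (t : ℝ) :
    Measurable fun x => stepSlope N Δt w x t :=
  measurable_stepFun _ _

theorem tendsto_one_div_grid {N : ℕ → ℕ} (hN : Tendsto N atTop atTop) :
    Tendsto (fun k => 1 / (N k : ℝ)) atTop (𝓝 0) :=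
  tendsto_one_div_atTop_nhds_zero_nat.comp hN

theorem abs_floor_sub_floor_le (a b : ℝ) : |(⌊a⌋₊ : ℝ) - ⌊b⌋₊| ≤ |a - b| + 1 := by
  rcases le_total 0 a with ha | ha <;> rcases le_total 0 b with hb | hb
  · have h1 := Nat.floor_le ha
    have h2 := Nat.lt_floor_add_one a
    have h3 := Nat.floor_le hb
    have h4 := Nat.lt_floor_add_one b
    have h5 := le_abs_self (a - b)
    have h6 := neg_abs_le (a - b)
    rw [abs_le]; constructor <;> linarith
  · have h1 := Nat.floor_le ha
    rw [Nat.floor_of_nonpos hb, Nat.cast_zero, sub_zero, Nat.abs_cast]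
    linarith [le_abs_self (a - b)]
  · have h1 := Nat.floor_le hb
    rw [Nat.floor_of_nonpos ha, Nat.cast_zero, zero_sub, abs_neg, Nat.abs_cast]
    linarith [neg_abs_le (a - b)]
  · rw [Nat.floor_of_nonpos ha, Nat.floor_of_nonpos hb]
    simpa using add_nonneg (abs_nonneg (a - b)) zero_le_one

theorem abs_sub_le_of_abs_succ_sub_le {f : ℕ → ℝ} {c : ℝ} (hf : ∀ i, |f (i + 1) - f i| ≤ c)
    (i j : ℕ) : |f i - f j| ≤ c * |(i : ℝ) - j| := by
  have key : ∀ i d : ℕ, |f (i + d) - f i| ≤ c * d := by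
    intro i d
    induction d with
    | zero => simp
    | succ d ih =>
      have := abs_sub_le (f (i + d + 1)) (f (i + d)) (f i)
      rw [← add_assoc]
      push_cast
      linarith [hf (i + d)]
  rcases le_total i j with h | h
  · obtain ⟨d, rfl⟩ := Nat.exists_eq_add_of_le h
    rw [abs_sub_comm, abs_sub_comm (i : ℝ)]
    simpa using key i d
  · obtain ⟨d, rfl⟩ := Nat.exists_eq_add_of_le h
    simpa using key j d

namespace GridBounds

variable {N : ℕ} [NeZero N] {Δt M L V C : ℝ} {w : ℕ → ZMod N → ℝ}

theorem isRegularGrid (h : GridBounds N Δt M L V C w) (n : ℕ) :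
    IsRegularGrid N L V (unroll (w n)) := by
  have hN : (0 : ℝ) < N := Nat.cast_pos.2 (NeZero.pos N)
  refine ⟨fun i => by simp [unroll], fun i => ?_, ?_⟩
  · have := h.lip n (i : ZMod N)
    rw [gridSlope, unroll, unroll, Nat.cast_add, Nat.cast_one, abs_mul, Nat.abs_cast]
    calc _ ≤ L * (1 / N) * N := by gcongr
      _ = L := by field_simp
  · have hv := h.var n
    rw [← ZMod.sum_add_one, ZMod.sum_eq_sum_range] at hv
    calc _ = (∑ i ∈ Finset.range N, |w n ((i : ZMod N) + 1 + 1) - 2 * w n ((i : ZMod N) + 1)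
              + w n ((i : ZMod N) + 1 - 1)|) * N := by
          rw [Finset.sum_mul]
          refine Finset.sum_congr rfl fun i _ => ?_
          rw [← Nat.abs_cast N, ← abs_mul, gridSlope, gridSlope, unroll, unroll, unroll]
          push_cast
          rw [add_sub_cancel_right]
          congr 1
          ring
      _ ≤ V * (1 / N) * N := by gcongr
      _ = V := by field_simp

theorem abs_unroll_sub_le (h : GridBounds N Δt M L V C w) (n i j : ℕ) :
    |unroll (w n) i - unroll (w n) j| ≤ L * (1 / N) * |(i : ℝ) - j| := by
  refine abs_sub_le_of_abs_succ_sub_le (fun i => ?_) i j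
  simpa [unroll] using h.lip n (i : ZMod N)

theorem nonneg_C (h : GridBounds N Δt M L V C w) (hΔt : 0 < Δt) : 0 ≤ C := by
  have := (sq_nonneg _).trans (h.time 0 1 zero_le_one 0)
  simp only [Nat.cast_one, Nat.cast_zero, sub_zero, one_mul] at this
  exact nonneg_of_mul_nonneg_left this hΔt

theorem abs_time_sub_le (h : GridBounds N Δt M L V C w) (hΔt : 0 < Δt) (j : ZMod N) (t s : ℝ) :
    |w ⌊t / Δt⌋₊ j - w ⌊s / Δt⌋₊ j| ≤ √(C * (|t - s| + Δt)) := by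
  have hC := h.nonneg_C hΔt
  apply Real.abs_le_sqrt
  have key : ∀ m n : ℕ, (w n j - w m j) ^ 2 ≤ C * (|(n : ℝ) - m| * Δt) := by
    intro m n
    rcases le_total m n with hmn | hmn
    · exact (h.time m n hmn j).trans (by gcongr; exact le_abs_self _)
    · rw [← neg_sub, neg_sq, abs_sub_comm]
      exact (h.time n m hmn j).trans (by gcongr; exact le_abs_self _)
  refine (key _ _).trans ?_
  gcongr
  calc _ ≤ (|t / Δt - s / Δt| + 1) * Δt := by gcongr; exact abs_floor_sub_floor_le _ _
    _ = |t - s| + Δt := by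
      rw [← sub_div, abs_div, abs_of_pos hΔt]; field_simp

theorem abs_stepSol_sub_le (h : GridBounds N Δt M L V C w) (hΔt : 0 < Δt) (x y t s : ℝ) :
    |stepSol N Δt w x t - stepSol N Δt w y s|
      ≤ L * (|x - y| + 1 / N) + √(C * (|t - s| + Δt)) := by
  have hN : (0 : ℝ) < N := Nat.cast_pos.2 (NeZero.pos N)
  have hL := (h.isRegularGrid 0).nonneg_L
  refine (abs_sub_le _ (stepSol N Δt w y t) _).trans (add_le_add ?_ ?_)
  · refine (h.abs_unroll_sub_le _ _ _).trans ?_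
    calc _ ≤ L * (1 / N) * (|x * N - y * N| + 1) := by
          gcongr; exact abs_floor_sub_floor_le _ _
      _ = _ := by
          rw [← sub_mul, abs_mul, Nat.abs_cast]; field_simp
  · exact h.abs_time_sub_le hΔt _ t s

theorem abs_stepSol_le (h : GridBounds N Δt M L V C w) (x t : ℝ) : |stepSol N Δt w x t| ≤ M :=
  h.sup _ _

theorem abs_stepSlope_le (h : GridBounds N Δt M L V C w) (x t : ℝ) :
    |stepSlope N Δt w x t| ≤ L :=
  (h.isRegularGrid _).slope _

end GridBounds

/-- A sequence of grid functions on space-time with uniform bounds, on grids that become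
arbitrarily fine, converging locally uniformly to `u` and with slopes converging to `z` in
`L¹`, locally uniformly in time. -/
structure ConvergesTo (N : ℕ → ℕ) [∀ k, NeZero (N k)] (Δt : ℕ → ℝ) (M L V C : ℝ)
    (w : ∀ k, ℕ → ZMod (N k) → ℝ) (u z : ℝ → ℝ → ℝ) : Prop where
  tendsto_N : Tendsto N atTop atTop
  Δt_pos : ∀ k, 0 < Δt k
  tendsto_Δt : Tendsto Δt atTop (𝓝 0)
  bounds : ∀ k, GridBounds (N k) (Δt k) M L V C (w k)
  measurable_u : ∀ t, Measurable fun x => u x t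
  abs_u_le : ∀ x t, |u x t| ≤ M
  measurable_z : ∀ t, Measurable fun x => z x t
  abs_z_le : ∀ x t, |z x t| ≤ L
  tendsto_sol : ∀ R : ℝ, ∀ ε > 0, ∃ K, ∀ k ≥ K, ∀ x ∈ Icc (-R) R, ∀ t ∈ Icc (-R) R,
    |stepSol (N k) (Δt k) (w k) x t - u x t| ≤ ε
  tendsto_slope : ∀ R : ℝ, ∀ ε > 0, ∃ K, ∀ k ≥ K, ∀ t ∈ Icc (-R) R,
    ∫ x in (0 : ℝ)..1, |stepSlope (N k) (Δt k) (w k) x t - z x t| ≤ ε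

section Limit

variable {N : ℕ → ℕ} [∀ k, NeZero (N k)] {Δt : ℕ → ℝ} {M L V C : ℝ}
  {w : ∀ k, ℕ → ZMod (N k) → ℝ}

theorem exists_subseq_convergesTo (hN : Tendsto N atTop atTop) (hΔt : ∀ k, 0 < Δt k)
    (hΔt0 : Tendsto Δt atTop (𝓝 0)) (hw : ∀ k, GridBounds (N k) (Δt k) M L V C (w k)) :
    ∃ φ : ℕ → ℕ, StrictMono φ ∧ ∃ u z : ℝ → ℝ → ℝ,
      ConvergesTo (fun l => N (φ l)) (fun l => Δt (φ l)) M L V C (fun l => w (φ l)) u z := by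
  have hN1 := tendsto_one_div_grid hN
  have hL := ((hw 0).isRegularGrid 0).nonneg_L
  have hV := ((hw 0).isRegularGrid 0).nonneg_V
  have hC := (hw 0).nonneg_C (hΔt 0)
  obtain ⟨φ, hφ, u, hu⟩ := exists_subseq_tendsto_locally_uniformly
    (v := fun k x t => stepSol (N k) (Δt k) (w k) x t) (fun k x t => (hw k).abs_stepSol_le x t) (by
      intro ε hε
      have h1 : Tendsto (fun d : ℝ => L * (d + d) + √(C * (d + d))) (𝓝 0) (𝓝 0) := by
        have : Continuous fun d : ℝ => L * (d + d) + √(C * (d + d)) := by fun_prop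
        simpa using this.tendsto 0
      obtain ⟨δ, hδ, hδε⟩ := Metric.eventually_nhds_iff.1 (h1.eventually_lt_const hε)
      have h2 : L * (δ / 2 + δ / 2) + √(C * (δ / 2 + δ / 2)) < ε := by
        apply hδε
        rw [Real.dist_eq, sub_zero, abs_of_pos (by positivity)]; linarith
      refine ⟨δ / 2, by positivity, ?_⟩
      obtain ⟨K, hK⟩ := eventually_atTop.1 ((hN1.eventually_lt_const (half_pos hδ)).and
        (hΔt0.eventually_lt_const (half_pos hδ)))
      refine ⟨K, fun k hk x y t s hxy hts => ((hw k).abs_stepSol_sub_le (hΔt k) x y t s).trans_lt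
        (lt_of_le_of_lt ?_ h2)⟩
      obtain ⟨h3, h4⟩ := hK k hk
      gcongr)
  have hN1φ := hN1.comp hφ.tendsto_atTop
  have slope_cauchy : ∀ R : ℝ, ∀ ε > 0, ∃ K, ∀ k ≥ K, ∀ m ≥ K, ∀ t ∈ Icc (-R) R,
      ∫ x in (0 : ℝ)..1, |stepSlope (N (φ k)) (Δt (φ k)) (w (φ k)) x t
        - stepSlope (N (φ m)) (Δt (φ m)) (w (φ m)) x t| ≤ ε := by
    intro R ε hε
    have h1 : Tendsto (fun d : ℝ => 2 * V * ((d + d) + L * d + L * d)) (𝓝 0) (𝓝 0) := by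
      have : Continuous fun d : ℝ => 2 * V * ((d + d) + L * d + L * d) := by fun_prop
      simpa using this.tendsto 0
    obtain ⟨δ, hδ, hδε⟩ := Metric.eventually_nhds_iff.1
      (h1.eventually_lt_const (show 0 < (ε / 2) ^ 2 by positivity))
    have h2 : 2 * V * ((δ / 2 + δ / 2) + L * (δ / 2) + L * (δ / 2)) < (ε / 2) ^ 2 := by
      apply hδε
      rw [Real.dist_eq, sub_zero, abs_of_pos (by positivity)]; linarith
    obtain ⟨K₁, hK₁⟩ := hu (max 1 R) (δ / 2) (by positivity)
    obtain ⟨K₂, hK₂⟩ := eventually_atTop.1 (hN1φ.eventually_lt_const (half_pos hδ))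
    refine ⟨max K₁ K₂, fun k hk m hm t ht => ?_⟩
    have hk1 := hK₁ k (le_of_max_le_left hk)
    have hm1 := hK₁ m (le_of_max_le_left hm)
    have hk2 := hK₂ k (le_of_max_le_right hk)
    have hm2 := hK₂ m (le_of_max_le_right hm)
    simp only [Function.comp_apply] at hk2 hm2
    have ht' : t ∈ Icc (-max 1 R) (max 1 R) :=
      ⟨(neg_le_neg (le_max_right 1 R)).trans ht.1, ht.2.trans (le_max_right 1 R)⟩
    have := ((hw (φ k)).isRegularGrid ⌊t / Δt (φ k)⌋₊).integral_abs_slope_sub_le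
      ((hw (φ m)).isRegularGrid ⌊t / Δt (φ m)⌋₊) (NeZero.pos _) (NeZero.pos _)
      (half_pos hε) (ε := δ / 2 + δ / 2) (fun x hx => ?_) (le_trans ?_ h2.le)
    · exact this.trans_eq (by ring)
    · have hx' : x ∈ Icc (-max 1 R) (max 1 R) :=
        ⟨by linarith [hx.1, le_max_left 1 R], hx.2.trans (le_max_left 1 R)⟩
      refine (abs_sub_le _ (u x t) _).trans (add_le_add (hk1 x hx' t ht') ?_)
      rw [abs_sub_comm]
      exact hm1 x hx' t ht'
    · gcongr
  have hz : ∀ t : ℝ, ∃ z : ℝ → ℝ, Measurable z ∧ (∀ x, |z x| ≤ L) ∧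
      ∀ k ε, (∃ K, ∀ m ≥ K, ∫ x in (0 : ℝ)..1, |stepSlope (N (φ k)) (Δt (φ k)) (w (φ k)) x t
        - stepSlope (N (φ m)) (Δt (φ m)) (w (φ m)) x t| ≤ ε) →
        ∫ x in (0 : ℝ)..1, |stepSlope (N (φ k)) (Δt (φ k)) (w (φ k)) x t - z x| ≤ ε := by
    intro t
    refine exists_bounded_L1_limit
      (a := fun k x => stepSlope (N (φ k)) (Δt (φ k)) (w (φ k)) x t)
      (fun k => measurable_stepSlope _ _ _ _) (fun k x => (hw _).abs_stepSlope_le x t)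
      fun ε hε => ?_
    obtain ⟨K, hK⟩ := slope_cauchy |t| ε hε
    exact ⟨K, fun k hk m hm => hK k hk m hm t ⟨neg_abs_le t, le_abs_self t⟩⟩
  choose z hzm hzL hzlim using hz
  have hlim : ∀ x t, Tendsto (fun l => stepSol (N (φ l)) (Δt (φ l)) (w (φ l)) x t) atTop
      (𝓝 (u x t)) := by
    intro x t
    refine Metric.tendsto_atTop.2 fun ε hε => ?_
    obtain ⟨K, hK⟩ := hu (max |x| |t|) (ε / 2) (half_pos hε)
    refine ⟨K, fun l hl => ?_⟩
    rw [Real.dist_eq]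
    have := hK l hl x (abs_le.1 (le_max_left _ _)) t (abs_le.1 (le_max_right _ _))
    linarith
  refine ⟨φ, hφ, u, fun x t => z t x, hN.comp hφ.tendsto_atTop, fun l => hΔt _,
    hΔt0.comp hφ.tendsto_atTop, fun l => hw _, fun t => ?_, fun x t => ?_, hzm,
    fun x t => hzL t x, hu, fun R ε hε => ?_⟩
  · exact measurable_of_tendsto_metrizable (f := fun l x =>
      stepSol (N (φ l)) (Δt (φ l)) (w (φ l)) x t) (fun l => measurable_stepSol _ _ _ t)
      (tendsto_pi_nhds.2 fun x => hlim x t)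
  · exact le_of_tendsto (hlim x t).abs (Eventually.of_forall fun l => (hw _).abs_stepSol_le x t)
  · obtain ⟨K, hK⟩ := slope_cauchy R ε hε
    exact ⟨K, fun k hk t ht => hzlim t k ε ⟨K, fun m hm => hK k hk m hm t ht⟩⟩

end Limit

end GridSequence

section WeakDerivative

open Set MeasureTheory Filter Topology

theorem Function.Periodic.exists_abs_le {f : ℝ → ℝ} (hf : Function.Periodic f 1)
    (hc : Continuous f) : ∃ C, ∀ x, |f x| ≤ C := by
  obtain ⟨C, hC⟩ := isCompact_Icc.exists_bound_of_continuousOn (s := Icc (0 : ℝ) 1) hc.continuousOn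
  refine ⟨C, fun x => ?_⟩
  obtain ⟨y, hy, hxy⟩ := hf.exists_mem_Ico₀ one_pos x
  rw [hxy]
  exact hC y (Ico_subset_Icc_self hy)

theorem tendsto_floor_div {N : ℕ → ℕ} (hN : Tendsto N atTop atTop) (hpos : ∀ k, 0 < N k)
    {x : ℝ} (hx : 0 ≤ x) : Tendsto (fun k => (⌊x * N k⌋₊ : ℝ) / N k) atTop (𝓝 x) := by
  rw [tendsto_iff_norm_sub_tendsto_zero]
  exact squeeze_zero (fun _ => norm_nonneg _) (fun k => abs_floor_div_sub_le (hpos k) hx)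
    (tendsto_one_div_grid hN)

theorem tendsto_floor_add_one_div {N : ℕ → ℕ} (hN : Tendsto N atTop atTop) (hpos : ∀ k, 0 < N k)
    {x : ℝ} (hx : 0 ≤ x) :
    Tendsto (fun k => ((⌊x * N k⌋₊ : ℝ) + 1) / N k) atTop (𝓝 x) := by
  simpa only [add_div, add_zero] using
    (tendsto_floor_div hN hpos hx).add (tendsto_one_div_grid hN)

/-- The piecewise linear interpolation of a grid function on space-time, constant in time on
each time step. -/
def IsInterpolation (N : ℕ) (Δt : ℝ) (w : ℕ → ZMod N → ℝ) (W : ℝ → ℝ → ℝ) : Prop :=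
  ∀ (n : ℕ) (j : ZMod N), ∀ x ∈ Ico ((j.val : ℝ) / N) (((j.val : ℝ) + 1) / N),
    ∀ t ∈ Ico ((n : ℝ) * Δt) (((n : ℝ) + 1) * Δt),
      W x t = ((((j.val : ℝ) + 1) / N - x) * N) * w n j
        + ((x - (j.val : ℝ) / N) * N) * w n (j + 1)

namespace IsInterpolation

variable {N : ℕ} [NeZero N] {Δt M L V C : ℝ} {w : ℕ → ZMod N → ℝ} {W : ℝ → ℝ → ℝ}

theorem eq_on_cell (hW : IsInterpolation N Δt w W) (hΔt : 0 < Δt) {i : ℕ} (hi : i < N)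
    {x : ℝ} (hx : x ∈ Ico ((i : ℝ) / N) (((i : ℝ) + 1) / N)) {t : ℝ} (ht : 0 ≤ t) :
    W x t = unroll (w ⌊t / Δt⌋₊) i
      + gridSlope N (unroll (w ⌊t / Δt⌋₊)) i * (x - (i : ℝ) / N) := by
  have hN : (N : ℝ) ≠ 0 := Nat.cast_ne_zero.2 (NeZero.ne N)
  have hv : ((i : ZMod N).val : ℝ) = i := by rw [ZMod.val_cast_of_lt hi]
  have h := hW ⌊t / Δt⌋₊ (i : ZMod N) x (by rwa [hv]) t
    ⟨(le_div_iff₀ hΔt).1 (Nat.floor_le (by positivity)),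
      (div_lt_iff₀ hΔt).1 (Nat.lt_floor_add_one _)⟩
  rw [hv] at h
  rw [h, gridSlope, unroll, unroll, Nat.cast_add, Nat.cast_one]
  field_simp
  ring

theorem abs_sub_stepSol_le (hW : IsInterpolation N Δt w W) (hw : GridBounds N Δt M L V C w)
    (hΔt : 0 < Δt) {x : ℝ} (hx : x ∈ Ico (0 : ℝ) 1) {t : ℝ} (ht : 0 ≤ t) :
    |W x t - stepSol N Δt w x t| ≤ L * (1 / N) := by
  have hN := NeZero.pos N
  rw [hW.eq_on_cell hΔt (floor_mul_lt hN hx.2) (mem_Ico_floor hN hx.1) ht, stepSol, stepFun,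
    add_sub_cancel_left, abs_mul, abs_sub_comm]
  exact mul_le_mul ((hw.isRegularGrid _).slope _) (abs_floor_div_sub_le hN hx.1) (abs_nonneg _)
    (hw.isRegularGrid 0).nonneg_L

theorem ae_deriv_eq (hW : IsInterpolation N Δt w W) (hΔt : 0 < Δt) {t : ℝ} (ht : 0 ≤ t) :
    ∀ᵐ x ∂(volume : Measure ℝ), x ∈ uIoc (0 : ℝ) 1 →
      deriv (fun y => W y t) x = stepSlope N Δt w x t := by
  have hN := NeZero.pos N
  have hc : (range fun i : ℕ => (i : ℝ) / N).Countable := countable_range _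
  filter_upwards [hc.ae_notMem volume] with x hx hx01
  rw [uIoc_of_le zero_le_one] at hx01
  have hx1 : x < 1 := hx01.2.lt_of_ne fun h => hx ⟨N, by
    simp [h, (Nat.cast_ne_zero (R := ℝ)).2 (NeZero.ne N)]⟩
  have hcell := mem_Ico_floor hN hx01.1.le
  have hioo : x ∈ Ioo ((⌊x * N⌋₊ : ℝ) / N) (((⌊x * N⌋₊ : ℝ) + 1) / N) :=
    ⟨hcell.1.lt_of_ne fun h => hx ⟨_, h⟩, hcell.2⟩
  have heq : (fun y => W y t) =ᶠ[𝓝 x] fun y => unroll (w ⌊t / Δt⌋₊) ⌊x * N⌋₊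
      + gridSlope N (unroll (w ⌊t / Δt⌋₊)) ⌊x * N⌋₊ * (y - (⌊x * N⌋₊ : ℝ) / N) := by
    filter_upwards [Ioo_mem_nhds hioo.1 hioo.2] with y hy
    exact hW.eq_on_cell hΔt (floor_mul_lt hN hx1) (Ioo_subset_Ico_self hy) ht
  rw [heq.deriv_eq]
  have hd : HasDerivAt (fun y : ℝ => unroll (w ⌊t / Δt⌋₊) ⌊x * N⌋₊
      + gridSlope N (unroll (w ⌊t / Δt⌋₊)) ⌊x * N⌋₊ * (y - (⌊x * N⌋₊ : ℝ) / N))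
      (gridSlope N (unroll (w ⌊t / Δt⌋₊)) ⌊x * N⌋₊ * 1) x :=
    (((hasDerivAt_id x).sub_const _).const_mul _).const_add _
  rw [hd.deriv, mul_one]
  rfl

end IsInterpolation

namespace ConvergesTo

variable {N : ℕ → ℕ} [∀ k, NeZero (N k)] {Δt : ℕ → ℝ} {M L V C : ℝ}
  {w : ∀ k, ℕ → ZMod (N k) → ℝ} {u z : ℝ → ℝ → ℝ}

theorem tendsto_sol_at (h : ConvergesTo N Δt M L V C w u z) (x t : ℝ) :
    Tendsto (fun k => stepSol (N k) (Δt k) (w k) x t) atTop (𝓝 (u x t)) := by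
  refine Metric.tendsto_atTop.2 fun ε hε => ?_
  obtain ⟨K, hK⟩ := h.tendsto_sol (max |x| |t|) (ε / 2) (half_pos hε)
  refine ⟨K, fun l hl => ?_⟩
  rw [Real.dist_eq]
  have := hK l hl x (abs_le.1 (le_max_left _ _)) t (abs_le.1 (le_max_right _ _))
  linarith

theorem tendsto_slope_at (h : ConvergesTo N Δt M L V C w u z) (t : ℝ) :
    Tendsto (fun k => ∫ x in (0 : ℝ)..1, |stepSlope (N k) (Δt k) (w k) x t - z x t|) atTop
      (𝓝 0) := by
  refine Metric.tendsto_atTop.2 fun ε hε => ?_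
  obtain ⟨K, hK⟩ := h.tendsto_slope |t| (ε / 2) (half_pos hε)
  refine ⟨K, fun l hl => ?_⟩
  rw [Real.dist_0_eq_abs, abs_of_nonneg
    (intervalIntegral.integral_nonneg zero_le_one fun _ _ => abs_nonneg _)]
  have := hK l hl t (abs_le.1 le_rfl)
  linarith

theorem tendsto_integral_sol_mul (h : ConvergesTo N Δt M L V C w u z) (t : ℝ)
    {g : ℝ → ℝ} (hg : Continuous g) :
    Tendsto (fun k => ∫ x in (0 : ℝ)..1, g x * stepSol (N k) (Δt k) (w k) x t) atTop
      (𝓝 (∫ x in (0 : ℝ)..1, g x * u x t)) := by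
  obtain ⟨D, hD⟩ := isCompact_uIcc.exists_bound_of_continuousOn
    (s := uIcc (0 : ℝ) 1) hg.continuousOn
  refine intervalIntegral.tendsto_integral_filter_of_dominated_convergence (fun _ => D * M)
    (Eventually.of_forall fun k =>
      (hg.measurable.mul (measurable_stepSol _ _ _ t)).aestronglyMeasurable)
    (Eventually.of_forall fun k => Eventually.of_forall fun x hx => ?_)
    intervalIntegrable_const
    (Eventually.of_forall fun x _ => (h.tendsto_sol_at x t).const_mul _)
  rw [norm_mul]
  exact mul_le_mul (hD x (uIoc_subset_uIcc hx)) ((h.bounds k).abs_stepSol_le x t) (norm_nonneg _)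
    ((norm_nonneg _).trans (hD x (uIoc_subset_uIcc hx)))

theorem integral_mul_deriv_eq (h : ConvergesTo N Δt M L V C w u z) (t : ℝ) {ψ : ℝ → ℝ}
    (hψ : ContDiff ℝ 1 ψ) (hper : ∀ x, ψ (x + 1) = ψ x) :
    ∫ x in (0 : ℝ)..1, u x t * deriv ψ x = - ∫ x in (0 : ℝ)..1, z x t * ψ x := by
  have hψ' : Continuous (deriv ψ) := hψ.continuous_deriv le_rfl
  obtain ⟨D, hD⟩ := Function.Periodic.exists_abs_le hper hψ.continuous
  have key : ∀ k, ∫ x in (0 : ℝ)..1, deriv ψ x * stepSol (N k) (Δt k) (w k) x t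
      = - ∫ x in (0 : ℝ)..1, stepSlope (N k) (Δt k) (w k) x t
          * stepFun (N k) (fun i => ψ (((i : ℝ) + 1) / N k)) x := by
    intro k
    have hN := NeZero.pos (N k)
    have hN' : (N k : ℝ) ≠ 0 := Nat.cast_ne_zero.2 hN.ne'
    set p := unroll (w k ⌊t / Δt k⌋₊) with hp
    have hreg : IsRegularGrid (N k) L V p := (h.bounds k).isRegularGrid _
    have e1 := integral_mul_stepFun_eq hN (f := p) (F := fun i => ψ ((i : ℝ) / N k))
      (g := deriv ψ) (C := M) (fun i => (h.bounds k).sup _ _)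
      (fun a b => hψ'.intervalIntegrable a b) (by simpa using hreg.per 0)
      (by simpa [div_self hN'] using hper 0) (fun i => by
        rw [intervalIntegral.integral_deriv_eq_sub
          (fun x _ => (hψ.differentiable one_ne_zero).differentiableAt)
          (hψ'.intervalIntegrable _ _), Nat.cast_add, Nat.cast_one])
    have e2 := integral_stepFun hN
      (fun i => gridSlope (N k) p i * ψ (((i : ℝ) + 1) / N k)) (C := L * D) (fun i => by
        rw [abs_mul]
        exact mul_le_mul (hreg.slope i) (hD _) (abs_nonneg _) hreg.nonneg_L)
    refine e1.trans ?_
    refine congrArg _ (Eq.trans ?_ e2.symm)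
    refine Finset.sum_congr rfl fun i _ => ?_
    rw [gridSlope, Nat.cast_add, Nat.cast_one]
    field_simp
  have hpos : ∀ k, 0 < N k := fun k => NeZero.pos _
  have lim1 := h.tendsto_integral_sol_mul t hψ'
  have lim2 := tendsto_integral_mul_of_L1
    (a := fun k x => stepSlope (N k) (Δt k) (w k) x t) (z := fun x => z x t)
    (s := fun k => stepFun (N k) (fun i => ψ (((i : ℝ) + 1) / N k))) (r := ψ) (C := D)
    (fun k => measurable_stepSlope _ _ _ t) (h.measurable_z t) (fun k => measurable_stepFun _ _)
    (fun k x => (h.bounds k).abs_stepSlope_le x t) (fun x => h.abs_z_le x t)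
    (fun k x _ => hD _) (h.tendsto_slope_at t)
    (fun x hx => (hψ.continuous.tendsto x).comp
      (tendsto_floor_add_one_div h.tendsto_N hpos hx.1.le))
  simp only [key] at lim1
  rw [tendsto_nhds_unique lim2.neg lim1]
  simp only [mul_comm]

theorem exists_forall_interpolation_lt (h : ConvergesTo N Δt M L V C w u z)
    {W : ℕ → ℝ → ℝ → ℝ} (hW : ∀ k, IsInterpolation (N k) (Δt k) (w k) (W k))
    (T : ℝ) {ε : ℝ} (hε : 0 < ε) :
    ∃ K, ∀ k ≥ K, ∀ t ∈ Icc 0 T,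
      (∫ x in (0 : ℝ)..1, |W k x t - u x t|)
        + (∫ x in (0 : ℝ)..1, |deriv (fun y => W k y t) x - z x t|) < ε := by
  obtain ⟨K₁, hK₁⟩ := h.tendsto_sol (max 1 T) (ε / 4) (by positivity)
  obtain ⟨K₂, hK₂⟩ := h.tendsto_slope T (ε / 4) (by positivity)
  have hL : Tendsto (fun k => L * (1 / (N k : ℝ))) atTop (𝓝 0) := by
    simpa using (tendsto_one_div_grid h.tendsto_N).const_mul L
  obtain ⟨K₃, hK₃⟩ := eventually_atTop.1
    (hL.eventually_lt_const (show 0 < ε / 4 by positivity))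
  refine ⟨max K₁ (max K₂ K₃), fun k hk t ht => ?_⟩
  simp only [ge_iff_le, max_le_iff] at hk
  have h1 := hK₁ k hk.1
  have h2 := hK₂ k hk.2.1 t ⟨by linarith [ht.1, ht.2], ht.2⟩
  have h3 := hK₃ k hk.2.2
  have e1 : ∫ x in (0 : ℝ)..1, |W k x t - u x t| ≤ ε / 2 := by
    have := intervalIntegral.norm_integral_le_of_norm_le_const_ae (a := (0 : ℝ)) (b := 1)
      (f := fun x => |W k x t - u x t|) (C := ε / 2)
      (ae_restrict_uIoc_iff_cell zero_le_one fun x hx => by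
        rw [Real.norm_eq_abs, abs_abs]
        have a1 := (hW k).abs_sub_stepSol_le (h.bounds k) (h.Δt_pos k) hx ht.1
        have a2 := h1 x ⟨by linarith [hx.1, le_max_left 1 T], hx.2.le.trans (le_max_left _ _)⟩
          t ⟨by linarith [ht.1, le_max_left 1 T], ht.2.trans (le_max_right _ _)⟩
        linarith [abs_sub_le (W k x t) (stepSol (N k) (Δt k) (w k) x t) (u x t)])
    rw [sub_zero, abs_one, mul_one] at this
    exact (le_abs_self _).trans this
  have e2 : ∫ x in (0 : ℝ)..1, |deriv (fun y => W k y t) x - z x t|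
      = ∫ x in (0 : ℝ)..1, |stepSlope (N k) (Δt k) (w k) x t - z x t| := by
    refine intervalIntegral.integral_congr_ae ?_
    filter_upwards [(hW k).ae_deriv_eq (h.Δt_pos k) ht.1] with x hx hx'
    rw [hx hx']
  linarith

end ConvergesTo

end WeakDerivative

section WeakForm

open Set MeasureTheory Filter Topology

/-- `ψ` is a continuously differentiable function of `(x, t)`, `1`-periodic in `x` and vanishing
for `T ≤ t`, with partial derivatives `ψx` and `ψt`, all bounded by `D` for nonnegative
times. -/
structure IsTestFunction (ψ ψx ψt : ℝ → ℝ → ℝ) (T D : ℝ) : Prop where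
  hasDerivAt_x : ∀ x t, HasDerivAt (fun y => ψ y t) (ψx x t) x
  hasDerivAt_t : ∀ x t, HasDerivAt (fun s => ψ x s) (ψt x t) t
  continuous : Continuous fun p : ℝ × ℝ => ψ p.1 p.2
  continuous_x : Continuous fun p : ℝ × ℝ => ψx p.1 p.2
  continuous_t : Continuous fun p : ℝ × ℝ => ψt p.1 p.2
  per : ∀ x t, ψ (x + 1) t = ψ x t
  nonneg_T : 0 ≤ T
  eq_zero : ∀ x t, T ≤ t → ψ x t = 0
  eq_zero_x : ∀ x t, T ≤ t → ψx x t = 0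
  eq_zero_t : ∀ x t, T ≤ t → ψt x t = 0
  abs_le : ∀ x t, 0 ≤ t → |ψ x t| ≤ D
  abs_x_le : ∀ x t, 0 ≤ t → |ψx x t| ≤ D
  abs_t_le : ∀ x t, 0 ≤ t → |ψt x t| ≤ D

theorem exists_dslope_eq_deriv {B : ℝ → ℝ} (hB : Differentiable ℝ B) (a b : ℝ) :
    ∃ ξ ∈ uIcc a b, dslope B a b = deriv B ξ := by
  rcases lt_trichotomy a b with h | rfl | h
  · obtain ⟨ξ, hξ, he⟩ := exists_deriv_eq_slope B h hB.continuous.continuousOn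
      hB.differentiableOn
    exact ⟨ξ, by rw [uIcc_of_le h.le]; exact Ioo_subset_Icc_self hξ, by
      rw [dslope_of_ne _ h.ne', slope_def_field, he]⟩
  · exact ⟨a, by simp, dslope_same _ _⟩
  · obtain ⟨ξ, hξ, he⟩ := exists_deriv_eq_slope B h hB.continuous.continuousOn
      hB.differentiableOn
    exact ⟨ξ, by rw [uIcc_of_ge h.le]; exact Ioo_subset_Icc_self hξ, by
      rw [dslope_of_ne _ h.ne, slope_comm, slope_def_field, he]⟩

theorem exists_gridSlope_eq_deriv {N : ℕ} (hN : 0 < N) {f f' : ℝ → ℝ}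
    (hf : ∀ x, HasDerivAt f (f' x) x) (i : ℕ) :
    ∃ ξ ∈ Icc ((i : ℝ) / N) (((i : ℝ) + 1) / N),
      gridSlope N (fun i => f ((i : ℝ) / N)) i = f' ξ := by
  have hN' : (0 : ℝ) < N := Nat.cast_pos.2 hN
  have hlt : (i : ℝ) / N < ((i : ℝ) + 1) / N := by gcongr; linarith
  obtain ⟨ξ, hξ, he⟩ := exists_hasDerivAt_eq_slope f f' hlt
    (fun x _ => (hf x).continuousAt.continuousWithinAt) (fun x _ => hf x)
  refine ⟨ξ, Ioo_subset_Icc_self hξ, ?_⟩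
  rw [he, gridSlope, Nat.cast_add, Nat.cast_one, ← sub_div, add_sub_cancel_left]
  field_simp

theorem tendsto_sum_mul_of_L1 {N : ℕ → ℕ} (hN : ∀ k, 0 < N k) {g s : ℕ → ℕ → ℝ} {z r : ℝ → ℝ}
    {L C : ℝ} (hz : Measurable z) (hg : ∀ k i, |g k i| ≤ L) (hzL : ∀ x, |z x| ≤ L)
    (hs : ∀ k i, |s k i| ≤ C)
    (hgz : Tendsto (fun k => ∫ x in (0 : ℝ)..1, |stepFun (N k) (g k) x - z x|) atTop (𝓝 0))
    (hsr : ∀ x ∈ Ioo (0 : ℝ) 1, Tendsto (fun k => s k ⌊x * N k⌋₊) atTop (𝓝 (r x))) :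
    Tendsto (fun k => ∑ i ∈ Finset.range (N k), g k i * s k i * (1 / N k)) atTop
      (𝓝 (∫ x in (0 : ℝ)..1, z x * r x)) := by
  have := tendsto_integral_mul_of_L1 (a := fun k => stepFun (N k) (g k))
    (s := fun k => stepFun (N k) (s k)) (fun k => measurable_stepFun _ _) hz
    (fun k => measurable_stepFun _ _) (fun k x => hg k _) hzL (fun k x _ => hs k _) hgz hsr
  refine this.congr fun k => ?_
  exact integral_stepFun (hN k) (fun i => g k i * s k i) (C := L * C) fun i => by
    rw [abs_mul]
    exact mul_le_mul (hg k i) (hs k i) (abs_nonneg _) ((abs_nonneg _).trans (hg k i))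

theorem IsRegularGrid.convexComb {N : ℕ} {L V θ : ℝ} {p q : ℕ → ℝ} (hp : IsRegularGrid N L V p)
    (hq : IsRegularGrid N L V q) (hθ0 : 0 ≤ θ) (hθ1 : θ ≤ 1) :
    IsRegularGrid N L V fun i => θ * p i + (1 - θ) * q i := by
  have hs : ∀ i, gridSlope N (fun i => θ * p i + (1 - θ) * q i) i
      = θ * gridSlope N p i + (1 - θ) * gridSlope N q i := by
    intro i; simp only [gridSlope]; ring
  have hc : ∀ a b : ℝ, |θ * a + (1 - θ) * b| ≤ θ * |a| + (1 - θ) * |b| := by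
    intro a b
    refine (abs_add_le _ _).trans_eq ?_
    rw [abs_mul, abs_mul, abs_of_nonneg hθ0, abs_of_nonneg (sub_nonneg.2 hθ1)]
  have hθ2 := sub_nonneg.2 hθ1
  refine ⟨fun i => by rw [hp.per, hq.per], fun i => ?_, ?_⟩
  · rw [hs]
    calc _ ≤ _ := hc _ _
      _ ≤ θ * L + (1 - θ) * L := by gcongr; exacts [hp.slope i, hq.slope i]
      _ = L := by ring
  · calc _ ≤ ∑ i ∈ Finset.range N, (θ * |gridSlope N p (i + 1) - gridSlope N p i|
              + (1 - θ) * |gridSlope N q (i + 1) - gridSlope N q i|) := by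
          refine Finset.sum_le_sum fun i _ => ?_
          refine le_of_eq_of_le ?_ (hc _ _)
          rw [hs, hs]
          congr 1
          ring
      _ ≤ θ * V + (1 - θ) * V := by
          rw [Finset.sum_add_distrib, ← Finset.mul_sum, ← Finset.mul_sum]
          gcongr
          exacts [hp.var, hq.var]
      _ = V := by ring

/-- The unrolled `θ`-level values between the time steps `n` and `n + 1`. -/
def thetaRow {N : ℕ} (θ : ℝ) (w : ℕ → ZMod N → ℝ) (n i : ℕ) : ℝ :=
  θ * unroll (w (n + 1)) i + (1 - θ) * unroll (w n) i

/-- The discrete `L²` pairing of the time level `n` with `g · t`. -/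
noncomputable def gridPairing (N : ℕ) (w : ℕ → ZMod N → ℝ) (g : ℝ → ℝ → ℝ) (n : ℕ) (t : ℝ) : ℝ :=
  ∑ i ∈ Finset.range N, 1 * (unroll (w n) (i + 1) * g (((i : ℝ) + 1) / N) t) * (1 / N)

/-- The discrete pairing of the slopes of the `θ`-level values with those of `B(w) ψ`. -/
noncomputable def gridFlux (N : ℕ) (θ Δt : ℝ) (B : ℝ → ℝ) (w : ℕ → ZMod N → ℝ) (ψ : ℝ → ℝ → ℝ)
    (n : ℕ) : ℝ :=
  ∑ i ∈ Finset.range N, gridSlope N (thetaRow θ w n) i * (B (thetaRow θ w n (i + 1))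
      * gridSlope N (fun i => ψ ((i : ℝ) / N) (((n : ℝ) + 1) * Δt)) i) * (1 / N)
    + ∑ i ∈ Finset.range N, gridSlope N (thetaRow θ w n) i ^ 2
      * (dslope B (thetaRow θ w n i) (thetaRow θ w n (i + 1))
        * ψ ((i : ℝ) / N) (((n : ℝ) + 1) * Δt)) * (1 / N)

section DiscreteWeakForm

variable {N : ℕ} {θ Δt M L V C T D : ℝ} {B : ℝ → ℝ} {w : ℕ → ZMod N → ℝ}
  {ψ ψx ψt : ℝ → ℝ → ℝ}

theorem measurable_nat_floor_div (f : ℕ → ℝ) (Δt : ℝ) : Measurable fun t : ℝ => f ⌊t / Δt⌋₊ :=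
  (measurable_from_nat (f := f)).comp (Nat.measurable_floor.comp (measurable_id.div_const _))

theorem measurable_gridPairing {g : ℝ → ℝ → ℝ} (hg : Continuous fun p : ℝ × ℝ => g p.1 p.2) :
    Measurable fun t : ℝ => gridPairing N w g ⌊t / Δt⌋₊ t := by
  unfold gridPairing
  refine Finset.measurable_sum _ fun i _ => Measurable.mul_const (Measurable.const_mul ?_ _) _
  refine (measurable_nat_floor_div (fun n => unroll (w n) (i + 1)) Δt).mul ?_
  exact (hg.comp (by fun_prop : Continuous fun t : ℝ => (((i : ℝ) + 1) / N, t))).measurable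

theorem abs_sum_mul_one_div_le (hN : 0 < N) {f : ℕ → ℝ} {A : ℝ} (hf : ∀ i, |f i| ≤ A) :
    |∑ i ∈ Finset.range N, f i * (1 / N)| ≤ A := by
  have hN' : (0 : ℝ) < N := Nat.cast_pos.2 hN
  calc _ ≤ ∑ i ∈ Finset.range N, |f i * (1 / N)| := Finset.abs_sum_le_sum_abs _ _
    _ ≤ ∑ i ∈ Finset.range N, A * (1 / N) := by
      refine Finset.sum_le_sum fun i _ => ?_
      rw [abs_mul, abs_of_pos (by positivity : (0 : ℝ) < 1 / N)]
      gcongr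
      exact hf i
    _ = A := by
      rw [Finset.sum_const, Finset.card_range, nsmul_eq_mul]; field_simp

theorem IsTestFunction.gridPairing_eq_zero (hψ : IsTestFunction ψ ψx ψt T D) (n : ℕ) {t : ℝ}
    (ht : T ≤ t) : gridPairing N w ψt n t = 0 :=
  Finset.sum_eq_zero fun i _ => by rw [hψ.eq_zero_t _ _ ht]; ring

theorem IsTestFunction.gridFlux_eq_zero (hψ : IsTestFunction ψ ψx ψt T D) (n : ℕ)
    (ht : T ≤ ((n : ℝ) + 1) * Δt) : gridFlux N θ Δt B w ψ n = 0 := by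
  simp [gridFlux, gridSlope, hψ.eq_zero _ _ ht]

variable [NeZero N]

theorem GridBounds.isRegularGrid_thetaRow (h : GridBounds N Δt M L V C w) (hθ0 : 0 ≤ θ)
    (hθ1 : θ ≤ 1) (n : ℕ) : IsRegularGrid N L V (thetaRow θ w n) :=
  (h.isRegularGrid (n + 1)).convexComb (h.isRegularGrid n) hθ0 hθ1

theorem GridBounds.abs_thetaRow_le (h : GridBounds N Δt M L V C w) (hθ0 : 0 ≤ θ)
    (hθ1 : θ ≤ 1) (n i : ℕ) : |thetaRow θ w n i| ≤ M := by
  have hθ2 := sub_nonneg.2 hθ1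
  calc _ ≤ _ := abs_add_le _ _
    _ ≤ θ * M + (1 - θ) * M := by
      rw [abs_mul, abs_mul, abs_of_nonneg hθ0, abs_of_nonneg hθ2]
      gcongr
      exacts [h.sup _ _, h.sup _ _]
    _ = M := by ring

theorem GridBounds.abs_thetaRow_sub_le (h : GridBounds N Δt M L V C w) (hθ0 : 0 ≤ θ)
    (hθ1 : θ ≤ 1) (n i : ℕ) : |thetaRow θ w n i - unroll (w n) i| ≤ √(C * Δt) := by
  have h1 := h.time n (n + 1) (Nat.le_succ n) (i : ZMod N)
  rw [Nat.cast_add, Nat.cast_one, add_sub_cancel_left, one_mul] at h1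
  have e : thetaRow θ w n i - unroll (w n) i = θ * (w (n + 1) i - w n i) := by
    rw [thetaRow, unroll, unroll]; ring
  rw [e, abs_mul, abs_of_nonneg hθ0]
  calc _ ≤ 1 * |w (n + 1) (i : ZMod N) - w n i| := by gcongr
    _ ≤ _ := by rw [one_mul]; exact Real.abs_le_sqrt h1

theorem IsThetaScheme.sum_sub_mul_eq (hw : IsThetaScheme N θ Δt B w) (hΔt : 0 < Δt)
    (hψ : ∀ x t, ψ (x + 1) t = ψ x t) (n : ℕ) :
    ∑ i ∈ Finset.range N, (unroll (w (n + 1)) (i + 1) - unroll (w n) (i + 1))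
        * ψ (((i : ℝ) + 1) / N) (((n : ℝ) + 1) * Δt) * (1 / N)
      = -(gridFlux N θ Δt B w ψ n * Δt) := by
  have hN : (N : ℝ) ≠ 0 := Nat.cast_ne_zero.2 (NeZero.ne N)
  set t := ((n : ℝ) + 1) * Δt with ht
  set r := thetaRow θ w n with hr
  set F : ℕ → ℝ := fun i => B (r i) * ψ ((i : ℝ) / N) t with hF
  have hrN : r (0 + N) = r 0 := by simp [hr, thetaRow, unroll]
  have hrN' : r (1 + N) = r 1 := by simp [hr, thetaRow, unroll]
  have hgN : gridSlope N r N = gridSlope N r 0 := by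
    rw [gridSlope, gridSlope, ← zero_add N, zero_add N, add_comm N 1, hrN', ← zero_add N, hrN,
      zero_add, zero_add]
  have hFN : F N = F 0 := by
    have h1 := hψ 0 t
    rw [zero_add] at h1 hrN
    simp only [hF, hrN, div_self hN, h1, Nat.cast_zero, zero_div]
  have hstep : ∀ i : ℕ, unroll (w (n + 1)) (i + 1) - unroll (w n) (i + 1)
      = Δt * N * (B (r (i + 1)) * (gridSlope N r (i + 1) - gridSlope N r i)) := by
    intro i
    have := hw.sub_eq hΔt n ((i + 1 : ℕ) : ZMod N)
    simp only [gridSlope, hr, thetaRow, unroll]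
    rw [this]
    push_cast
    rw [add_sub_cancel_right, gridDx]
    field_simp
    ring
  have hparts := sum_range_mul_sub_eq (f := gridSlope N r) (F := F) hgN hFN
  have hFsub : ∀ i, F (i + 1) - F i = (B (r (i + 1))
      * gridSlope N (fun i => ψ ((i : ℝ) / N) t) i
      + gridSlope N r i * (dslope B (r i) (r (i + 1)) * ψ ((i : ℝ) / N) t)) * (1 / N) := by
    intro i
    have hd := sub_smul_dslope B (r i) (r (i + 1))
    rw [smul_eq_mul] at hd
    have e : gridSlope N r i * (dslope B (r i) (r (i + 1)) * ψ ((i : ℝ) / N) t)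
        = (B (r (i + 1)) - B (r i)) * N * ψ ((i : ℝ) / N) t := by
      rw [← hd, gridSlope]; ring
    rw [e, gridSlope]
    simp only [hF]
    field_simp
    ring
  have hflux : gridFlux N θ Δt B w ψ n
      = ∑ i ∈ Finset.range N, gridSlope N r i * (F (i + 1) - F i) := by
    rw [gridFlux, ← Finset.sum_add_distrib]
    refine Finset.sum_congr rfl fun i _ => ?_
    rw [hFsub]
    ring
  rw [hflux, hparts, neg_mul, neg_neg, Finset.sum_mul]
  refine Finset.sum_congr rfl fun i _ => ?_
  rw [hstep]
  simp only [hF]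
  push_cast
  field_simp

theorem GridBounds.abs_gridPairing_le (h : GridBounds N Δt M L V C w)
    (hψ : IsTestFunction ψ ψx ψt T D) (n : ℕ) {t : ℝ} (ht : 0 ≤ t) :
    |gridPairing N w ψt n t| ≤ M * D := by
  refine abs_sum_mul_one_div_le (NeZero.pos N) fun i => ?_
  rw [one_mul, abs_mul]
  exact mul_le_mul (h.sup _ _) (hψ.abs_t_le _ _ ht) (abs_nonneg _)
    ((abs_nonneg _).trans (h.sup 0 0))

theorem IsTestFunction.abs_gridSlope_le (hψ : IsTestFunction ψ ψx ψt T D) {t : ℝ} (ht : 0 ≤ t)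
    (i : ℕ) : |gridSlope N (fun i => ψ ((i : ℝ) / N) t) i| ≤ D := by
  obtain ⟨ξ, -, he⟩ := exists_gridSlope_eq_deriv (NeZero.pos N)
    (fun x => hψ.hasDerivAt_x x t) i
  rw [he]
  exact hψ.abs_x_le ξ t ht

theorem GridBounds.abs_dslope_thetaRow_le (h : GridBounds N Δt M L V C w) (hθ0 : 0 ≤ θ)
    (hθ1 : θ ≤ 1) (hB : Differentiable ℝ B) {D' : ℝ}
    (hB' : ∀ ξ ∈ Icc (-M) M, |deriv B ξ| ≤ D') (n i m : ℕ) :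
    |dslope B (thetaRow θ w n i) (thetaRow θ w n m)| ≤ D' := by
  obtain ⟨ξ, hξ, he⟩ := exists_dslope_eq_deriv hB (thetaRow θ w n i) (thetaRow θ w n m)
  rw [he]
  exact hB' ξ (uIcc_subset_Icc (abs_le.1 (h.abs_thetaRow_le hθ0 hθ1 n i))
    (abs_le.1 (h.abs_thetaRow_le hθ0 hθ1 n m)) hξ)

theorem GridBounds.abs_gridFlux_le (h : GridBounds N Δt M L V C w) (hθ0 : 0 ≤ θ)
    (hθ1 : θ ≤ 1) (hΔt : 0 < Δt) (hB : Differentiable ℝ B) (hB1 : ∀ ξ, |B ξ| ≤ 1) {D' : ℝ}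
    (hB' : ∀ ξ ∈ Icc (-M) M, |deriv B ξ| ≤ D')
    (hψ : IsTestFunction ψ ψx ψt T D) (n : ℕ) :
    |gridFlux N θ Δt B w ψ n| ≤ L * (1 * D) + L ^ 2 * (D' * D) := by
  have hr := h.isRegularGrid_thetaRow hθ0 hθ1 n
  have ht : 0 ≤ ((n : ℝ) + 1) * Δt := by positivity
  have hD' : 0 ≤ D' := (abs_nonneg _).trans (h.abs_dslope_thetaRow_le hθ0 hθ1 hB hB' 0 0 0)
  have hL := hr.nonneg_L
  refine (abs_add_le _ _).trans (add_le_add ?_ ?_) <;>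
    refine abs_sum_mul_one_div_le (NeZero.pos N) fun i => ?_
  · rw [abs_mul, abs_mul]
    exact mul_le_mul (hr.slope i) (mul_le_mul (hB1 _) (hψ.abs_gridSlope_le ht i) (abs_nonneg _)
      zero_le_one) (by positivity) hL
  · rw [abs_mul, abs_mul, abs_pow]
    exact mul_le_mul (pow_le_pow_left₀ (abs_nonneg _) (hr.slope i) 2)
      (mul_le_mul (h.abs_dslope_thetaRow_le hθ0 hθ1 hB hB' _ _ _) (hψ.abs_le _ _ ht)
        (abs_nonneg _) hD') (by positivity) (by positivity)

theorem IsThetaScheme.integral_time_step (hw : IsThetaScheme N θ Δt B w) (hΔt : 0 < Δt)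
    (hψ : IsTestFunction ψ ψx ψt T D) (n : ℕ) :
    ∫ t in ((n : ℝ) * Δt)..(((n : ℝ) + 1) * Δt),
        (gridPairing N w ψt ⌊t / Δt⌋₊ t - gridFlux N θ Δt B w ψ ⌊t / Δt⌋₊)
      = gridPairing N w ψ (n + 1) (((n : ℝ) + 1) * Δt) - gridPairing N w ψ n (n * Δt) := by
  have hle : (n : ℝ) * Δt ≤ ((n : ℝ) + 1) * Δt := by gcongr; linarith
  have hd : ∀ t, HasDerivAt (fun t => gridPairing N w ψ n t) (gridPairing N w ψt n t) t := by
    intro t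
    exact HasDerivAt.fun_sum fun i _ =>
      (((hψ.hasDerivAt_t _ t).const_mul _).const_mul _).mul_const _
  have hcont : Continuous fun t => gridPairing N w ψt n t := by
    unfold gridPairing
    refine continuous_finsetSum _ fun i _ => ?_
    have := hψ.continuous_t.comp
      (by fun_prop : Continuous fun t : ℝ => (((i : ℝ) + 1) / N, t))
    exact ((this.const_mul _).const_mul _).mul_const _
  have e : ∫ t in ((n : ℝ) * Δt)..(((n : ℝ) + 1) * Δt),
        (gridPairing N w ψt ⌊t / Δt⌋₊ t - gridFlux N θ Δt B w ψ ⌊t / Δt⌋₊)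
      = ∫ t in ((n : ℝ) * Δt)..(((n : ℝ) + 1) * Δt),
        (gridPairing N w ψt n t - gridFlux N θ Δt B w ψ n) := by
    refine intervalIntegral.integral_congr_ae (ae_restrict_uIoc_iff_cell hle fun t ht => ?_)
    have : ⌊t / Δt⌋₊ = n := (Nat.floor_eq_iff
      (div_nonneg ((by positivity : 0 ≤ (n : ℝ) * Δt).trans ht.1) hΔt.le)).2
      ⟨(le_div_iff₀ hΔt).2 ht.1, (div_lt_iff₀ hΔt).2 ht.2⟩
    rw [this]
  rw [e, intervalIntegral.integral_sub (hcont.intervalIntegrable _ _) intervalIntegrable_const,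
    intervalIntegral.integral_eq_sub_of_hasDerivAt (fun t _ => hd t)
      (hcont.intervalIntegrable _ _), intervalIntegral.integral_const, smul_eq_mul]
  have hs := hw.sum_sub_mul_eq hΔt hψ.per n
  have hsplit : gridPairing N w ψ (n + 1) (((n : ℝ) + 1) * Δt)
      - gridPairing N w ψ n (((n : ℝ) + 1) * Δt)
      = ∑ i ∈ Finset.range N, (unroll (w (n + 1)) (i + 1) - unroll (w n) (i + 1))
        * ψ (((i : ℝ) + 1) / N) (((n : ℝ) + 1) * Δt) * (1 / N) := by
    rw [gridPairing, gridPairing, ← Finset.sum_sub_distrib]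
    exact Finset.sum_congr rfl fun i _ => by ring
  rw [hs] at hsplit
  linear_combination -hsplit

theorem IsThetaScheme.integral_eq_neg_initial (hw : IsThetaScheme N θ Δt B w) (hΔt : 0 < Δt)
    (hψ : IsTestFunction ψ ψx ψt T D)
    (hint : ∀ a b, 0 ≤ a → 0 ≤ b → IntervalIntegrable (fun t =>
      gridPairing N w ψt ⌊t / Δt⌋₊ t - gridFlux N θ Δt B w ψ ⌊t / Δt⌋₊) volume a b) :
    ∫ t in (0 : ℝ)..T, (gridPairing N w ψt ⌊t / Δt⌋₊ t - gridFlux N θ Δt B w ψ ⌊t / Δt⌋₊)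
      = -gridPairing N w ψ 0 0 := by
  obtain ⟨m, hm⟩ := exists_nat_ge (T / Δt)
  rw [div_le_iff₀ hΔt] at hm
  have hsum := intervalIntegral.sum_integral_adjacent_intervals (μ := volume)
    (f := fun t => gridPairing N w ψt ⌊t / Δt⌋₊ t - gridFlux N θ Δt B w ψ ⌊t / Δt⌋₊)
    (a := fun n : ℕ => (n : ℝ) * Δt) (n := m)
    (fun n _ => hint _ _ (by positivity) (by positivity))
  simp only [Nat.cast_add, Nat.cast_one, Nat.cast_zero, zero_mul,
    hw.integral_time_step hΔt hψ] at hsum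
  have htel := Finset.sum_range_sub (fun n : ℕ => gridPairing N w ψ n ((n : ℝ) * Δt)) m
  simp only [Nat.cast_add, Nat.cast_one, Nat.cast_zero, zero_mul] at htel
  have hend : gridPairing N w ψ m ((m : ℝ) * Δt) = 0 :=
    Finset.sum_eq_zero fun i _ => by rw [hψ.eq_zero _ _ hm]; ring
  rw [hend, zero_sub] at htel
  have htail : ∫ t in T..((m : ℝ) * Δt),
      (gridPairing N w ψt ⌊t / Δt⌋₊ t - gridFlux N θ Δt B w ψ ⌊t / Δt⌋₊) = 0 := by
    refine intervalIntegral.integral_zero_ae (Eventually.of_forall fun t ht => ?_)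
    rw [uIoc_of_le hm] at ht
    rw [hψ.gridPairing_eq_zero _ ht.1.le, hψ.gridFlux_eq_zero, sub_zero]
    exact ht.1.le.trans ((div_lt_iff₀ hΔt).1 (Nat.lt_floor_add_one _)).le
  have := intervalIntegral.integral_add_adjacent_intervals
    (hint 0 T le_rfl hψ.nonneg_T) (hint T (m * Δt) hψ.nonneg_T (by positivity))
  rw [htail, add_zero] at this
  rw [this, ← hsum, htel]

end DiscreteWeakForm

end WeakForm

section WeakLimit

open Set MeasureTheory Filter Topology

namespace ConvergesTo

variable {N : ℕ → ℕ} [∀ k, NeZero (N k)] {Δt : ℕ → ℝ} {M L V C T D θ : ℝ} {B : ℝ → ℝ}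
  {w : ∀ k, ℕ → ZMod (N k) → ℝ} {u z ψ ψx ψt : ℝ → ℝ → ℝ}

theorem tendsto_sqrt_Δt (h : ConvergesTo N Δt M L V C w u z) :
    Tendsto (fun k => √(C * Δt k)) atTop (𝓝 0) := by
  simpa using (h.tendsto_Δt.const_mul C).sqrt

theorem tendsto_next_time (h : ConvergesTo N Δt M L V C w u z) {t : ℝ} (ht : 0 ≤ t) :
    Tendsto (fun k => ((⌊t / Δt k⌋₊ : ℝ) + 1) * Δt k) atTop (𝓝 t) := by
  rw [tendsto_iff_norm_sub_tendsto_zero]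
  refine squeeze_zero (fun _ => norm_nonneg _) (fun k => ?_) h.tendsto_Δt
  have hk := h.Δt_pos k
  have h1 := (le_div_iff₀ hk).1 (Nat.floor_le (div_nonneg ht hk.le))
  have h2 := (div_lt_iff₀ hk).1 (Nat.lt_floor_add_one (t / Δt k))
  rw [Real.norm_eq_abs, abs_le]
  constructor <;> linarith

theorem tendsto_unroll_succ (h : ConvergesTo N Δt M L V C w u z) (x t : ℝ) :
    Tendsto (fun k => unroll (w k ⌊t / Δt k⌋₊) (⌊x * N k⌋₊ + 1)) atTop (𝓝 (u x t)) := by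
  have h0 : Tendsto (fun k => unroll (w k ⌊t / Δt k⌋₊) (⌊x * N k⌋₊ + 1)
      - stepSol (N k) (Δt k) (w k) x t) atTop (𝓝 0) := by
    refine squeeze_zero_norm (a := fun k => L * (1 / (N k : ℝ))) (fun k => ?_)
      (by simpa using (tendsto_one_div_grid h.tendsto_N).const_mul L)
    have := (h.bounds k).abs_unroll_sub_le ⌊t / Δt k⌋₊ (⌊x * N k⌋₊ + 1) ⌊x * N k⌋₊
    simpa [stepSol, stepFun] using this
  simpa using h0.add (h.tendsto_sol_at x t)

theorem tendsto_thetaRow (h : ConvergesTo N Δt M L V C w u z) (hθ0 : 0 ≤ θ) (hθ1 : θ ≤ 1)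
    (x t : ℝ) :
    Tendsto (fun k => thetaRow θ (w k) ⌊t / Δt k⌋₊ ⌊x * N k⌋₊) atTop (𝓝 (u x t)) := by
  have h0 : Tendsto (fun k => thetaRow θ (w k) ⌊t / Δt k⌋₊ ⌊x * N k⌋₊
      - stepSol (N k) (Δt k) (w k) x t) atTop (𝓝 0) :=
    squeeze_zero_norm (fun k => (h.bounds k).abs_thetaRow_sub_le hθ0 hθ1 _ _) h.tendsto_sqrt_Δt
  simpa using h0.add (h.tendsto_sol_at x t)

theorem tendsto_thetaRow_succ (h : ConvergesTo N Δt M L V C w u z) (hθ0 : 0 ≤ θ) (hθ1 : θ ≤ 1)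
    (x t : ℝ) :
    Tendsto (fun k => thetaRow θ (w k) ⌊t / Δt k⌋₊ (⌊x * N k⌋₊ + 1)) atTop (𝓝 (u x t)) := by
  have h0 : Tendsto (fun k => thetaRow θ (w k) ⌊t / Δt k⌋₊ (⌊x * N k⌋₊ + 1)
      - unroll (w k ⌊t / Δt k⌋₊) (⌊x * N k⌋₊ + 1)) atTop (𝓝 0) :=
    squeeze_zero_norm (fun k => (h.bounds k).abs_thetaRow_sub_le hθ0 hθ1 _ _) h.tendsto_sqrt_Δt
  simpa using h0.add (h.tendsto_unroll_succ x t)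

theorem tendsto_thetaSlope (h : ConvergesTo N Δt M L V C w u z) (hθ0 : 0 ≤ θ) (hθ1 : θ ≤ 1)
    (t : ℝ) :
    Tendsto (fun k => ∫ x in (0 : ℝ)..1,
      |stepFun (N k) (gridSlope (N k) (thetaRow θ (w k) ⌊t / Δt k⌋₊)) x - z x t|) atTop
      (𝓝 0) := by
  have hN1 := tendsto_one_div_grid h.tendsto_N
  have hlim : Tendsto (fun k => 2 * (√(2 * V * (√(C * Δt k) + L * (1 / N k) + L * (1 / N k)))
      + Δt k) + ∫ x in (0 : ℝ)..1, |stepSlope (N k) (Δt k) (w k) x t - z x t|) atTop (𝓝 0) := by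
    have h1 := ((((h.tendsto_sqrt_Δt.add (hN1.const_mul L)).add (hN1.const_mul L)).const_mul
      (2 * V)).sqrt.add h.tendsto_Δt).const_mul 2
    simpa using h1.add (h.tendsto_slope_at t)
  refine squeeze_zero (fun k => intervalIntegral.integral_nonneg zero_le_one
    fun _ _ => abs_nonneg _) (fun k => ?_) hlim
  have hreg := (h.bounds k).isRegularGrid ⌊t / Δt k⌋₊
  have hregθ := (h.bounds k).isRegularGrid_thetaRow hθ0 hθ1 ⌊t / Δt k⌋₊
  have hpos := h.Δt_pos k
  have hnonneg : 0 ≤ 2 * V * (√(C * Δt k) + L * (1 / N k) + L * (1 / N k)) := by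
    have := hreg.nonneg_L
    have := hreg.nonneg_V
    positivity
  have h1 := hregθ.integral_abs_slope_sub_le hreg (NeZero.pos _) (NeZero.pos _)
    (ε := √(C * Δt k))
    (δ := √(2 * V * (√(C * Δt k) + L * (1 / N k) + L * (1 / N k))) + Δt k)
    (by positivity) (fun x _ => (h.bounds k).abs_thetaRow_sub_le hθ0 hθ1 _ _) (by
      nlinarith [Real.sq_sqrt hnonneg, Real.sqrt_nonneg
        (2 * V * (√(C * Δt k) + L * (1 / N k) + L * (1 / N k)))])
  refine le_trans ?_ (add_le_add_left h1 _)
  have hz : IntervalIntegrable (fun x => z x t) volume 0 1 :=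
    intervalIntegrable_of_abs_le (h.measurable_z t) (fun x => h.abs_z_le x t) _ _
  have ha := hregθ.intervalIntegrable_slope 0 1
  have hb := hreg.intervalIntegrable_slope 0 1
  have hab := (ha.sub hb).abs
  have hbz := (hb.sub hz).abs
  refine (intervalIntegral.integral_mono_on zero_le_one (ha.sub hz).abs (hab.add hbz)
    fun x _ => abs_sub_le _ _ _).trans_eq ?_
  exact intervalIntegral.integral_add hab hbz

theorem tendsto_gridPairing (h : ConvergesTo N Δt M L V C w u z) {g : ℝ → ℝ → ℝ}
    (hg : Continuous fun p : ℝ × ℝ => g p.1 p.2) {t : ℝ} (hgD : ∀ x, |g x t| ≤ D) :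
    Tendsto (fun k => gridPairing (N k) (w k) g ⌊t / Δt k⌋₊ t) atTop
      (𝓝 (∫ x in (0 : ℝ)..1, u x t * g x t)) := by
  have hpos : ∀ k, 0 < N k := fun k => NeZero.pos _
  have := tendsto_sum_mul_of_L1 hpos (g := fun _ _ => 1) (z := fun _ => 1) (L := 1) (C := M * D)
    (s := fun k i => unroll (w k ⌊t / Δt k⌋₊) (i + 1) * g (((i : ℝ) + 1) / N k) t)
    (r := fun x => u x t * g x t) measurable_const (by simp) (by simp)
    (fun k i => by
      rw [abs_mul]
      exact mul_le_mul ((h.bounds k).sup _ _) (hgD _) (abs_nonneg _)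
        ((abs_nonneg _).trans ((h.bounds k).sup 0 0)))
    (by simp [stepFun])
    (fun x hx => (h.tendsto_unroll_succ x t).mul ((hg.tendsto (x, t)).comp
      ((tendsto_floor_add_one_div h.tendsto_N hpos hx.1.le).prodMk_nhds tendsto_const_nhds)))
  simpa only [one_mul, gridPairing] using this

theorem tendsto_gridFlux (h : ConvergesTo N Δt M L V C w u z) (hθ0 : 0 ≤ θ) (hθ1 : θ ≤ 1)
    (hB : ContDiff ℝ 1 B) (hB1 : ∀ ξ, |B ξ| ≤ 1) {D' : ℝ}
    (hB' : ∀ ξ ∈ Icc (-M) M, |deriv B ξ| ≤ D')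
    (hψ : IsTestFunction ψ ψx ψt T D) {t : ℝ} (ht : 0 ≤ t) :
    Tendsto (fun k => gridFlux (N k) θ (Δt k) B (w k) ψ ⌊t / Δt k⌋₊) atTop
      (𝓝 ((∫ x in (0 : ℝ)..1, z x t * (B (u x t) * ψx x t))
        + ∫ x in (0 : ℝ)..1, z x t ^ 2 * (deriv B (u x t) * ψ x t))) := by
  have hpos : ∀ k, 0 < N k := fun k => NeZero.pos _
  have hdiff : Differentiable ℝ B := hB.differentiable one_ne_zero
  have htk : ∀ k, 0 ≤ ((⌊t / Δt k⌋₊ : ℝ) + 1) * Δt k := fun k => by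
    have := h.Δt_pos k
    positivity
  have hreg : ∀ k, IsRegularGrid (N k) L V (thetaRow θ (w k) ⌊t / Δt k⌋₊) := fun k =>
    (h.bounds k).isRegularGrid_thetaRow hθ0 hθ1 _
  have hL := (hreg 0).nonneg_L
  have hslope := h.tendsto_thetaSlope hθ0 hθ1 t
  refine Tendsto.add ?_ ?_
  · refine tendsto_sum_mul_of_L1 hpos (h.measurable_z t)
      (L := L) (C := 1 * D) (fun k i => (hreg k).slope i) (fun x => h.abs_z_le x t) (fun k i => ?_)
      hslope fun x hx => ?_
    · rw [abs_mul]
      exact mul_le_mul (hB1 _) (hψ.abs_gridSlope_le (htk k) i) (abs_nonneg _) zero_le_one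
    · refine ((hB.continuous.tendsto _).comp (h.tendsto_thetaRow_succ hθ0 hθ1 x t)).mul ?_
      choose ξ hξ he using fun k => exists_gridSlope_eq_deriv (hpos k)
        (fun x => hψ.hasDerivAt_x x (((⌊t / Δt k⌋₊ : ℝ) + 1) * Δt k)) ⌊x * N k⌋₊
      simp only [he]
      exact (hψ.continuous_x.tendsto (x, t)).comp
        ((tendsto_of_tendsto_of_tendsto_of_le_of_le (tendsto_floor_div h.tendsto_N hpos hx.1.le)
          (tendsto_floor_add_one_div h.tendsto_N hpos hx.1.le) (fun k => (hξ k).1)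
          fun k => (hξ k).2).prodMk_nhds (h.tendsto_next_time ht))
  · refine tendsto_sum_mul_of_L1 hpos ((h.measurable_z t).pow_const 2)
      (L := L ^ 2) (C := D' * D) (fun k i => ?_) (fun x => ?_) (fun k i => ?_) ?_ fun x hx => ?_
    · rw [abs_pow]
      exact pow_le_pow_left₀ (abs_nonneg _) ((hreg k).slope i) 2
    · rw [abs_pow]
      exact pow_le_pow_left₀ (abs_nonneg _) (h.abs_z_le x t) 2
    · rw [abs_mul]
      have hd := (h.bounds k).abs_dslope_thetaRow_le hθ0 hθ1 hdiff hB' ⌊t / Δt k⌋₊ i (i + 1)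
      exact mul_le_mul hd (hψ.abs_le _ _ (htk k)) (abs_nonneg _) ((abs_nonneg _).trans hd)
    · refine squeeze_zero (fun k => intervalIntegral.integral_nonneg zero_le_one
        fun _ _ => abs_nonneg _) (fun k => ?_) (by simpa using hslope.const_mul (L + L))
      have hz := intervalIntegrable_of_abs_le (h.measurable_z t) (fun x => h.abs_z_le x t) 0 1
      have hint := (((hreg k).intervalIntegrable_slope 0 1).sub hz).abs.const_mul (L + L)
      rw [← intervalIntegral.integral_const_mul]
      refine intervalIntegral.integral_mono_on zero_le_one ?_ hint fun x _ => ?_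
      · refine intervalIntegrable_of_abs_le (C := L ^ 2 + L ^ 2)
          ((measurable_stepFun _ _).sub ((h.measurable_z t).pow_const 2)).abs (fun x => ?_) _ _
        rw [abs_abs]
        refine (abs_sub _ _).trans (add_le_add ?_ ?_)
        · rw [stepFun, abs_pow]
          exact pow_le_pow_left₀ (abs_nonneg _) ((hreg k).slope _) 2
        · rw [abs_pow]
          exact pow_le_pow_left₀ (abs_nonneg _) (h.abs_z_le x t) 2
      · have e : stepFun (N k) (fun i => gridSlope (N k)
            (thetaRow θ (w k) ⌊t / Δt k⌋₊) i ^ 2) x - z x t ^ 2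
            = (gridSlope (N k) (thetaRow θ (w k) ⌊t / Δt k⌋₊) ⌊x * N k⌋₊ + z x t)
              * (gridSlope (N k) (thetaRow θ (w k) ⌊t / Δt k⌋₊) ⌊x * N k⌋₊ - z x t) := by
          rw [stepFun]; ring
        rw [e, abs_mul]
        exact mul_le_mul_of_nonneg_right ((abs_add_le _ _).trans
          (add_le_add ((hreg k).slope _) (h.abs_z_le x t))) (abs_nonneg _)
    · refine Tendsto.mul ?_ ?_
      · choose ξ hξ he using fun k => exists_dslope_eq_deriv hdiff
          (thetaRow θ (w k) ⌊t / Δt k⌋₊ ⌊x * N k⌋₊) (thetaRow θ (w k) ⌊t / Δt k⌋₊ (⌊x * N k⌋₊ + 1))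
        simp only [he]
        refine ((hB.continuous_deriv le_rfl).tendsto _).comp ?_
        have h1 := h.tendsto_thetaRow hθ0 hθ1 x t
        have h2 := h.tendsto_thetaRow_succ hθ0 hθ1 x t
        have h3 := (h2.sub h1).abs
        rw [sub_self, abs_zero] at h3
        have h4 : Tendsto (fun k => ξ k - thetaRow θ (w k) ⌊t / Δt k⌋₊ ⌊x * N k⌋₊) atTop (𝓝 0) :=
          squeeze_zero_norm (fun k => abs_sub_left_of_mem_uIcc (hξ k)) h3
        simpa using h4.add h1
      · exact (hψ.continuous.tendsto (x, t)).comp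
          ((tendsto_floor_div h.tendsto_N hpos hx.1.le).prodMk_nhds (h.tendsto_next_time ht))

theorem weak_form (h : ConvergesTo N Δt M L V C w u z) (hθ0 : 0 ≤ θ) (hθ1 : θ ≤ 1)
    (hw : ∀ k, IsThetaScheme (N k) θ (Δt k) B (w k))
    (hB : ContDiff ℝ 1 B) (hB1 : ∀ ξ, |B ξ| ≤ 1) (hψ : IsTestFunction ψ ψx ψt T D) :
    (∫ t in (0 : ℝ)..T, ((∫ x in (0 : ℝ)..1, u x t * ψt x t)
        - ((∫ x in (0 : ℝ)..1, z x t * (B (u x t) * ψx x t))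
          + ∫ x in (0 : ℝ)..1, z x t ^ 2 * (deriv B (u x t) * ψ x t))))
      = -∫ x in (0 : ℝ)..1, u x 0 * ψ x 0 := by
  obtain ⟨D', hB'⟩ := isCompact_Icc.exists_bound_of_continuousOn (s := Icc (-M) M)
    (hB.continuous_deriv le_rfl).continuousOn
  have hdiff : Differentiable ℝ B := hB.differentiable one_ne_zero
  have hmeas : ∀ k, Measurable fun t => gridPairing (N k) (w k) ψt ⌊t / Δt k⌋₊ t
      - gridFlux (N k) θ (Δt k) B (w k) ψ ⌊t / Δt k⌋₊ := fun k =>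
    (measurable_gridPairing hψ.continuous_t).sub (measurable_nat_floor_div _ _)
  have hbd : ∀ k t, 0 ≤ t → ‖gridPairing (N k) (w k) ψt ⌊t / Δt k⌋₊ t
      - gridFlux (N k) θ (Δt k) B (w k) ψ ⌊t / Δt k⌋₊‖
        ≤ M * D + (L * (1 * D) + L ^ 2 * (D' * D)) := fun k t ht =>
    (norm_sub_le _ _).trans (add_le_add ((h.bounds k).abs_gridPairing_le hψ _ ht)
      ((h.bounds k).abs_gridFlux_le hθ0 hθ1 (h.Δt_pos k) hdiff hB1 hB' hψ _))
  have hdisc : ∀ k, ∫ t in (0 : ℝ)..T, (gridPairing (N k) (w k) ψt ⌊t / Δt k⌋₊ t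
      - gridFlux (N k) θ (Δt k) B (w k) ψ ⌊t / Δt k⌋₊) = -gridPairing (N k) (w k) ψ 0 0 := by
    intro k
    refine (hw k).integral_eq_neg_initial (h.Δt_pos k) hψ fun a b ha hb => ?_
    refine intervalIntegrable_const.mono_fun'
      (g := fun _ => M * D + (L * (1 * D) + L ^ 2 * (D' * D)))
      (hmeas k).aestronglyMeasurable
      ((ae_restrict_iff' measurableSet_uIoc).2 (Eventually.of_forall fun t ht => ?_))
    exact hbd k t ((le_min ha hb).trans ht.1.le)
  have lim1 : Tendsto (fun k => ∫ t in (0 : ℝ)..T, (gridPairing (N k) (w k) ψt ⌊t / Δt k⌋₊ t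
      - gridFlux (N k) θ (Δt k) B (w k) ψ ⌊t / Δt k⌋₊)) atTop
      (𝓝 (∫ t in (0 : ℝ)..T, ((∫ x in (0 : ℝ)..1, u x t * ψt x t)
        - ((∫ x in (0 : ℝ)..1, z x t * (B (u x t) * ψx x t))
          + ∫ x in (0 : ℝ)..1, z x t ^ 2 * (deriv B (u x t) * ψ x t))))) := by
    refine intervalIntegral.tendsto_integral_filter_of_dominated_convergence
      (fun _ => M * D + (L * (1 * D) + L ^ 2 * (D' * D)))
      (Eventually.of_forall fun k => (hmeas k).aestronglyMeasurable)
      (Eventually.of_forall fun k => Eventually.of_forall fun t ht => hbd k t ?_)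
      intervalIntegrable_const (Eventually.of_forall fun t ht => ?_)
    · rw [uIoc_of_le hψ.nonneg_T] at ht
      exact ht.1.le
    · rw [uIoc_of_le hψ.nonneg_T] at ht
      exact (h.tendsto_gridPairing hψ.continuous_t (fun x => hψ.abs_t_le x t ht.1.le)).sub
        (h.tendsto_gridFlux hθ0 hθ1 hB hB1 hB' hψ ht.1.le)
  simp only [hdisc] at lim1
  have lim2 := h.tendsto_gridPairing hψ.continuous (t := 0) (fun x => hψ.abs_le x 0 le_rfl)
  simp only [zero_div, Nat.floor_zero] at lim2
  exact tendsto_nhds_unique lim1 lim2.neg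

theorem initial_trace (h : ConvergesTo N Δt M L V C w u z) {w₀ : ℝ → ℝ} (hw₀ : Continuous w₀)
    {K : ℝ} (hinit : ∀ k (j : ZMod (N k)), |w k 0 j - w₀ ((j.val : ℝ) / N k)| ≤ K * (1 / N k))
    {x : ℝ} (hx : x ∈ Ico (0 : ℝ) 1) : u x 0 = w₀ x := by
  have hpos : ∀ k, 0 < N k := fun k => NeZero.pos _
  have h1 : Tendsto (fun k => stepSol (N k) (Δt k) (w k) x 0
      - w₀ ((⌊x * N k⌋₊ : ℝ) / N k)) atTop (𝓝 0) := by
    refine squeeze_zero_norm (a := fun k => K * (1 / (N k : ℝ))) (fun k => ?_)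
      (by simpa using (tendsto_one_div_grid h.tendsto_N).const_mul K)
    have := hinit k (⌊x * N k⌋₊ : ZMod (N k))
    rw [ZMod.val_cast_of_lt (floor_mul_lt (hpos k) hx.2)] at this
    simpa [stepSol, stepFun, unroll] using this
  have h2 := (hw₀.tendsto x).comp (tendsto_floor_div h.tendsto_N hpos hx.1)
  refine tendsto_nhds_unique (h.tendsto_sol_at x 0) ?_
  simpa using h1.add h2

end ConvergesTo

end WeakLimit

section TestFunctions

open Set MeasureTheory Filter Topology

theorem exists_abs_le_of_periodic_of_vanishing {g : ℝ → ℝ → ℝ}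
    (hg : Continuous fun p : ℝ × ℝ => g p.1 p.2) (hper : ∀ x t, g (x + 1) t = g x t) {T : ℝ}
    (hT : ∀ x t, T ≤ t → g x t = 0) : ∃ D, ∀ x t, 0 ≤ t → |g x t| ≤ D := by
  obtain ⟨D, hD⟩ := (isCompact_Icc.prod isCompact_Icc).exists_bound_of_continuousOn
    (s := Icc (0 : ℝ) 1 ×ˢ Icc (0 : ℝ) |T|) hg.continuousOn
  have hD0 : 0 ≤ D := (norm_nonneg _).trans
    (hD (0, 0) ⟨⟨le_rfl, zero_le_one⟩, ⟨le_rfl, abs_nonneg T⟩⟩)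
  refine ⟨D, fun x t ht => ?_⟩
  rcases le_total |T| t with h | h
  · rwa [hT x t ((le_abs_self T).trans h), abs_zero]
  · have hp : Function.Periodic (fun y => g y t) 1 := fun y => hper y t
    obtain ⟨y, hy, hxy⟩ := hp.exists_mem_Ico₀ one_pos x
    rw [hxy]
    exact hD (y, t) ⟨Ico_subset_Icc_self hy, ht, h⟩

theorem exists_isTestFunction {ψ : ℝ → ℝ → ℝ} (hψ : ContDiff ℝ 1 fun p : ℝ × ℝ => ψ p.1 p.2)
    (hper : ∀ x t, ψ (x + 1) t = ψ x t) {T : ℝ} (hT : ∀ x t, T ≤ t → ψ x t = 0) :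
    ∃ T' D, IsTestFunction ψ (fun x t => deriv (fun y => ψ y t) x)
      (fun x t => deriv (fun s => ψ x s) t) T' D := by
  have hd := hψ.differentiable one_ne_zero
  have hx : ∀ x t, HasDerivAt (fun y => ψ y t)
      (fderiv ℝ (fun p : ℝ × ℝ => ψ p.1 p.2) (x, t) (1, 0)) x := fun x t =>
    (hd (x, t)).hasFDerivAt.comp_hasDerivAt (f := fun y : ℝ => (y, t)) x
      ((hasDerivAt_id x).prodMk (hasDerivAt_const x t))
  have ht : ∀ x t, HasDerivAt (fun s => ψ x s)
      (fderiv ℝ (fun p : ℝ × ℝ => ψ p.1 p.2) (x, t) (0, 1)) t := fun x t =>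
    (hd (x, t)).hasFDerivAt.comp_hasDerivAt (f := fun s : ℝ => (x, s)) t
      ((hasDerivAt_const t x).prodMk (hasDerivAt_id t))
  have hf := hψ.continuous_fderiv one_ne_zero
  have hcx : Continuous fun p : ℝ × ℝ => deriv (fun y => ψ y p.2) p.1 := by
    simp only [(hx _ _).deriv]
    exact hf.clm_apply continuous_const
  have hct : Continuous fun p : ℝ × ℝ => deriv (fun s => ψ p.1 s) p.2 := by
    simp only [(ht _ _).deriv]
    exact hf.clm_apply continuous_const
  have hle : T ≤ max T 0 + 1 := by linarith [le_max_left T 0]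
  have h0 : ∀ x t, max T 0 + 1 ≤ t → ψ x t = 0 := fun x t h => hT x t (hle.trans h)
  have h0x : ∀ x t, max T 0 + 1 ≤ t → deriv (fun y => ψ y t) x = 0 := by
    intro x t h
    simp [h0 _ t h]
  have h0t : ∀ x t, max T 0 + 1 ≤ t → deriv (fun s => ψ x s) t = 0 := by
    intro x t h
    have hlt : T < t := by linarith [le_max_left T 0]
    have : (fun s => ψ x s) =ᶠ[𝓝 t] fun _ => 0 := by
      filter_upwards [Ioi_mem_nhds hlt] with s hs
      exact hT x s (le_of_lt hs)
    rw [this.deriv_eq, deriv_const]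
  have hperx : ∀ x t, deriv (fun y => ψ y t) (x + 1) = deriv (fun y => ψ y t) x := by
    intro x t
    rw [← deriv_comp_add_const]
    simp only [hper]
  obtain ⟨D₁, hD₁⟩ := exists_abs_le_of_periodic_of_vanishing hψ.continuous hper h0
  obtain ⟨D₂, hD₂⟩ := exists_abs_le_of_periodic_of_vanishing
    (g := fun x t => deriv (fun y => ψ y t) x) hcx hperx h0x
  obtain ⟨D₃, hD₃⟩ := exists_abs_le_of_periodic_of_vanishing
    (g := fun x t => deriv (fun s => ψ x s) t) hct (fun x t => by simp only [hper]) h0t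
  refine ⟨max T 0 + 1, max D₁ (max D₂ D₃), fun x t => (hx x t).differentiableAt.hasDerivAt,
    fun x t => (ht x t).differentiableAt.hasDerivAt, hψ.continuous, hcx, hct, hper,
    by positivity, h0, h0x, h0t, fun x t h => (hD₁ x t h).trans (le_max_left _ _),
    fun x t h => (hD₂ x t h).trans ((le_max_left _ _).trans (le_max_right _ _)),
    fun x t h => (hD₃ x t h).trans ((le_max_right _ _).trans (le_max_right _ _))⟩

namespace ConvergesTo

variable {N : ℕ → ℕ} [∀ k, NeZero (N k)] {Δt : ℕ → ℝ} {M L V C T D θ : ℝ} {B : ℝ → ℝ}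
  {w : ∀ k, ℕ → ZMod (N k) → ℝ} {u z ψ ψx ψt : ℝ → ℝ → ℝ}

theorem integral_split (h : ConvergesTo N Δt M L V C w u z) (hB : ContDiff ℝ 1 B)
    (hB1 : ∀ ξ, |B ξ| ≤ 1) (hψ : IsTestFunction ψ ψx ψt T D) {t : ℝ} (ht : 0 ≤ t) :
    ∫ x in (0 : ℝ)..1, (u x t * ψt x t - B (u x t) * z x t * ψx x t
        - deriv B (u x t) * (z x t) ^ 2 * ψ x t)
      = (∫ x in (0 : ℝ)..1, u x t * ψt x t)
        - ((∫ x in (0 : ℝ)..1, z x t * (B (u x t) * ψx x t))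
          + ∫ x in (0 : ℝ)..1, z x t ^ 2 * (deriv B (u x t) * ψ x t)) := by
  obtain ⟨D', hB'⟩ := isCompact_Icc.exists_bound_of_continuousOn (s := Icc (-M) M)
    (hB.continuous_deriv le_rfl).continuousOn
  have hM : 0 ≤ M := (abs_nonneg _).trans (h.abs_u_le 0 0)
  have hL : 0 ≤ L := (abs_nonneg _).trans (h.abs_z_le 0 0)
  have hud : ∀ x, |deriv B (u x t)| ≤ D' := fun x => hB' _ (abs_le.1 (h.abs_u_le x t))
  have hD' : 0 ≤ D' := (abs_nonneg _).trans (hud 0)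
  have slice : Continuous fun x : ℝ => (x, t) := by fun_prop
  have i1 : IntervalIntegrable (fun x => u x t * ψt x t) volume 0 1 :=
    intervalIntegrable_of_abs_le (g := fun x => u x t * ψt x t) (C := M * D)
      ((h.measurable_u t).mul (hψ.continuous_t.comp slice).measurable) (fun x => by
        rw [abs_mul]
        exact mul_le_mul (h.abs_u_le x t) (hψ.abs_t_le x t ht) (abs_nonneg _) hM) _ _
  have i2 : IntervalIntegrable (fun x => z x t * (B (u x t) * ψx x t)) volume 0 1 :=
    intervalIntegrable_of_abs_le (g := fun x => z x t * (B (u x t) * ψx x t)) (C := L * (1 * D))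
      ((h.measurable_z t).mul ((hB.continuous.measurable.comp (h.measurable_u t)).mul
        (hψ.continuous_x.comp slice).measurable)) (fun x => by
        rw [abs_mul, abs_mul]
        exact mul_le_mul (h.abs_z_le x t) (mul_le_mul (hB1 _) (hψ.abs_x_le x t ht)
          (abs_nonneg _) zero_le_one) (by positivity) hL) _ _
  have i3 : IntervalIntegrable (fun x => z x t ^ 2 * (deriv B (u x t) * ψ x t)) volume 0 1 :=
    intervalIntegrable_of_abs_le (g := fun x => z x t ^ 2 * (deriv B (u x t) * ψ x t))
      (C := L ^ 2 * (D' * D))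
      (((h.measurable_z t).pow_const 2).mul
        (((hB.continuous_deriv le_rfl).measurable.comp (h.measurable_u t)).mul
        (hψ.continuous.comp slice).measurable)) (fun x => by
        rw [abs_mul, abs_mul, abs_pow]
        exact mul_le_mul (pow_le_pow_left₀ (abs_nonneg _) (h.abs_z_le x t) 2)
          (mul_le_mul (hud x) (hψ.abs_le x t ht) (abs_nonneg _) hD')
          (by positivity) (by positivity)) _ _
  rw [← intervalIntegral.integral_add i2 i3, ← intervalIntegral.integral_sub i1 (i2.add i3)]
  exact intervalIntegral.integral_congr fun x _ => by ring

theorem integral_Ioi_eq (h : ConvergesTo N Δt M L V C w u z) (hθ0 : 0 ≤ θ) (hθ1 : θ ≤ 1)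
    (hw : ∀ k, IsThetaScheme (N k) θ (Δt k) B (w k))
    (hB : ContDiff ℝ 1 B) (hB1 : ∀ ξ, |B ξ| ≤ 1) (hψ : IsTestFunction ψ ψx ψt T D) :
    ∫ t in Ioi (0 : ℝ), ∫ x in (0 : ℝ)..1, (u x t * ψt x t - B (u x t) * z x t * ψx x t
        - deriv B (u x t) * (z x t) ^ 2 * ψ x t)
      = -∫ x in (0 : ℝ)..1, u x 0 * ψ x 0 := by
  rw [← h.weak_form hθ0 hθ1 hw hB hB1 hψ, intervalIntegral.integral_of_le hψ.nonneg_T,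
    setIntegral_eq_of_subset_of_forall_sdiff_eq_zero measurableSet_Ioi
      (show Ioc 0 T ⊆ Ioi 0 from Ioc_subset_Ioi_self)]
  · exact setIntegral_congr_fun measurableSet_Ioc fun t ht =>
      h.integral_split hB hB1 hψ ht.1.le
  · intro t ht
    have hTt : T ≤ t := by
      by_contra! hlt
      exact ht.2 ⟨ht.1, hlt.le⟩
    simp [hψ.eq_zero _ _ hTt, hψ.eq_zero_x _ _ hTt, hψ.eq_zero_t _ _ hTt]

end ConvergesTo

end TestFunctions

/-- **Main convergence theorem.** For a sequence of grids with `N k → ∞`, `Δt k → 0`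
satisfying the CFL condition, and θ-scheme solutions `w k` with cell-average initial data
from a 1-periodic Lipschitz `w₀` whose derivative has bounded variation on `[0,1]`,
a subsequence of the space-time interpolations `W k` converges in
`C([0,∞); W^{1,1}(0,1))` (i.e., uniformly in `t` on compacts, in `L¹` in `x`, together with
the spatial derivatives) to a bounded weak solution `u` (with bounded weak `x`-derivative
`z`) of `w_t = B(w) w_xx` with initial data `w₀`. -/
theorem scheme_convergence_to_weak_solution
    (B : ℝ → ℝ) (hBreg : ContDiff ℝ 2 B)
    (hB0 : ∀ ξ : ℝ, 0 ≤ B ξ) (hB1 : ∀ ξ : ℝ, B ξ ≤ 1)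
    (θ : ℝ) (hθ0 : 0 ≤ θ) (hθ1 : θ ≤ 1)
    (w₀ : ℝ → ℝ) (hw₀per : ∀ x : ℝ, w₀ (x + 1) = w₀ x)
    (Lip : NNReal) (hw₀lip : LipschitzWith Lip w₀)
    (hw₀BV : BoundedVariationOn (deriv w₀) (Set.Icc 0 1))
    (N : ℕ → ℕ) (hN2 : ∀ k, 2 ≤ N k)
    (hNinf : Filter.Tendsto N Filter.atTop Filter.atTop)
    (Δt : ℕ → ℝ) (hΔtpos : ∀ k, 0 < Δt k)
    (hΔt0 : Filter.Tendsto Δt Filter.atTop (nhds 0))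
    (hCFL : ∀ k, Δt k / (gridDx (N k)) ^ 2 * (1 - θ) < 1 / 2)
    (w : ∀ k : ℕ, ℕ → ZMod (N k) → ℝ)
    (hw : ∀ k, IsThetaScheme (N k) θ (Δt k) B (w k))
    (hinit : ∀ k (j : ZMod (N k)),
      w k 0 j = (N k : ℝ) *
        ∫ x in ((j.val : ℝ) / (N k) - 1 / (2 * (N k)))..((j.val : ℝ) / (N k) + 1 / (2 * (N k))),
          w₀ x)
    (W : ℕ → ℝ → ℝ → ℝ)
    (hW : ∀ k (n : ℕ) (j : ZMod (N k)),
      ∀ x ∈ Set.Ico ((j.val : ℝ) / (N k)) (((j.val : ℝ) + 1) / (N k)),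
      ∀ t ∈ Set.Ico ((n : ℝ) * Δt k) (((n : ℝ) + 1) * Δt k),
      W k x t = ((((j.val : ℝ) + 1) / (N k) - x) * (N k)) * w k n j
                + ((x - (j.val : ℝ) / (N k)) * (N k)) * w k n (j + 1)) :
    ∃ φ : ℕ → ℕ, StrictMono φ ∧
    ∃ u z : ℝ → ℝ → ℝ,
      -- `u` and its weak spatial derivative `z` are bounded
      (∃ M : ℝ, ∀ x t : ℝ, |u x t| ≤ M ∧ |z x t| ≤ M) ∧
      -- `z` is the weak spatial derivative of `u`
      (∀ t : ℝ, 0 ≤ t → ∀ ψ : ℝ → ℝ, ContDiff ℝ (⊤ : ℕ∞) ψ → (∀ x : ℝ, ψ (x + 1) = ψ x) →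
        ∫ x in (0 : ℝ)..1, u x t * deriv ψ x = - ∫ x in (0 : ℝ)..1, z x t * ψ x) ∧
      -- convergence in `C([0,T]; W^{1,1})` along the subsequence
      (∀ T : ℝ, 0 < T → ∀ ε : ℝ, 0 < ε → ∃ K : ℕ, ∀ l : ℕ, K ≤ l →
        ∀ t ∈ Set.Icc (0 : ℝ) T,
          (∫ x in (0 : ℝ)..1, |W (φ l) x t - u x t|)
            + (∫ x in (0 : ℝ)..1, |deriv (fun y => W (φ l) y t) x - z x t|) < ε) ∧
      -- `u` is a weak solution of `w_t = B(w) w_xx` with initial data `w₀`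
      (∀ ψ : ℝ → ℝ → ℝ, ContDiff ℝ (⊤ : ℕ∞) (fun p : ℝ × ℝ => ψ p.1 p.2) →
        (∀ x t : ℝ, ψ (x + 1) t = ψ x t) →
        (∃ T : ℝ, ∀ x t : ℝ, T ≤ t → ψ x t = 0) →
        (∫ t in Set.Ioi (0 : ℝ), ∫ x in (0 : ℝ)..1,
            (u x t * deriv (fun s => ψ x s) t
              - B (u x t) * z x t * deriv (fun y => ψ y t) x
              - deriv B (u x t) * (z x t) ^ 2 * ψ x t))
          + (∫ x in (0 : ℝ)..1, w₀ x * ψ x 0) = 0) := by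
  have : ∀ k, NeZero (N k) := fun k => ⟨by have := hN2 k; omega⟩
  obtain ⟨M, V, hMV⟩ := cellAverage_bounds hw₀per hw₀lip hw₀BV
  have hbounds : ∀ k, GridBounds (N k) (Δt k) M Lip V ((2 * M + 4 * Lip) * V) (w k) := fun k =>
    have hk := hMV (N k) (w k 0) (hN2 k) (hinit k)
    (hw k).gridBounds hB0 hB1 hθ0 hθ1 (hΔtpos k) (hCFL k) hk.1 hk.2.1 hk.2.2.1
  have hB : ContDiff ℝ 1 B := hBreg.of_le one_le_two
  have hBabs : ∀ ξ, |B ξ| ≤ 1 := fun ξ => by rw [abs_of_nonneg (hB0 ξ)]; exact hB1 ξ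
  obtain ⟨φ, hφ, u, z, h⟩ := exists_subseq_convergesTo hNinf hΔtpos hΔt0 hbounds
  refine ⟨φ, hφ, u, z, ⟨max M Lip, fun x t => ⟨(h.abs_u_le x t).trans (le_max_left _ _),
    (h.abs_z_le x t).trans (le_max_right _ _)⟩⟩, fun t _ ψ hψ hper =>
    h.integral_mul_deriv_eq t (hψ.of_le (by exact_mod_cast le_top)) hper,
    fun T _ ε hε => h.exists_forall_interpolation_lt (W := fun l => W (φ l))
      (fun l => hW (φ l)) T hε, fun ψ hψ hper ⟨T, hT⟩ => ?_⟩
  obtain ⟨T', D, htest⟩ := exists_isTestFunction (hψ.of_le (by exact_mod_cast le_top)) hper hT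
  have htrace : ∫ x in (0 : ℝ)..1, u x 0 * ψ x 0 = ∫ x in (0 : ℝ)..1, w₀ x * ψ x 0 := by
    refine intervalIntegral.integral_congr_ae
      (ae_restrict_uIoc_iff_cell zero_le_one fun x hx => ?_)
    rw [h.initial_trace hw₀lip.continuous
      (fun l => (hMV (N (φ l)) (w (φ l) 0) (hN2 _) (hinit _)).2.2.2) hx]
  rw [h.integral_Ioi_eq hθ0 hθ1 (fun l => hw (φ l)) hB hBabs htest, htrace, neg_add_cancel]
end

section
/- Let B : ℝ → ℝ be continuously differentiable with B(ξ) ≥ 0 for all ξ, and let w : ℝ × [0,T] → ℝ be a smooth function, 1-periodic in x, satisfying ∂_t w = B(w) ∂_x² w on ℝ × [0,T]. Let η : ℝ → ℝ be a twice continuously differentiable convex function. Then the function t ↦ ∫₀¹ η(∂_x w(x,t)) dx is nonincreasing on [0,T]. -/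
set_option autoImplicit false

/-- The restriction of a differentiable function on the plane to a horizontal line. -/
lemma hasDerivAt_fst_slice {g : ℝ × ℝ → ℝ} (hg : Differentiable ℝ g) (x t : ℝ) :
    HasDerivAt (fun y => g (y, t)) (fderiv ℝ g (x, t) (1, 0)) x :=
  (hg (x, t)).hasFDerivAt.comp_hasDerivAt x ((hasDerivAt_id x).prodMk (hasDerivAt_const x t))

/-- The restriction of a differentiable function on the plane to a vertical line. -/
lemma hasDerivAt_snd_slice {g : ℝ × ℝ → ℝ} (hg : Differentiable ℝ g) (x t : ℝ) :
    HasDerivAt (fun s => g (x, s)) (fderiv ℝ g (x, t) (0, 1)) t :=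
  (hg (x, t)).hasFDerivAt.comp_hasDerivAt t ((hasDerivAt_const t x).prodMk (hasDerivAt_id t))

lemma contDiff_fderiv_apply_const {g : ℝ × ℝ → ℝ} (hg : ContDiff ℝ (⊤ : ℕ∞) g) (v : ℝ × ℝ) :
    ContDiff ℝ (⊤ : ℕ∞) (fun p => fderiv ℝ g p v) :=
  (hg.fderiv_right (m := (⊤ : ℕ∞)) (by simp)).clm_apply contDiff_const

/-- Directional derivatives of a smooth function commute. -/
lemma fderiv_fderiv_apply_comm {g : ℝ × ℝ → ℝ} (hg : ContDiff ℝ (⊤ : ℕ∞) g) (p u v : ℝ × ℝ) :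
    fderiv ℝ (fun q => fderiv ℝ g q u) p v = fderiv ℝ (fun q => fderiv ℝ g q v) p u := by
  have hd : DifferentiableAt ℝ (fderiv ℝ g) p :=
    (hg.fderiv_right (m := (⊤ : ℕ∞)) (by simp)).differentiable (by simp) p
  have key : ∀ a b : ℝ × ℝ,
      fderiv ℝ (fun q => fderiv ℝ g q a) p b = fderiv ℝ (fderiv ℝ g) p b a := by
    intro a b
    rw [fderiv_clm_apply hd (differentiableAt_const a)]
    simp
  have hs : IsSymmSndFDerivAt ℝ g p :=
    hg.contDiffAt.isSymmSndFDerivAt (by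
      rw [minSmoothness_of_isRCLikeNormedField]
      exact WithTop.coe_le_coe.2 le_top)
  rw [key, key, hs.eq]

/-- The increment in `t` of an integral over `x` is the iterated integral of the `t`-derivative. -/
lemma integral_sub_integral_eq_integral_integral {h h' : ℝ × ℝ → ℝ} (hh : Continuous h)
    (hh' : Continuous h') (hd : ∀ x t, HasDerivAt (fun s => h (x, s)) (h' (x, t)) t)
    (c d a b : ℝ) :
    (∫ x in c..d, h (x, b)) - ∫ x in c..d, h (x, a) = ∫ t in a..b, ∫ x in c..d, h' (x, t) := by
  rw [← intervalIntegral.integral_sub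
    ((by fun_prop : Continuous fun x => h (x, b)).intervalIntegrable _ _)
    ((by fun_prop : Continuous fun x => h (x, a)).intervalIntegrable _ _),
    MeasureTheory.intervalIntegral_intervalIntegral_swap (F := fun t x => h' (x, t))]
  · refine intervalIntegral.integral_congr fun x _ => ?_
    exact (intervalIntegral.integral_eq_sub_of_hasDerivAt (fun t _ => hd x t)
      ((by fun_prop : Continuous fun t => h' (x, t)).intervalIntegrable _ _)).symm
  · refine (ContinuousOn.integrableOn_compact (isCompact_uIcc.prod isCompact_uIcc)
      (f := fun p : ℝ × ℝ => h' (p.2, p.1)) (by fun_prop)).mono_set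
      (Set.prod_mono Set.uIoc_subset_uIcc Set.uIoc_subset_uIcc)

/-- The second derivative of a `C²` convex function is nonnegative. -/
lemma ConvexOn.deriv_deriv_nonneg {η : ℝ → ℝ} (hηconv : ConvexOn ℝ Set.univ η)
    (hη : Differentiable ℝ η) (y : ℝ) : 0 ≤ deriv (deriv η) y := by
  have hm : Monotone (deriv η) :=
    monotoneOn_univ.1 (hηconv.monotoneOn_deriv fun x _ => hη x)
  exact hm.deriv_nonneg

/-- **Entropy decay for the spatial derivative.**
If `w` is a smooth, 1-periodic-in-`x` solution of `w_t = B(w) w_xx` on `ℝ × [0,T]`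
with `B ≥ 0` continuously differentiable, and `η` is a `C²` convex function, then
`t ↦ ∫₀¹ η(∂ₓw(x,t)) dx` is nonincreasing on `[0,T]`. -/
theorem entropy_decay_of_derivative (T : ℝ) (hT : 0 < T)
    (B : ℝ → ℝ) (hBreg : ContDiff ℝ 1 B) (hB0 : ∀ ξ : ℝ, 0 ≤ B ξ)
    (w : ℝ → ℝ → ℝ) (hw : ContDiff ℝ (⊤ : ℕ∞) (fun p : ℝ × ℝ => w p.1 p.2))
    (hper : ∀ x t : ℝ, w (x + 1) t = w x t)
    (heq : ∀ x : ℝ, ∀ t ∈ Set.Icc (0 : ℝ) T,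
      deriv (fun s => w x s) t = B (w x t) * iteratedDeriv 2 (fun y => w y t) x)
    (η : ℝ → ℝ) (hηreg : ContDiff ℝ 2 η) (hηconv : ConvexOn ℝ Set.univ η) :
    AntitoneOn (fun t => ∫ x in (0 : ℝ)..1, η (deriv (fun y => w y t) x))
      (Set.Icc 0 T) := by
  set f : ℝ × ℝ → ℝ := fun p => w p.1 p.2 with hf
  set z : ℝ × ℝ → ℝ := fun p => fderiv ℝ f p (1, 0) with hz
  set v : ℝ × ℝ → ℝ := fun p => fderiv ℝ f p (0, 1) with hv
  have hzs : ContDiff ℝ (⊤ : ℕ∞) z := contDiff_fderiv_apply_const hw _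
  have hvs : ContDiff ℝ (⊤ : ℕ∞) v := contDiff_fderiv_apply_const hw _
  have hfd : Differentiable ℝ f := hw.differentiable (by simp)
  have hzd : Differentiable ℝ z := hzs.differentiable (by simp)
  have hvd : Differentiable ℝ v := hvs.differentiable (by simp)
  have hzx : ∀ x t, deriv (fun y => w y t) x = z (x, t) := fun x t =>
    (hasDerivAt_fst_slice hfd x t).deriv
  have hvt : ∀ x t, deriv (fun s => w x s) t = v (x, t) := fun x t =>
    (hasDerivAt_snd_slice hfd x t).deriv
  have hpde : ∀ x, ∀ t ∈ Set.Icc (0 : ℝ) T,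
      v (x, t) = B (w x t) * fderiv ℝ z (x, t) (1, 0) := by
    intro x t ht
    rw [← hvt, heq x t ht, iteratedDeriv_succ, iteratedDeriv_one]
    rw [funext fun y => hzx y t, (hasDerivAt_fst_slice hzd x t).deriv]
  have hmixed : ∀ p, fderiv ℝ z p (0, 1) = fderiv ℝ v p (1, 0) := fun p =>
    fderiv_fderiv_apply_comm hw p _ _
  have hzper : ∀ t, z (1, t) = z (0, t) := by
    intro t
    rw [← hzx, ← hzx, ← zero_add (1 : ℝ), ← deriv_comp_add_const]
    simp only [hper]
  have hvper : ∀ t, v (1, t) = v (0, t) := by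
    intro t
    rw [← hvt, ← hvt]
    congr 1
    funext s
    simpa using hper 0 s
  have hη1 : Differentiable ℝ η := hηreg.differentiable (by norm_num)
  have hη'reg : ContDiff ℝ 1 (deriv η) := hηreg.deriv'
  have hη'c : Continuous (deriv η) := hη'reg.continuous
  have hη'd : Differentiable ℝ (deriv η) := hη'reg.differentiable (by norm_num)
  have hη''c : Continuous (deriv (deriv η)) := hη'reg.continuous_deriv le_rfl
  have hzc := hzs.continuous
  have hvc := hvs.continuous
  have hzxc : Continuous fun p => fderiv ℝ z p (1, 0) :=
    (contDiff_fderiv_apply_const hzs _).continuous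
  have hztc : Continuous fun p => fderiv ℝ z p (0, 1) :=
    (contDiff_fderiv_apply_const hzs _).continuous
  have hdiss : ∀ t ∈ Set.Icc (0 : ℝ) T,
      ∫ x in (0 : ℝ)..1, deriv η (z (x, t)) * fderiv ℝ z (x, t) (0, 1) ≤ 0 := by
    intro t ht
    have hparts := intervalIntegral.integral_mul_deriv_eq_deriv_mul (a := 0) (b := 1)
      (u := fun x => deriv η (z (x, t))) (v := fun x => v (x, t))
      (u' := fun x => deriv (deriv η) (z (x, t)) * fderiv ℝ z (x, t) (1, 0))
      (v' := fun x => fderiv ℝ v (x, t) (1, 0))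
      (fun x _ => (hη'd _).hasDerivAt.comp x (hasDerivAt_fst_slice hzd x t))
      (fun x _ => hasDerivAt_fst_slice hvd x t)
      (Continuous.intervalIntegrable (by fun_prop) _ _)
      (Continuous.intervalIntegrable (by
        simp only [← hmixed]
        exact hztc.comp (by fun_prop)) _ _)
    simp only [hmixed]
    rw [hparts, hzper, hvper, sub_self, zero_sub, neg_nonpos]
    refine intervalIntegral.integral_nonneg zero_le_one fun x _ => ?_
    rw [hpde x t ht]
    have h1 := mul_nonneg (mul_nonneg (hηconv.deriv_deriv_nonneg hη1 (z (x, t))) (hB0 (w x t)))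
      (sq_nonneg (fderiv ℝ z (x, t) (1, 0)))
    linarith
  intro a ha b hb hab
  have hkey := integral_sub_integral_eq_integral_integral (h := fun p => η (z p))
    (h' := fun p => deriv η (z p) * fderiv ℝ z p (0, 1)) (hη1.continuous.comp hzc)
    ((hη'c.comp hzc).mul hztc)
    (fun x t => (hη1 _).hasDerivAt.comp t (hasDerivAt_snd_slice hzd x t)) 0 1 a b
  have hle : ∫ t in a..b, ∫ x in (0 : ℝ)..1,
      deriv η (z (x, t)) * fderiv ℝ z (x, t) (0, 1) ≤ 0 := by
    rw [← neg_nonneg, ← intervalIntegral.integral_neg]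
    exact intervalIntegral.integral_nonneg hab fun t ht =>
      neg_nonneg.2 (hdiss t ⟨ha.1.trans ht.1, ht.2.trans hb.2⟩)
  simp only [hzx]
  linarith
end

section
/- Let B : ℝ → ℝ be twice continuously differentiable with B(ξ) ≥ 0 for all ξ, and let w : ℝ × [0,T] → ℝ be a smooth function, 1-periodic in x, satisfying ∂_t w = B(w) ∂_x² w on ℝ × [0,T]. Then the function t ↦ ∫₀¹ |∂_x² w(x,t)| dx is nonincreasing on [0,T]. -/
set_option autoImplicit false

section PartialDerivatives

/-- Partial derivative with respect to the first variable. -/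
noncomputable def partialFst (f : ℝ × ℝ → ℝ) (p : ℝ × ℝ) : ℝ := fderiv ℝ f p (1, 0)

/-- Partial derivative with respect to the second variable. -/
noncomputable def partialSnd (f : ℝ × ℝ → ℝ) (p : ℝ × ℝ) : ℝ := fderiv ℝ f p (0, 1)

lemma contDiff_partialFst {f : ℝ × ℝ → ℝ} (hf : ContDiff ℝ (⊤ : ℕ∞) f) :
    ContDiff ℝ (⊤ : ℕ∞) (partialFst f) :=
  (hf.fderiv_right (by simp)).clm_apply contDiff_const

lemma contDiff_partialSnd {f : ℝ × ℝ → ℝ} (hf : ContDiff ℝ (⊤ : ℕ∞) f) :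
    ContDiff ℝ (⊤ : ℕ∞) (partialSnd f) :=
  (hf.fderiv_right (by simp)).clm_apply contDiff_const

lemma hasDerivAt_partialFst {f : ℝ × ℝ → ℝ} {x t : ℝ} (hf : DifferentiableAt ℝ f (x, t)) :
    HasDerivAt (fun s => f (s, t)) (partialFst f (x, t)) x :=
  hf.hasFDerivAt.comp_hasDerivAt x ((hasDerivAt_id x).prodMk (hasDerivAt_const x t))

lemma hasDerivAt_partialSnd {f : ℝ × ℝ → ℝ} {x t : ℝ} (hf : DifferentiableAt ℝ f (x, t)) :
    HasDerivAt (fun s => f (x, s)) (partialSnd f (x, t)) t :=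
  hf.hasFDerivAt.comp_hasDerivAt t ((hasDerivAt_const t x).prodMk (hasDerivAt_id t))

lemma partialSnd_partialFst {f : ℝ × ℝ → ℝ} (hf : ContDiff ℝ (⊤ : ℕ∞) f) :
    partialSnd (partialFst f) = partialFst (partialSnd f) := by
  funext p
  have hd : DifferentiableAt ℝ (fderiv ℝ f) p :=
    (hf.fderiv_right (m := (⊤ : ℕ∞)) (by simp)).differentiable (by simp) p
  have hsymm : IsSymmSndFDerivAt ℝ f p :=
    (contDiff_infty.1 hf 2).contDiffAt.isSymmSndFDerivAt (by simp)
  have happly (u v : ℝ × ℝ) :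
      fderiv ℝ (fun q => fderiv ℝ f q u) p v = fderiv ℝ (fderiv ℝ f) p v u := by
    rw [fderiv_clm_apply hd (differentiableAt_const u)]
    simp
  change fderiv ℝ (fun q => fderiv ℝ f q (1, 0)) p (0, 1) =
    fderiv ℝ (fun q => fderiv ℝ f q (0, 1)) p (1, 0)
  rw [happly, happly, hsymm]

lemma partialFst_add_right {f : ℝ × ℝ → ℝ} {c : ℝ × ℝ} (hf : ∀ p, f (p + c) = f p)
    (p : ℝ × ℝ) : partialFst f (p + c) = partialFst f p := by
  rw [partialFst, ← fderiv_comp_add_right, funext hf, partialFst]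

lemma partialSnd_add_right {f : ℝ × ℝ → ℝ} {c : ℝ × ℝ} (hf : ∀ p, f (p + c) = f p)
    (p : ℝ × ℝ) : partialSnd f (p + c) = partialSnd f p := by
  rw [partialSnd, ← fderiv_comp_add_right, funext hf, partialSnd]

lemma iteratedDeriv_two_eq_partialFst {f : ℝ × ℝ → ℝ} (hf : ContDiff ℝ (⊤ : ℕ∞) f) (x t : ℝ) :
    iteratedDeriv 2 (fun s => f (s, t)) x = partialFst (partialFst f) (x, t) := by
  have h : deriv (fun s => f (s, t)) = fun s => partialFst f (s, t) :=
    funext fun s => (hasDerivAt_partialFst (hf.differentiable (by simp) _)).deriv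
  rw [iteratedDeriv_succ', iteratedDeriv_one, h]
  exact (hasDerivAt_partialFst ((contDiff_partialFst hf).differentiable (by simp) _)).deriv

/-- Differentiation under the integral sign for a continuously differentiable integrand. -/
lemma hasDerivAt_intervalIntegral_partialSnd {f : ℝ × ℝ → ℝ} (hf : ContDiff ℝ 1 f) (a b t : ℝ) :
    HasDerivAt (fun s => ∫ x in a..b, f (x, s)) (∫ x in a..b, partialSnd f (x, t)) t := by
  have hcont : Continuous (partialSnd f) :=
    (hf.continuous_fderiv one_ne_zero).clm_apply continuous_const
  obtain ⟨C, hC⟩ := (isCompact_uIcc (a := a) (b := b)).prod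
    (isCompact_Icc (a := t - 1) (b := t + 1)) |>.exists_bound_of_continuousOn hcont.continuousOn
  refine (intervalIntegral.hasDerivAt_integral_of_dominated_loc_of_deriv_le
    (F := fun s x => f (x, s)) (F' := fun s x => partialSnd f (x, s)) (bound := fun _ => C)
    (Icc_mem_nhds (sub_one_lt t) (lt_add_one t)) (.of_forall fun s => ?_) ?_ ?_
    (.of_forall fun x hx s hs => hC (x, s) ⟨Set.uIoc_subset_uIcc hx, hs⟩) (by simp)
    (.of_forall fun x _ s _ => hasDerivAt_partialSnd (hf.differentiable one_ne_zero _))).2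
  · exact (hf.continuous.comp (by fun_prop)).aestronglyMeasurable
  · exact (hf.continuous.comp (by fun_prop)).intervalIntegrable _ _
  · exact (hcont.comp (by fun_prop)).aestronglyMeasurable

end PartialDerivatives

section RegularizedAbs

/-- Smooth convex approximation of the absolute value. -/
noncomputable def regAbs (ε y : ℝ) : ℝ := √(y ^ 2 + ε ^ 2)

lemma regAbs_pos {ε : ℝ} (hε : 0 < ε) (y : ℝ) : 0 < regAbs ε y := by
  unfold regAbs
  positivity

lemma regAbs_sq (ε y : ℝ) : regAbs ε y ^ 2 = y ^ 2 + ε ^ 2 :=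
  Real.sq_sqrt (by positivity)

lemma abs_le_regAbs (ε y : ℝ) : |y| ≤ regAbs ε y :=
  Real.abs_le_sqrt (by nlinarith [sq_nonneg ε])

lemma le_regAbs (ε y : ℝ) : ε ≤ regAbs ε y :=
  Real.le_sqrt_of_sq_le (by nlinarith [sq_nonneg y])

lemma regAbs_le {ε : ℝ} (hε : 0 < ε) (y : ℝ) : regAbs ε y ≤ |y| + ε :=
  Real.sqrt_le_iff.2 ⟨by positivity, by nlinarith [sq_abs y, abs_nonneg y]⟩

lemma contDiff_regAbs {ε : ℝ} (hε : 0 < ε) {n : ℕ∞} : ContDiff ℝ n (regAbs ε) :=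
  ContDiff.sqrt (by fun_prop) fun y => by positivity

lemma HasDerivAt.regAbs {ε : ℝ} (hε : 0 < ε) {y : ℝ → ℝ} {y' x : ℝ} (hy : HasDerivAt y y' x) :
    HasDerivAt (fun s => regAbs ε (y s)) (y x / _root_.regAbs ε (y x) * y') x := by
  have h := ((hy.pow 2).add_const (ε ^ 2)).sqrt (by simp; positivity)
  refine h.congr_deriv ?_
  have := (regAbs_pos hε (y x)).ne'
  simp only [_root_.regAbs, Pi.pow_apply] at this ⊢
  field_simp
  simp only [Nat.cast_ofNat, Nat.add_one_sub_one, pow_one]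
  ring

/-- Regularized Kato inequality `∫ sign(y) (a y)'' ≤ 0` over a period. -/
lemma integral_regAbs_deriv_mul_le {ε C : ℝ} (hε : 0 < ε) {y y' g' g'' a a' a'' : ℝ → ℝ}
    (hy : ∀ x, HasDerivAt y (y' x) x) (hg' : ∀ x, HasDerivAt g' (g'' x) x)
    (ha' : ∀ x, HasDerivAt a' (a'' x) x) (hg : ∀ x, g' x = a' x * y x + a x * y' x)
    (ha : ∀ x, 0 ≤ a x) (hy'c : Continuous y') (hg''c : Continuous g'') (ha''c : Continuous a'')
    (hyp : y 1 = y 0) (hgp : g' 1 = g' 0) (hap : a' 1 = a' 0)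
    (hC : ∀ x ∈ Set.Icc (0 : ℝ) 1, |a'' x| ≤ C) :
    ∫ x in (0 : ℝ)..1, y x / regAbs ε (y x) * g'' x ≤ ε * C := by
  have hS (x : ℝ) : regAbs ε (y x) ≠ 0 := (regAbs_pos hε _).ne'
  have hyc : Continuous y := continuous_iff_continuousAt.2 fun x => (hy x).continuousAt
  have hg'c : Continuous g' := continuous_iff_continuousAt.2 fun x => (hg' x).continuousAt
  have ha'c : Continuous a' := continuous_iff_continuousAt.2 fun x => (ha' x).continuousAt
  have hSc : Continuous fun x => regAbs ε (y x) :=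
    (contDiff_regAbs hε (n := 0)).continuous.comp hyc
  set F' : ℝ → ℝ := fun x => ε ^ 2 * y' x * (g' x - a' x * y x) / regAbs ε (y x) ^ 3 +
    y x / regAbs ε (y x) * g'' x + ε ^ 2 / regAbs ε (y x) * a'' x with hF'
  have hF'c : Continuous F' := by
    have hS3 (x : ℝ) : regAbs ε (y x) ^ 3 ≠ 0 := pow_ne_zero 3 (hS x)
    fun_prop (disch := assumption)
  have hF (x : ℝ) : HasDerivAt
      (fun x => y x / regAbs ε (y x) * g' x + ε ^ 2 / regAbs ε (y x) * a' x) (F' x) x := by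
    have h := (((hy x).div ((hy x).regAbs hε) (hS x)).mul (hg' x)).add
      (((hasDerivAt_const x (ε ^ 2)).div ((hy x).regAbs hε) (hS x)).mul (ha' x))
    refine h.congr_deriv ?_
    have hne := hS x
    have hsq := regAbs_sq ε (y x)
    simp only [hF', Pi.div_apply]
    field_simp
    rw [hsq]
    ring
  have hint : ∫ x in (0 : ℝ)..1, F' x = 0 := by
    rw [intervalIntegral.integral_eq_sub_of_hasDerivAt (fun x _ => hF x)
      (hF'c.intervalIntegrable _ _), hyp, hgp, hap, sub_self]
  have hle : ∀ x ∈ Set.Icc (0 : ℝ) 1, y x / regAbs ε (y x) * g'' x ≤ F' x + ε * C := by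
    intro x hx
    have hpos := regAbs_pos hε (y x)
    have hconv : 0 ≤ ε ^ 2 * y' x * (g' x - a' x * y x) / regAbs ε (y x) ^ 3 := by
      have : ε ^ 2 * y' x * (g' x - a' x * y x) = ε ^ 2 * (a x * y' x ^ 2) := by
        rw [hg]
        ring
      rw [this]
      have := ha x
      positivity
    have hcoef : ε ^ 2 / regAbs ε (y x) ≤ ε := by
      rw [div_le_iff₀ hpos]
      nlinarith [le_regAbs ε (y x)]
    have herr : -(ε ^ 2 / regAbs ε (y x) * a'' x) ≤ ε * C := by
      rw [← mul_neg]
      calc ε ^ 2 / regAbs ε (y x) * -a'' x ≤ ε ^ 2 / regAbs ε (y x) * |a'' x| := by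
            gcongr
            exact neg_le_abs _
        _ ≤ ε * C := mul_le_mul hcoef (hC x hx) (abs_nonneg _) hε.le
    simp only [hF']
    linarith
  calc ∫ x in (0 : ℝ)..1, y x / regAbs ε (y x) * g'' x
      ≤ ∫ x in (0 : ℝ)..1, (F' x + ε * C) :=
        intervalIntegral.integral_mono_on zero_le_one
          (((hyc.div hSc hS).mul hg''c).intervalIntegrable _ _)
          ((hF'c.add continuous_const).intervalIntegrable _ _) hle
    _ = ε * C := by
        rw [intervalIntegral.integral_add (hF'c.intervalIntegrable _ _) (by simp), hint]
        simp

/-- A space-time function `Y` with `∂ₜ Y = ∂ₓ² G`, where `G = a Y` and `a ≥ 0`, has nonincreasing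
`L¹` norm over a period. -/
lemma antitoneOn_integral_abs_of_partialSnd_eq {T : ℝ} {Y G a a' a'' : ℝ × ℝ → ℝ}
    (hY : ContDiff ℝ (⊤ : ℕ∞) Y) (hG : ContDiff ℝ (⊤ : ℕ∞) G)
    (hYG : partialSnd Y = partialFst (partialFst G))
    (ha : ∀ x t, HasDerivAt (fun s => a (s, t)) (a' (x, t)) x)
    (ha' : ∀ x t, HasDerivAt (fun s => a' (s, t)) (a'' (x, t)) x) (ha''c : Continuous a'')
    (ha0 : ∀ p, 0 ≤ a p) (heq : ∀ x, ∀ t ∈ Set.Icc 0 T, G (x, t) = a (x, t) * Y (x, t))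
    (hYp : ∀ p, Y (p + (1, 0)) = Y p) (hGp : ∀ p, G (p + (1, 0)) = G p)
    (hap : ∀ p, a' (p + (1, 0)) = a' p) :
    AntitoneOn (fun t => ∫ x in (0 : ℝ)..1, |Y (x, t)|) (Set.Icc 0 T) := by
  have hGx := contDiff_partialFst hG
  obtain ⟨C, hC⟩ := (isCompact_Icc (a := (0 : ℝ)) (b := 1)).prod
    (isCompact_Icc (a := 0) (b := T)) |>.exists_bound_of_continuousOn ha''c.continuousOn
  have hYcont (t : ℝ) : Continuous fun x => Y (x, t) := hY.continuous.comp (by fun_prop)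
  have hkato (ε : ℝ) (hε : 0 < ε) (t : ℝ) (ht : t ∈ Set.Icc 0 T) :
      ∫ x in (0 : ℝ)..1, Y (x, t) / regAbs ε (Y (x, t)) * partialFst (partialFst G) (x, t)
        ≤ ε * C := by
    refine integral_regAbs_deriv_mul_le hε (y' := fun x => partialFst Y (x, t))
      (g' := fun x => partialFst G (x, t)) (a := fun x => a (x, t)) (a' := fun x => a' (x, t))
      (a'' := fun x => a'' (x, t))
      (fun x => hasDerivAt_partialFst (hY.differentiable (by simp) _))
      (fun x => hasDerivAt_partialFst (hGx.differentiable (by simp) _))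
      (fun x => ha' x t) (fun x => ?_) (fun x => ha0 _)
      ((contDiff_partialFst hY).continuous.comp (by fun_prop))
      ((contDiff_partialFst hGx).continuous.comp (by fun_prop))
      (ha''c.comp (by fun_prop)) ?_ ?_ ?_ (fun x hx => hC (x, t) ⟨hx, ht⟩)
    · have hprod := (ha x t).mul
        (hasDerivAt_partialFst (hY.differentiable (by simp) (x, t)))
      refine (hasDerivAt_partialFst (hG.differentiable (by simp) (x, t))).unique ?_
      exact hprod.congr_of_eventuallyEq (.of_forall fun s => heq s t ht)
    · simpa using hYp (0, t)
    · simpa using partialFst_add_right hGp (0, t)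
    · simpa using hap (0, t)
  have hderiv (ε : ℝ) (hε : 0 < ε) (t : ℝ) :
      HasDerivAt (fun t => (∫ x in (0 : ℝ)..1, regAbs ε (Y (x, t))) - ε * C * t)
        ((∫ x in (0 : ℝ)..1,
          Y (x, t) / regAbs ε (Y (x, t)) * partialFst (partialFst G) (x, t)) - ε * C) t := by
    have hreg : ContDiff ℝ 1 fun p => regAbs ε (Y p) :=
      (contDiff_regAbs hε (n := 1)).comp (hY.of_le (by exact_mod_cast le_top))
    have h := (hasDerivAt_intervalIntegral_partialSnd hreg 0 1 t).sub
      ((hasDerivAt_id t).const_mul (ε * C))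
    refine h.congr_deriv ?_
    rw [mul_one]
    congr 2
    funext x
    refine (hasDerivAt_partialSnd (hreg.differentiable one_ne_zero (x, t))).unique ?_
    rw [← hYG]
    exact (hasDerivAt_partialSnd (hY.differentiable (by simp) (x, t))).regAbs hε
  intro s hs t ht hst
  have hbound (ε : ℝ) (hε : 0 < ε) : ∫ x in (0 : ℝ)..1, |Y (x, t)| ≤
      (∫ x in (0 : ℝ)..1, |Y (x, s)|) + ε * (1 + C * (t - s)) := by
    have hanti := antitoneOn_of_deriv_nonpos (convex_Icc 0 T)
      (fun r _ => (hderiv ε hε r).continuousAt.continuousWithinAt)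
      (fun r _ => (hderiv ε hε r).differentiableAt.differentiableWithinAt)
      (fun r hr => by
        rw [(hderiv ε hε r).deriv]
        exact sub_nonpos.2 (hkato ε hε r (interior_subset hr))) hs ht hst
    have hregc (r : ℝ) : Continuous fun x => regAbs ε (Y (x, r)) :=
      (contDiff_regAbs hε (n := 0)).continuous.comp (hYcont r)
    have hlow : ∫ x in (0 : ℝ)..1, |Y (x, t)| ≤ ∫ x in (0 : ℝ)..1, regAbs ε (Y (x, t)) :=
      intervalIntegral.integral_mono_on zero_le_one ((hYcont t).abs.intervalIntegrable _ _)
        ((hregc t).intervalIntegrable _ _) fun x _ => abs_le_regAbs _ _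
    have hupp : ∫ x in (0 : ℝ)..1, regAbs ε (Y (x, s)) ≤ (∫ x in (0 : ℝ)..1, |Y (x, s)|) + ε := by
      calc ∫ x in (0 : ℝ)..1, regAbs ε (Y (x, s)) ≤ ∫ x in (0 : ℝ)..1, (|Y (x, s)| + ε) :=
            intervalIntegral.integral_mono_on zero_le_one ((hregc s).intervalIntegrable _ _)
              (((hYcont s).abs.add continuous_const).intervalIntegrable _ _)
              fun x _ => regAbs_le hε _
        _ = _ := by
            rw [intervalIntegral.integral_add ((hYcont s).abs.intervalIntegrable _ _) (by simp)]
            simp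
    simp only at hanti
    linarith
  have hlim : Filter.Tendsto
      (fun ε : ℝ => (∫ x in (0 : ℝ)..1, |Y (x, s)|) + ε * (1 + C * (t - s)))
      (nhdsWithin 0 (Set.Ioi 0)) (nhds (∫ x in (0 : ℝ)..1, |Y (x, s)|)) := by
    refine Filter.Tendsto.mono_left ?_ nhdsWithin_le_nhds
    exact Continuous.tendsto' (by fun_prop) _ _ (by simp)
  exact ge_of_tendsto hlim (eventually_mem_nhdsWithin.mono hbound)

end RegularizedAbs

/-- **BV bound on `∂ₓw` for the continuous problem.**
If `w` is a smooth, 1-periodic-in-`x` solution of `w_t = B(w) w_xx` on `ℝ × [0,T]`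
with `B ≥ 0` twice continuously differentiable, then `t ↦ ∫₀¹ |∂ₓ²w(x,t)| dx`
is nonincreasing on `[0,T]`. -/
theorem second_derivative_L1_decay (T : ℝ) (hT : 0 < T)
    (B : ℝ → ℝ) (hBreg : ContDiff ℝ 2 B) (hB0 : ∀ ξ : ℝ, 0 ≤ B ξ)
    (w : ℝ → ℝ → ℝ) (hw : ContDiff ℝ (⊤ : ℕ∞) (fun p : ℝ × ℝ => w p.1 p.2))
    (hper : ∀ x t : ℝ, w (x + 1) t = w x t)
    (heq : ∀ x : ℝ, ∀ t ∈ Set.Icc (0 : ℝ) T,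
      deriv (fun s => w x s) t = B (w x t) * iteratedDeriv 2 (fun y => w y t) x) :
    AntitoneOn (fun t => ∫ x in (0 : ℝ)..1, |iteratedDeriv 2 (fun y => w y t) x|)
      (Set.Icc 0 T) := by
  set W : ℝ × ℝ → ℝ := fun p => w p.1 p.2
  have hWx := contDiff_partialFst hw
  have hWp (p : ℝ × ℝ) : W (p + (1, 0)) = W p := by simpa [W] using hper p.1 p.2
  have hWxp := partialFst_add_right hWp
  have hB' : ContDiff ℝ 1 (deriv B) :=
    (contDiff_succ_iff_deriv.1 (show ContDiff ℝ (1 + 1) B by rwa [one_add_one_eq_two])).2.2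
  have hdW (x t : ℝ) := hasDerivAt_partialFst (hw.differentiable (by simp) (x, t))
  have hiter (x t : ℝ) :
      iteratedDeriv 2 (fun y => w y t) x = partialFst (partialFst W) (x, t) :=
    iteratedDeriv_two_eq_partialFst hw x t
  simp only [hiter] at heq ⊢
  refine antitoneOn_integral_abs_of_partialSnd_eq (G := partialSnd W) (a := fun p => B (W p))
    (a' := fun p => deriv B (W p) * partialFst W p)
    (a'' := fun p => deriv (deriv B) (W p) * partialFst W p * partialFst W p +
      deriv B (W p) * partialFst (partialFst W) p)
    (contDiff_partialFst hWx) (contDiff_partialSnd hw) ?_ (fun x t => ?_) (fun x t => ?_) ?_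
    (fun p => hB0 _) (fun x t ht => ?_) (partialFst_add_right hWxp)
    (partialSnd_add_right hWp) (fun p => by rw [hWp, hWxp])
  · rw [partialSnd_partialFst hWx, partialSnd_partialFst hw]
  · exact (hBreg.differentiable two_ne_zero _).hasDerivAt.comp x (hdW x t)
  · exact ((hB'.differentiable one_ne_zero _).hasDerivAt.comp x (hdW x t)).mul
      (hasDerivAt_partialFst (hWx.differentiable (by simp) (x, t)))
  · have h0 := hw.continuous
    have h1 := hWx.continuous
    have h2 := (contDiff_partialFst hWx).continuous
    have h3 := hB'.continuous
    have h4 := hB'.continuous_deriv le_rfl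
    exact (((h4.comp h0).mul h1).mul h1).add ((h3.comp h0).mul h2)
  · rw [← (hasDerivAt_partialSnd (hw.differentiable (by simp) (x, t))).deriv]
    exact heq x t ht
end

section
/- Let B : ℝ → ℝ be twice continuously differentiable with B(ξ) ≥ 0 for all ξ, let w : ℝ × [0,T] → ℝ be a smooth function satisfying ∂_t w = B(w) ∂_x² w, and set y = ∂_x² w. Then for every twice continuously differentiable convex function η : ℝ → ℝ, the pointwise inequality ∂_t η(y) ≤ ∂_x²( B(w) η(y) ) + ∂_x²( B(w) ) · ( η'(y) y − η(y) ) holds at every point (x,t). -/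
set_option autoImplicit false

theorem two_le_infty : (2 : WithTop ℕ∞) ≤ ((⊤ : ℕ∞) : WithTop ℕ∞) := 
  WithTop.coe_le_coe.2 (le_top : (2 : ℕ∞) ≤ ⊤)

/-- The partial derivative in the first variable, as a Fréchet derivative. -/
theorem hasDerivAt_fst_of_differentiable {F : ℝ × ℝ → ℝ} (hF : Differentiable ℝ F) (x t : ℝ) :
    HasDerivAt (fun y => F (y, t)) (fderiv ℝ F (x, t) (1, 0)) x :=
  (hF (x, t)).hasFDerivAt.comp_hasDerivAt x ((hasDerivAt_id x).prodMk (hasDerivAt_const x t))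

/-- The partial derivative in the second variable, as a Fréchet derivative. -/
theorem hasDerivAt_snd_of_differentiable {F : ℝ × ℝ → ℝ} (hF : Differentiable ℝ F) (x t : ℝ) :
    HasDerivAt (fun s => F (x, s)) (fderiv ℝ F (x, t) (0, 1)) t :=
  (hF (x, t)).hasFDerivAt.comp_hasDerivAt t ((hasDerivAt_const t x).prodMk (hasDerivAt_id t))

theorem contDiff_two_slice {F : ℝ × ℝ → ℝ} (hF : ContDiff ℝ (⊤ : ℕ∞) F) (t : ℝ) :
    ContDiff ℝ 2 (fun y => F (y, t)) :=
  (hF.of_le two_le_infty).comp (contDiff_prodMk_left t)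

theorem contDiff_deriv_fst {F : ℝ × ℝ → ℝ} (hF : ContDiff ℝ (⊤ : ℕ∞) F) :
    ContDiff ℝ (⊤ : ℕ∞) (fun p : ℝ × ℝ => deriv (fun y => F (y, p.2)) p.1) := by
  have hd : Differentiable ℝ F := hF.differentiable (by simp)
  have h : (fun p : ℝ × ℝ => deriv (fun y => F (y, p.2)) p.1)
      = fun p => fderiv ℝ F p (1, 0) :=
    funext fun p => (hasDerivAt_fst_of_differentiable hd p.1 p.2).deriv
  rw [h]
  exact (hF.fderiv_right (m := (⊤ : ℕ∞)) (by simp)).clm_apply contDiff_const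

/-- Mixed partial derivatives of a smooth function of two real variables commute. -/
theorem deriv_deriv_comm {F : ℝ × ℝ → ℝ} (hF : ContDiff ℝ (⊤ : ℕ∞) F) (x t : ℝ) :
    deriv (fun s => deriv (fun y => F (y, s)) x) t
      = deriv (fun y => deriv (fun s => F (y, s)) t) x := by
  have hd : Differentiable ℝ F := hF.differentiable (by simp)
  have hd2 : Differentiable ℝ (fderiv ℝ F) :=
    (hF.fderiv_right (m := (⊤ : ℕ∞)) (by simp)).differentiable (by simp)
  simp only [(hasDerivAt_fst_of_differentiable hd _ _).deriv,
    (hasDerivAt_snd_of_differentiable hd _ _).deriv]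
  have hsymm : IsSymmSndFDerivAt ℝ F (x, t) :=
    hF.contDiffAt.isSymmSndFDerivAt (by simpa using two_le_infty)
  rw [(hasDerivAt_snd_of_differentiable (F := fun p => fderiv ℝ F p (1, 0))
      (fun p => (hd2 p).clm_apply (differentiableAt_const _)) x t).deriv,
    (hasDerivAt_fst_of_differentiable (F := fun p => fderiv ℝ F p (0, 1))
      (fun p => (hd2 p).clm_apply (differentiableAt_const _)) x t).deriv,
    fderiv_clm_apply (hd2 _) (differentiableAt_const _),
    fderiv_clm_apply (hd2 _) (differentiableAt_const _)]
  simpa using hsymm (0, 1) (1, 0)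

theorem iteratedDeriv_two_eq (f : ℝ → ℝ) : iteratedDeriv 2 f = deriv (deriv f) := by
  rw [iteratedDeriv_succ, iteratedDeriv_one]

/-- The second-order Leibniz rule. -/
theorem iteratedDeriv_two_mul {f g : ℝ → ℝ} (hf : ContDiff ℝ 2 f) (hg : ContDiff ℝ 2 g) (x : ℝ) :
    iteratedDeriv 2 (fun y => f y * g y) x
      = iteratedDeriv 2 f x * g x + 2 * (deriv f x * deriv g x) + f x * iteratedDeriv 2 g x := by
  have hf1 : Differentiable ℝ f := hf.differentiable (by simp)
  have hg1 : Differentiable ℝ g := hg.differentiable (by simp)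
  have hf2 : Differentiable ℝ (deriv f) := hf.differentiable_deriv_two
  have hg2 : Differentiable ℝ (deriv g) := hg.differentiable_deriv_two
  have h : deriv (fun y => f y * g y) = fun y => deriv f y * g y + f y * deriv g y :=
    funext fun y => deriv_fun_mul (hf1 y) (hg1 y)
  simp only [iteratedDeriv_two_eq]
  rw [h, (((hf2 x).hasDerivAt.fun_mul (hg1 x).hasDerivAt).fun_add
    ((hf1 x).hasDerivAt.fun_mul (hg2 x).hasDerivAt)).deriv]
  ring

/-- The second-order chain rule. -/
theorem iteratedDeriv_two_comp {f g : ℝ → ℝ} (hf : ContDiff ℝ 2 f) (hg : ContDiff ℝ 2 g) (x : ℝ) :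
    iteratedDeriv 2 (fun y => f (g y)) x
      = iteratedDeriv 2 f (g x) * deriv g x ^ 2 + deriv f (g x) * iteratedDeriv 2 g x := by
  have hf1 : Differentiable ℝ f := hf.differentiable (by simp)
  have hg1 : Differentiable ℝ g := hg.differentiable (by simp)
  have hf2 : Differentiable ℝ (deriv f) := hf.differentiable_deriv_two
  have hg2 : Differentiable ℝ (deriv g) := hg.differentiable_deriv_two
  have h : deriv (fun y => f (g y)) = fun y => deriv f (g y) * deriv g y :=
    funext fun y => ((hf1 (g y)).hasDerivAt.comp y (hg1 y).hasDerivAt).deriv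
  simp only [iteratedDeriv_two_eq]
  have hcomp : HasDerivAt (fun y => deriv f (g y)) (deriv (deriv f) (g x) * deriv g x) x :=
    (hf2 (g x)).hasDerivAt.comp x (hg1 x).hasDerivAt
  rw [h, (hcomp.fun_mul (hg2 x).hasDerivAt).deriv]
  ring

theorem ConvexOn.iteratedDeriv_two_nonneg {f : ℝ → ℝ} (hf : Differentiable ℝ f)
    (hconv : ConvexOn ℝ Set.univ f) (x : ℝ) : 0 ≤ iteratedDeriv 2 f x := by
  have hmono : Monotone (deriv f) :=
    monotoneOn_univ.1 (hconv.monotoneOn_deriv fun y _ => hf y)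
  rw [iteratedDeriv_two_eq]
  exact hmono.deriv_nonneg

/-- **Pointwise entropy inequality for `y = ∂ₓ²w`.**
If `w` is a smooth solution of `w_t = B(w) w_xx` on `ℝ × [0,T]` with `B ≥ 0` twice
continuously differentiable, and `η` is a `C²` convex function, then with `y = ∂ₓ²w`,
`∂ₜ η(y) ≤ ∂ₓ²(B(w) η(y)) + ∂ₓ²(B(w)) (η'(y) y - η(y))` at every point. -/
theorem pointwise_entropy_inequality (T : ℝ) (hT : 0 < T)
    (B : ℝ → ℝ) (hBreg : ContDiff ℝ 2 B) (hB0 : ∀ ξ : ℝ, 0 ≤ B ξ)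
    (w : ℝ → ℝ → ℝ) (hw : ContDiff ℝ (⊤ : ℕ∞) (fun p : ℝ × ℝ => w p.1 p.2))
    (heq : ∀ x : ℝ, ∀ t ∈ Set.Icc (0 : ℝ) T,
      deriv (fun s => w x s) t = B (w x t) * iteratedDeriv 2 (fun y => w y t) x)
    (η : ℝ → ℝ) (hηreg : ContDiff ℝ 2 η) (hηconv : ConvexOn ℝ Set.univ η) :
    ∀ x : ℝ, ∀ t ∈ Set.Icc (0 : ℝ) T,
      deriv (fun s => η (iteratedDeriv 2 (fun y => w y s) x)) t
        ≤ iteratedDeriv 2 (fun y => B (w y t) * η (iteratedDeriv 2 (fun z => w z t) y)) x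
          + iteratedDeriv 2 (fun y => B (w y t)) x
            * (deriv η (iteratedDeriv 2 (fun y => w y t) x)
                 * iteratedDeriv 2 (fun y => w y t) x
               - η (iteratedDeriv 2 (fun y => w y t) x)) := by
  intro x t ht
  have hd1 : ContDiff ℝ (⊤ : ℕ∞) (fun p : ℝ × ℝ => deriv (fun z => w z p.2) p.1) :=
    contDiff_deriv_fst hw
  have hd : ContDiff ℝ (⊤ : ℕ∞) (fun p : ℝ × ℝ => iteratedDeriv 2 (fun z => w z p.2) p.1) := by
    simp only [iteratedDeriv_two_eq]
    exact contDiff_deriv_fst hd1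
  have hwt : ContDiff ℝ 2 (fun y => w y t) :=
    contDiff_two_slice hw t
  have hY : ContDiff ℝ 2 (fun y => iteratedDeriv 2 (fun z => w z t) y) :=
    contDiff_two_slice hd t
  have hB : ContDiff ℝ 2 (fun y => B (w y t)) := hBreg.comp hwt
  have hη1 : Differentiable ℝ η := hηreg.differentiable (by simp)
  have hYt : DifferentiableAt ℝ (fun s => iteratedDeriv 2 (fun y => w y s) x) t :=
    (hasDerivAt_snd_of_differentiable
      (F := fun p : ℝ × ℝ => iteratedDeriv 2 (fun z => w z p.2) p.1)
      (hd.differentiable (by simp)) x t).differentiableAt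
  have hcomm : deriv (fun s => iteratedDeriv 2 (fun y => w y s) x) t
      = iteratedDeriv 2 (fun y => B (w y t) * iteratedDeriv 2 (fun z => w z t) y) x := by
    simp only [← heq _ t ht]
    simp only [iteratedDeriv_two_eq]
    have h : deriv (fun y => deriv (fun s => w y s) t)
        = fun y => deriv (fun s => deriv (fun z => w z s) y) t :=
      funext fun y => (deriv_deriv_comm hw y t).symm
    rw [h]
    exact deriv_deriv_comm hd1 x t
  have hlhs : deriv (fun s => η (iteratedDeriv 2 (fun y => w y s) x)) t
      = deriv η (iteratedDeriv 2 (fun y => w y t) x)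
        * deriv (fun s => iteratedDeriv 2 (fun y => w y s) x) t :=
    ((hη1 _).hasDerivAt.comp t hYt.hasDerivAt).deriv
  have hηY : ContDiff ℝ 2 (fun y => η (iteratedDeriv 2 (fun z => w z t) y)) := hηreg.comp hY
  rw [hlhs, hcomm, iteratedDeriv_two_mul hB hY, iteratedDeriv_two_mul hB hηY]
  have hcomp := iteratedDeriv_two_comp hηreg hY x
  have hcomp1 : deriv (fun y => η (iteratedDeriv 2 (fun z => w z t) y)) x
      = deriv η (iteratedDeriv 2 (fun z => w z t) x)
        * deriv (fun y => iteratedDeriv 2 (fun z => w z t) y) x :=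
    ((hη1 _).hasDerivAt.comp x (hY.differentiable (by simp) x).hasDerivAt).deriv
  rw [hcomp, hcomp1]
  have hnonneg := mul_nonneg (hB0 (w x t)) (mul_nonneg
    (hηconv.iteratedDeriv_two_nonneg hη1 (iteratedDeriv 2 (fun z => w z t) x))
    (sq_nonneg (deriv (fun y => iteratedDeriv 2 (fun z => w z t) y) x)))
  linear_combination hnonneg
end
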